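/- arXiv:2007.08936 — 2 statements merged into one kernel-verified Lean document; each statement's English description precedes it below -/
import Mathlib

section
/- Let 𝒵 be a σ-compact metrizable topological space and (Z_k)_{k∈ℕ} a strictly stationary sequence of 𝒵-valued random variables with marginal distribution θ = L(Z₁). Let h : 𝒵² → ℝ be a continuous, symmetric, degenerate and positive semidefinite kernel with ∫ |h|^{2+ε} dθ² < ∞ and E|h(Z₁, Z₁)|^{1+ε/2} < ∞ for some ε > 0. Suppose the sequence (Z_k) satisfies the α-mixing condition α(n) = O(n^{-r}) for some r > 1 + 2ε^{-1}. Then, with V = V_h(Z₁, ..., Zₙ) the V-statistic with kernel h, nV converges in distribution to Σ_{k=1}^∞ λ_k ζ_k², where (λ_k, φ_k) are the pairs of non-negative eigenvalues and matching eigenfunctions of the integral operator f ↦ ∫ h(·, z) f(z) dθ(z) on L²(θ), and (ζ_k)_{k∈ℕ} is a sequence of centered Gaussian random variables with covariance structure Cov(ζ_i, ζ_j) = lim_{n→∞} n^{-1} Σ_{t,u=1}^n Cov(φ_i(Z_t), φ_j(Z_u)). -/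
open MeasureTheory Filter Topology ProbabilityTheory
open scoped ENNReal NNReal

noncomputable section

/-- The shift map on path space. -/
def shift {𝒵 : Type*} (x : ℕ → 𝒵) : ℕ → 𝒵 := fun i => x (i + 1)

/-- The `α`-dependence coefficient of two sub-σ-algebras. -/
def alphaDep {Ω : Type*} [MeasurableSpace Ω] (P : Measure Ω)
    (A B : MeasurableSpace Ω) : ℝ :=
  sSup {r | ∃ a b : Set Ω, MeasurableSet[A] a ∧ MeasurableSet[B] b ∧
    r = |(P (a ∩ b)).toReal - (P a).toReal * (P b).toReal|}

/-- The σ-algebra generated by `Z 0, …, Z (l-1)`, i.e. by `Z₁, …, Z_l`. -/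
def sigmaUpTo {Ω 𝒵 : Type*} [m𝒵 : MeasurableSpace 𝒵] (Z : ℕ → Ω → 𝒵) (l : ℕ) :
    MeasurableSpace Ω :=
  ⨆ i ∈ Finset.range l, MeasurableSpace.comap (Z i) m𝒵

/-- The σ-algebra generated by `Z l, Z (l+1), …`. -/
def sigmaFrom {Ω 𝒵 : Type*} [m𝒵 : MeasurableSpace 𝒵] (Z : ℕ → Ω → 𝒵) (l : ℕ) :
    MeasurableSpace Ω :=
  ⨆ i ∈ {i : ℕ | l ≤ i}, MeasurableSpace.comap (Z i) m𝒵

/-- The α-mixing coefficient `α(n) = sup_l α(σ(Z₁,…,Z_l), σ(Z_{l+n}, …))` of the process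
(with the 0-based indexing `Z_k = Z (k-1)`). -/
def alphaProc {Ω 𝒵 : Type*} [MeasurableSpace Ω] [MeasurableSpace 𝒵]
    (P : Measure Ω) (Z : ℕ → Ω → 𝒵) (n : ℕ) : ℝ :=
  sSup {r | ∃ l : ℕ, r = alphaDep P (sigmaUpTo Z (l + 1)) (sigmaFrom Z (l + n))}

noncomputable section

lemma cov_aux {Ω : Type*} {m1 m0 : MeasurableSpace Ω} {P : Measure Ω} [IsProbabilityMeasure P]
    (hm : m1 ≤ m0) {X Y : Ω → ℝ} {A κ : ℝ}
    (hX : StronglyMeasurable[m1] X) (hXA : ∀ ω, |X ω| ≤ A) (hY : Integrable Y P)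
    (hκ : ∀ a, MeasurableSet[m1] a → |∫ ω in a, Y ω ∂P - P.real a * ∫ ω, Y ω ∂P| ≤ κ) :
    |∫ ω, X ω * Y ω ∂P - (∫ ω, X ω ∂P) * ∫ ω, Y ω ∂P| ≤ 2 * A * κ := by
  have hX0 : StronglyMeasurable X := hX.mono hm
  have hXint : Integrable X P := Integrable.of_bound hX0.aestronglyMeasurable A
    (Eventually.of_forall (by simpa using hXA))
  have hXY : Integrable (fun ω => X ω * Y ω) P :=
    hY.bdd_mul hX0.aestronglyMeasurable (Eventually.of_forall (by simpa using hXA))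
  set G : Ω → ℝ := fun ω => (P[Y | m1]) ω - ∫ ω, Y ω ∂P with hG
  have hGm : StronglyMeasurable[m1] G := stronglyMeasurable_condExp.sub stronglyMeasurable_const
  have hGi : Integrable G P := integrable_condExp.sub (integrable_const _)
  have hXG : Integrable (fun ω => X ω * G ω) P :=
    hGi.bdd_mul hX0.aestronglyMeasurable (Eventually.of_forall (by simpa using hXA))
  have h1 : ∫ ω, X ω * Y ω ∂P = ∫ ω, X ω * (P[Y | m1]) ω ∂P := by
    have := condExp_mul_of_stronglyMeasurable_left hX hXY hY
    rw [← integral_condExp hm (f := fun ω => X ω * Y ω)]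
    exact integral_congr_ae this
  have hXc : Integrable (fun ω => X ω * (P[Y | m1]) ω) P :=
    integrable_condExp.bdd_mul hX0.aestronglyMeasurable (Eventually.of_forall (by simpa using hXA))
  have h2 : ∫ ω, X ω * Y ω ∂P - (∫ ω, X ω ∂P) * ∫ ω, Y ω ∂P = ∫ ω, X ω * G ω ∂P := by
    rw [h1, ← integral_mul_const, ← integral_sub hXc (hXint.mul_const _)]
    congr 1; ext ω; simp only [hG]; ring
  have hset : ∀ a, MeasurableSet[m1] a → |∫ ω in a, G ω ∂P| ≤ κ := by
    intro a ha
    have : ∫ ω in a, G ω ∂P = ∫ ω in a, Y ω ∂P - P.real a * ∫ ω, Y ω ∂P := by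
      simp only [hG]
      rw [integral_sub integrable_condExp.integrableOn (integrable_const _).integrableOn,
        setIntegral_condExp hm hY ha]
      simp
    rw [this]; exact hκ a ha
  have ha : MeasurableSet[m1] {ω | 0 ≤ G ω} := hGm.measurable measurableSet_Ici
  have h3 : ∫ ω, |G ω| ∂P ≤ 2 * κ := by
    have e1 : ∫ ω in {ω | 0 ≤ G ω}, |G ω| ∂P = ∫ ω in {ω | 0 ≤ G ω}, G ω ∂P :=
      setIntegral_congr_fun (hm _ ha) (fun ω hω => abs_of_nonneg hω)
    have e2 : ∫ ω in {ω | 0 ≤ G ω}ᶜ, |G ω| ∂P = ∫ ω in {ω | 0 ≤ G ω}ᶜ, - G ω ∂P :=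
      setIntegral_congr_fun (hm _ ha).compl (fun ω hω => abs_of_neg (by simpa using hω))
    rw [← integral_add_compl (hm _ ha) hGi.abs, e1, e2, integral_neg]
    have b1 := abs_le.1 (hset _ ha)
    have b2 := abs_le.1 (hset _ ha.compl)
    linarith [b1.2, b2.1]
  rw [h2]
  calc |∫ ω, X ω * G ω ∂P| ≤ ∫ ω, |X ω * G ω| ∂P := abs_integral_le_integral_abs
    _ ≤ ∫ ω, A * |G ω| ∂P := by
        apply integral_mono hXG.abs (hGi.abs.const_mul _)
        intro ω; simp only [abs_mul]
        exact mul_le_mul_of_nonneg_right (hXA ω) (abs_nonneg _)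
    _ = A * ∫ ω, |G ω| ∂P := integral_const_mul _ _
    _ ≤ A * (2 * κ) := by
        have : (0:ℝ) ≤ A := by
          have hne : Nonempty Ω := by
            by_contra hcon
            rw [not_nonempty_iff] at hcon
            have := measure_univ (μ := P)
            simp [Set.univ_eq_empty_iff.2 hcon] at this
          exact (abs_nonneg _).trans (hXA hne.some)
        gcongr
    _ = 2 * A * κ := by ring

lemma cov_bdd {Ω : Type*} {m1 m2 m0 : MeasurableSpace Ω} {P : Measure Ω} [IsProbabilityMeasure P]
    (hm1 : m1 ≤ m0) (hm2 : m2 ≤ m0) {X Y : Ω → ℝ} {A B κ : ℝ}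
    (hX : StronglyMeasurable[m1] X) (hXA : ∀ ω, |X ω| ≤ A)
    (hY : StronglyMeasurable[m2] Y) (hYB : ∀ ω, |Y ω| ≤ B)
    (hκ : ∀ a b, MeasurableSet[m1] a → MeasurableSet[m2] b →
      |P.real (a ∩ b) - P.real a * P.real b| ≤ κ) :
    |∫ ω, X ω * Y ω ∂P - (∫ ω, X ω ∂P) * ∫ ω, Y ω ∂P| ≤ 4 * A * B * κ := by
  have hYint : Integrable Y P := Integrable.of_bound (hY.mono hm2).aestronglyMeasurable B
    (Eventually.of_forall (by simpa using hYB))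
  have := cov_aux (κ := 2 * B * κ) hm1 hX hXA hYint (fun a ha => by
    have hi : Integrable (a.indicator (fun _ => (1:ℝ))) P :=
      (integrable_const _).indicator (hm1 _ ha)
    have := cov_aux (κ := κ) hm2 hY hYB hi (fun b hb => by
      rw [integral_indicator (hm1 _ ha), Measure.restrict_restrict (hm1 _ ha),
        integral_indicator (hm1 _ ha)]
      simpa [mul_comm] using hκ a b ha hb)
    rw [integral_indicator (hm1 _ ha)] at this
    have e : ∫ ω, Y ω * a.indicator (fun _ => (1:ℝ)) ω ∂P = ∫ ω in a, Y ω ∂P := by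
      rw [← integral_indicator (hm1 _ ha)]
      congr 1; ext ω; by_cases h : ω ∈ a <;> simp [h]
    rw [e] at this
    simpa [mul_comm] using this)
  calc _ ≤ _ := this
    _ = _ := by ring

lemma cov_bdd_complex {Ω : Type*} {m1 m2 m0 : MeasurableSpace Ω} {P : Measure Ω} [IsProbabilityMeasure P]
    (hm1 : m1 ≤ m0) (hm2 : m2 ≤ m0) {X Y : Ω → ℂ} {κ : ℝ}
    (hX : StronglyMeasurable[m1] X) (hXA : ∀ ω, ‖X ω‖ ≤ 1)
    (hY : StronglyMeasurable[m2] Y) (hYB : ∀ ω, ‖Y ω‖ ≤ 1)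
    (hκ : ∀ a b, MeasurableSet[m1] a → MeasurableSet[m2] b →
      |P.real (a ∩ b) - P.real a * P.real b| ≤ κ) :
    ‖∫ ω, X ω * Y ω ∂P - (∫ ω, X ω ∂P) * ∫ ω, Y ω ∂P‖ ≤ 16 * κ := by
  have hXr : StronglyMeasurable[m1] (fun ω => (X ω).re) :=
    Complex.continuous_re.comp_stronglyMeasurable hX
  have hXi : StronglyMeasurable[m1] (fun ω => (X ω).im) :=
    Complex.continuous_im.comp_stronglyMeasurable hX
  have hYr : StronglyMeasurable[m2] (fun ω => (Y ω).re) :=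
    Complex.continuous_re.comp_stronglyMeasurable hY
  have hYi : StronglyMeasurable[m2] (fun ω => (Y ω).im) :=
    Complex.continuous_im.comp_stronglyMeasurable hY
  have bXr : ∀ ω, |(X ω).re| ≤ 1 := fun ω => (Complex.abs_re_le_norm _).trans (hXA ω)
  have bXi : ∀ ω, |(X ω).im| ≤ 1 := fun ω => (Complex.abs_im_le_norm _).trans (hXA ω)
  have bYr : ∀ ω, |(Y ω).re| ≤ 1 := fun ω => (Complex.abs_re_le_norm _).trans (hYB ω)
  have bYi : ∀ ω, |(Y ω).im| ≤ 1 := fun ω => (Complex.abs_im_le_norm _).trans (hYB ω)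
  have c1 := cov_bdd hm1 hm2 hXr bXr hYr bYr hκ
  have c2 := cov_bdd hm1 hm2 hXr bXr hYi bYi hκ
  have c3 := cov_bdd hm1 hm2 hXi bXi hYr bYr hκ
  have c4 := cov_bdd hm1 hm2 hXi bXi hYi bYi hκ
  have hXint : Integrable X P := Integrable.of_bound (hX.mono hm1).aestronglyMeasurable 1
    (Eventually.of_forall hXA)
  have hYint : Integrable Y P := Integrable.of_bound (hY.mono hm2).aestronglyMeasurable 1
    (Eventually.of_forall hYB)
  have hXY : Integrable (fun ω => X ω * Y ω) P :=
    hYint.bdd_mul (hX.mono hm1).aestronglyMeasurable (Eventually.of_forall hXA)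
  have ib : ∀ {f g : Ω → ℝ}, StronglyMeasurable[m1] f → StronglyMeasurable[m2] g →
      (∀ ω, |f ω| ≤ 1) → (∀ ω, |g ω| ≤ 1) → Integrable (fun ω => f ω * g ω) P := by
    intro f g hf hg h1 h2
    refine Integrable.of_bound ((hf.mono hm1).mul (hg.mono hm2)).aestronglyMeasurable 1
      (Eventually.of_forall fun ω => ?_)
    simp only [Real.norm_eq_abs, abs_mul]
    exact mul_le_one₀ (h1 ω) (abs_nonneg _) (h2 ω)
  have re_int : ∀ {f : Ω → ℂ}, Integrable f P → (∫ ω, f ω ∂P).re = ∫ ω, (f ω).re ∂P :=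
    fun hf => (integral_re hf).symm
  have im_int : ∀ {f : Ω → ℂ}, Integrable f P → (∫ ω, f ω ∂P).im = ∫ ω, (f ω).im ∂P :=
    fun hf => (integral_im hf).symm
  have hre : (∫ ω, X ω * Y ω ∂P - (∫ ω, X ω ∂P) * ∫ ω, Y ω ∂P).re =
      (∫ ω, (X ω).re * (Y ω).re ∂P - (∫ ω, (X ω).re ∂P) * ∫ ω, (Y ω).re ∂P) -
      (∫ ω, (X ω).im * (Y ω).im ∂P - (∫ ω, (X ω).im ∂P) * ∫ ω, (Y ω).im ∂P) := by
    rw [Complex.sub_re, Complex.mul_re, re_int hXY, re_int hXint, re_int hYint, im_int hXint,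
      im_int hYint]
    simp only [Complex.mul_re]
    rw [integral_sub (ib hXr hYr bXr bYr) (ib hXi hYi bXi bYi)]
    ring
  have him : (∫ ω, X ω * Y ω ∂P - (∫ ω, X ω ∂P) * ∫ ω, Y ω ∂P).im =
      (∫ ω, (X ω).re * (Y ω).im ∂P - (∫ ω, (X ω).re ∂P) * ∫ ω, (Y ω).im ∂P) +
      (∫ ω, (X ω).im * (Y ω).re ∂P - (∫ ω, (X ω).im ∂P) * ∫ ω, (Y ω).re ∂P) := by
    rw [Complex.sub_im, Complex.mul_im, im_int hXY, re_int hXint, re_int hYint, im_int hXint,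
      im_int hYint]
    simp only [Complex.mul_im]
    rw [integral_add (ib hXr hYi bXr bYi) (ib hXi hYr bXi bYr)]
    ring
  refine (Complex.norm_le_abs_re_add_abs_im _).trans ?_
  rw [hre, him]
  refine (add_le_add (abs_sub _ _) (abs_add_le _ _)).trans ?_
  linarith

lemma rpow_trunc_le {p x M : ℝ} (hp : 2 < p) (hM : 0 < M) (hx : M ≤ x) (y : ℝ) (hy : 0 ≤ y) :
    y * x ≤ M ^ (2 - p) * (y ^ p + x ^ p) := by
  have hx0 : 0 < x := hM.trans_le hx
  have h1 : x ≤ M ^ (2 - p) * x ^ (p - 1) := by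
    have : x = x ^ (2 - p) * x ^ (p - 1) := by
      rw [← Real.rpow_add hx0]; ring_nf; simp
    nth_rewrite 1 [this]
    apply mul_le_mul_of_nonneg_right _ (by positivity)
    exact Real.rpow_le_rpow_of_nonpos hM hx (by linarith)
  have h2 : y * x ^ (p - 1) ≤ y ^ p + x ^ p := by
    rcases le_total y x with h | h
    · have : y * x ^ (p - 1) ≤ x * x ^ (p - 1) := by gcongr
      have e : x * x ^ (p - 1) = x ^ p := by
        nth_rewrite 1 [← Real.rpow_one x]; rw [← Real.rpow_add hx0]; ring_nf
      have : 0 ≤ y ^ p := by positivity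
      linarith
    · have hy0 : 0 < y := hx0.trans_le h
      have : y * x ^ (p - 1) ≤ y * y ^ (p - 1) := by
        gcongr; linarith
      have e : y * y ^ (p - 1) = y ^ p := by
        nth_rewrite 1 [← Real.rpow_one y]; rw [← Real.rpow_add hy0]; ring_nf
      have : 0 ≤ x ^ p := by positivity
      linarith
  calc y * x ≤ y * (M ^ (2 - p) * x ^ (p - 1)) := by gcongr
    _ = M ^ (2 - p) * (y * x ^ (p - 1)) := by ring
    _ ≤ _ := by gcongr

end

noncomputable section

lemma memLp_of_rpow {Ω : Type*} {m0 : MeasurableSpace Ω} {P : Measure Ω}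
    {X : Ω → ℝ} {p : ℝ} (hp : 0 < p) (hX : AEStronglyMeasurable X P)
    (h : Integrable (fun ω => |X ω| ^ p) P) : MemLp X (ENNReal.ofReal p) P := by
  rw [← integrable_norm_rpow_iff hX (by simpa using hp) (by simp)]
  simpa [ENNReal.toReal_ofReal hp.le] using h

lemma memLp_two_of_rpow {Ω : Type*} {m0 : MeasurableSpace Ω} {P : Measure Ω} [IsFiniteMeasure P]
    {X : Ω → ℝ} {p : ℝ} (hp : 2 < p) (hX : AEStronglyMeasurable X P)
    (h : Integrable (fun ω => |X ω| ^ p) P) : MemLp X 2 P := by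
  refine (memLp_of_rpow (by linarith) hX h).mono_exponent ?_
  rw [show (2 : ℝ≥0∞) = ENNReal.ofReal 2 by simp]
  exact ENNReal.ofReal_le_ofReal hp.le

lemma cov_tail {Ω : Type*} {m0 : MeasurableSpace Ω} {P : Measure Ω}
    [IsProbabilityMeasure P] {X Y U V : Ω → ℝ} {p M : ℝ} (hp : 2 < p) (hM : 0 < M)
    (hX : AEStronglyMeasurable X P) (hY : AEStronglyMeasurable Y P)
    (hU : AEStronglyMeasurable U P) (hV : AEStronglyMeasurable V P)
    (hXp : Integrable (fun ω => |X ω| ^ p) P) (hYp : Integrable (fun ω => |Y ω| ^ p) P)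
    (hUX : ∀ ω, |U ω| ≤ |X ω|) (hVY : ∀ ω, V ω = 0 ∨ (V ω = Y ω ∧ M ≤ |Y ω|)) :
    |∫ ω, U ω * V ω ∂P - (∫ ω, U ω ∂P) * ∫ ω, V ω ∂P| ≤
      2 * M ^ (2 - p) * (∫ ω, |X ω| ^ p ∂P + ∫ ω, |Y ω| ^ p ∂P) := by
  have hX2 := memLp_two_of_rpow hp hX hXp
  have hY2 := memLp_two_of_rpow hp hY hYp
  have hVY' : ∀ ω, |V ω| ≤ |Y ω| := fun ω => by
    rcases hVY ω with h | h
    · simp [h]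
    · rw [h.1]
  have hU2 : MemLp U 2 P := hX2.mono hU (Eventually.of_forall fun ω => by simpa using hUX ω)
  have hV2 : MemLp V 2 P := hY2.mono hV (Eventually.of_forall fun ω => by simpa using hVY' ω)
  have hUi : Integrable U P := hU2.integrable (by norm_num)
  have hVi : Integrable V P := hV2.integrable (by norm_num)
  have hMp : 0 < M ^ (2 - p) := Real.rpow_pos_of_pos hM _
  have key : ∀ (x : ℝ) ω, |x| * |V ω| ≤ M ^ (2 - p) * (|x| ^ p + |Y ω| ^ p) := fun x ω => by
    rcases hVY ω with h | h
    · simp only [h, abs_zero, mul_zero]; positivity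
    · rw [h.1]; exact rpow_trunc_le hp hM h.2 _ (abs_nonneg _)
  have hUV : Integrable (fun ω => U ω * V ω) P := hU2.integrable_mul hV2
  have b1 : |∫ ω, U ω * V ω ∂P| ≤ M ^ (2 - p) * (∫ ω, |X ω| ^ p ∂P + ∫ ω, |Y ω| ^ p ∂P) := by
    rw [← integral_add hXp hYp, ← integral_const_mul]
    refine abs_integral_le_integral_abs.trans (integral_mono hUV.abs ((hXp.add hYp).const_mul _) ?_)
    intro ω
    simp only [abs_mul]
    exact (mul_le_mul_of_nonneg_right (hUX ω) (abs_nonneg _)).trans (key _ _)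
  have b2 : |(∫ ω, U ω ∂P) * ∫ ω, V ω ∂P| ≤
      M ^ (2 - p) * (∫ ω, |X ω| ^ p ∂P + ∫ ω, |Y ω| ^ p ∂P) := by
    have hx : ∀ x : ℝ, |x| * |∫ ω, V ω ∂P| ≤ M ^ (2 - p) * (|x| ^ p + ∫ ω, |Y ω| ^ p ∂P) := by
      intro x
      calc |x| * |∫ ω, V ω ∂P| ≤ |x| * ∫ ω, |V ω| ∂P := by
            gcongr; exact abs_integral_le_integral_abs
        _ = ∫ ω, |x| * |V ω| ∂P := (integral_const_mul _ _).symm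
        _ ≤ ∫ ω, M ^ (2 - p) * (|x| ^ p + |Y ω| ^ p) ∂P := by
            refine integral_mono (hVi.abs.const_mul _)
              (((integrable_const _).add hYp).const_mul _) (fun ω => key x ω)
        _ = _ := by
            rw [integral_const_mul, integral_add (integrable_const _) hYp]; simp
    calc |(∫ ω, U ω ∂P) * ∫ ω, V ω ∂P| = |∫ ω, U ω ∂P| * |∫ ω, V ω ∂P| := abs_mul _ _
      _ ≤ (∫ ω, |U ω| ∂P) * |∫ ω, V ω ∂P| := by
            gcongr; exact abs_integral_le_integral_abs
      _ = ∫ ω, |U ω| * |∫ ω, V ω ∂P| ∂P := (integral_mul_const _ _).symm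
      _ ≤ ∫ ω, M ^ (2 - p) * (|X ω| ^ p + ∫ ω, |Y ω| ^ p ∂P) ∂P := by
            refine integral_mono (hUi.abs.mul_const _)
              ((hXp.add (integrable_const _)).const_mul _) (fun ω => ?_)
            exact (mul_le_mul_of_nonneg_right (hUX ω) (abs_nonneg _)).trans (hx _)
      _ = _ := by
            rw [integral_const_mul, integral_add hXp (integrable_const _)]; simp
  refine (abs_sub _ _).trans ?_
  linarith

/-- truncation -/
def trunc (M x : ℝ) : ℝ := if |x| ≤ M then x else 0

lemma measurable_trunc (M : ℝ) : Measurable (trunc M) := by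
  unfold trunc
  exact Measurable.ite (measurableSet_le measurable_norm measurable_const) measurable_id
    measurable_const

lemma abs_trunc_le {M : ℝ} (hM : 0 ≤ M) (x : ℝ) : |trunc M x| ≤ M := by
  unfold trunc; split_ifs with h
  · exact h
  · simpa using hM

lemma abs_trunc_le' (M x : ℝ) : |trunc M x| ≤ |x| := by
  unfold trunc; split_ifs with h <;> simp

lemma trunc_tail (M x : ℝ) : x - trunc M x = 0 ∨ (x - trunc M x = x ∧ M ≤ |x|) := by
  unfold trunc; split_ifs with h
  · simp
  · right; exact ⟨by simp, (not_le.1 h).le⟩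

lemma cov_unbdd {Ω : Type*} {m1 m2 m0 : MeasurableSpace Ω} {P : Measure Ω}
    [IsProbabilityMeasure P]
    (hm1 : m1 ≤ m0) (hm2 : m2 ≤ m0) {X Y : Ω → ℝ} {κ p M : ℝ} (hp : 2 < p) (hM : 0 < M)
    (hX : StronglyMeasurable[m1] X) (hY : StronglyMeasurable[m2] Y)
    (hXp : Integrable (fun ω => |X ω| ^ p) P) (hYp : Integrable (fun ω => |Y ω| ^ p) P)
    (hκ : ∀ a b, MeasurableSet[m1] a → MeasurableSet[m2] b →
      |P.real (a ∩ b) - P.real a * P.real b| ≤ κ) :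
    |∫ ω, X ω * Y ω ∂P - (∫ ω, X ω ∂P) * ∫ ω, Y ω ∂P| ≤
      4 * M ^ 2 * κ + 4 * M ^ (2 - p) * (∫ ω, |X ω| ^ p ∂P + ∫ ω, |Y ω| ^ p ∂P) := by
  have hX1 : StronglyMeasurable[m1] (fun ω => trunc M (X ω)) :=
    ((measurable_trunc M).comp hX.measurable).stronglyMeasurable
  have hY1 : StronglyMeasurable[m2] (fun ω => trunc M (Y ω)) :=
    ((measurable_trunc M).comp hY.measurable).stronglyMeasurable
  have c1 := cov_bdd hm1 hm2 hX1 (fun ω => abs_trunc_le hM.le _) hY1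
    (fun ω => abs_trunc_le hM.le _) hκ
  have aX := (hX.mono hm1).aestronglyMeasurable (μ := P)
  have aY := (hY.mono hm2).aestronglyMeasurable (μ := P)
  have aX1 := (hX1.mono hm1).aestronglyMeasurable (μ := P)
  have aY1 := (hY1.mono hm2).aestronglyMeasurable (μ := P)
  have c2 := cov_tail (U := fun ω => trunc M (X ω)) (V := fun ω => Y ω - trunc M (Y ω)) hp hM
    aX aY aX1 (aY.sub aY1) hXp hYp (fun ω => abs_trunc_le' _ _) (fun ω => trunc_tail _ _)
  have c3 := cov_tail (U := fun ω => Y ω) (V := fun ω => X ω - trunc M (X ω)) hp hM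
    aY aX aY (aX.sub aX1) hYp hXp (fun ω => le_rfl) (fun ω => trunc_tail _ _)
  have hX2 := memLp_two_of_rpow hp aX hXp
  have hY2 := memLp_two_of_rpow hp aY hYp
  have hX12 : MemLp (fun ω => trunc M (X ω)) 2 P :=
    hX2.mono aX1 (Eventually.of_forall fun ω => by simpa using abs_trunc_le' _ _)
  have hY12 : MemLp (fun ω => trunc M (Y ω)) 2 P :=
    hY2.mono aY1 (Eventually.of_forall fun ω => by simpa using abs_trunc_le' _ _)
  have iX := hX2.integrable (by norm_num)
  have iY := hY2.integrable (by norm_num)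
  have iX1 := hX12.integrable (by norm_num)
  have iY1 := hY12.integrable (by norm_num)
  have iXY : Integrable (fun ω => X ω * Y ω) P := hX2.integrable_mul hY2
  have iX1Y : Integrable (fun ω => trunc M (X ω) * Y ω) P := hX12.integrable_mul hY2
  have iX1Y1 : Integrable (fun ω => trunc M (X ω) * trunc M (Y ω)) P := hX12.integrable_mul hY12
  have iYX : Integrable (fun ω => Y ω * X ω) P := hY2.integrable_mul hX2
  have iYX1 : Integrable (fun ω => Y ω * trunc M (X ω)) P := hY2.integrable_mul hX12
  simp only [mul_sub] at c2 c3
  rw [integral_sub iX1Y iX1Y1, integral_sub iY iY1] at c2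
  rw [integral_sub iYX iYX1, integral_sub iX iX1] at c3
  have e1 : ∫ ω, Y ω * X ω ∂P = ∫ ω, X ω * Y ω ∂P := by congr 1; ext; ring
  have e2 : ∫ ω, Y ω * trunc M (X ω) ∂P = ∫ ω, trunc M (X ω) * Y ω ∂P := by congr 1; ext; ring
  rw [e1, e2] at c3
  rw [abs_le] at *
  constructor <;> nlinarith [c1.1, c1.2, c2.1, c2.2, c3.1, c3.2]

end

noncomputable section
set_option linter.unusedSectionVars false
set_option linter.unusedVariables false

/-- Bundled working hypotheses on the process. -/
structure MixProc {Ω 𝒵 : Type*} [MeasurableSpace Ω] [MeasurableSpace 𝒵]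
    (P : Measure Ω) (Z : ℕ → Ω → 𝒵) (p r C : ℝ) : Prop where
  meas : ∀ i, Measurable (Z i)
  stat : ∀ m, P.map (fun ω i => Z (i + m) ω) = P.map (fun ω i => Z i ω)
  mix : ∀ l n : ℕ, 1 ≤ n → ∀ a b, MeasurableSet[sigmaUpTo Z (l + 1)] a →
    MeasurableSet[sigmaFrom Z (l + n)] b →
      |P.real (a ∩ b) - P.real a * P.real b| ≤ C * (n : ℝ) ^ (-r)
  hp : 2 < p
  hr : 1 < r * (1 - 2 / p)
  hC : 0 ≤ C

section
variable {Ω 𝒵 : Type*} [MeasurableSpace Ω] [m𝒵 : MeasurableSpace 𝒵] {P : Measure Ω}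
  [IsProbabilityMeasure P] {Z : ℕ → Ω → 𝒵}

lemma abs_cov_le_one (a b : Set Ω) :
    |(P (a ∩ b)).toReal - (P a).toReal * (P b).toReal| ≤ 1 := by
  change |P.real (a ∩ b) - P.real a * P.real b| ≤ 1
  have h1 : P.real (a ∩ b) ≤ 1 := measureReal_le_one
  have h2 : P.real a ≤ 1 := measureReal_le_one
  have h3 : P.real b ≤ 1 := measureReal_le_one
  have h4 : 0 ≤ P.real (a ∩ b) := measureReal_nonneg
  have h5 : 0 ≤ P.real a := measureReal_nonneg
  have h6 : 0 ≤ P.real b := measureReal_nonneg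
  rw [abs_le]; constructor <;> nlinarith

lemma mix_sets {r C : ℝ}
    (hmix : ∀ n : ℕ, 1 ≤ n → alphaProc P Z n ≤ C * (n : ℝ) ^ (-r)) (l n : ℕ) (hn : 1 ≤ n)
    (a b : Set Ω) (ha : MeasurableSet[sigmaUpTo Z (l + 1)] a)
    (hb : MeasurableSet[sigmaFrom Z (l + n)] b) :
    |P.real (a ∩ b) - P.real a * P.real b| ≤ C * (n : ℝ) ^ (-r) := by
  refine le_trans ?_ (hmix n hn)
  have h1 : ∀ l : ℕ, alphaDep P (sigmaUpTo Z (l + 1)) (sigmaFrom Z (l + n)) ≤ 1 := fun l => by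
    refine Real.sSup_le ?_ zero_le_one
    rintro x ⟨a, b, -, -, rfl⟩
    exact abs_cov_le_one a b
  have h2 : |P.real (a ∩ b) - P.real a * P.real b| ≤
      alphaDep P (sigmaUpTo Z (l + 1)) (sigmaFrom Z (l + n)) := by
    refine le_csSup ⟨1, ?_⟩ ⟨a, b, ha, hb, rfl⟩
    rintro x ⟨a, b, -, -, rfl⟩
    exact abs_cov_le_one a b
  refine h2.trans (le_csSup ⟨1, ?_⟩ ⟨l, rfl⟩)
  rintro x ⟨l, rfl⟩
  exact h1 _

lemma stat_iter (hZ : ∀ i, Measurable (Z i))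
    (hstat : MeasurePreserving shift (P.map fun ω i => Z i ω) (P.map fun ω i => Z i ω)) (m : ℕ) :
    P.map (fun ω i => Z (i + m) ω) = P.map (fun ω i => Z i ω) := by
  induction m with
  | zero => simp
  | succ m ih =>
    have hm : Measurable (fun ω i => Z (i + m) ω) := measurable_pi_lambda _ fun i => hZ _
    have hs : Measurable (shift : (ℕ → 𝒵) → ℕ → 𝒵) := hstat.measurable
    have : (fun ω i => Z (i + (m + 1)) ω) = shift ∘ (fun ω i => Z (i + m) ω) := by
      ext ω i; simp only [shift, Function.comp]; rw [show i + (m + 1) = i + 1 + m by omega]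
    rw [this, ← Measure.map_map hs hm, ih, hstat.map_eq]

variable {p r C : ℝ}

lemma sigmaUpTo_le (hZ : ∀ i, Measurable (Z i)) (l : ℕ) :
    sigmaUpTo Z l ≤ ‹MeasurableSpace Ω› := by
  unfold sigmaUpTo
  exact iSup₂_le fun i _ => (hZ i).comap_le

lemma sigmaFrom_le (hZ : ∀ i, Measurable (Z i)) (l : ℕ) :
    sigmaFrom Z l ≤ ‹MeasurableSpace Ω› := by
  unfold sigmaFrom
  exact iSup₂_le fun i _ => (hZ i).comap_le

lemma measurable_sigmaUpTo {l i : ℕ} (hi : i < l) : Measurable[sigmaUpTo Z l] (Z i) := by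
  have h : MeasurableSpace.comap (Z i) m𝒵 ≤ sigmaUpTo Z l := by
    unfold sigmaUpTo
    exact le_iSup₂ (f := fun i (_ : i ∈ Finset.range l) => MeasurableSpace.comap (Z i) m𝒵) i
      (Finset.mem_range.2 hi)
  exact Measurable.of_comap_le h

lemma measurable_sigmaFrom {l i : ℕ} (hi : l ≤ i) : Measurable[sigmaFrom Z l] (Z i) := by
  have h : MeasurableSpace.comap (Z i) m𝒵 ≤ sigmaFrom Z l := by
    unfold sigmaFrom
    exact le_iSup₂ (f := fun i (_ : i ∈ {i : ℕ | l ≤ i}) => MeasurableSpace.comap (Z i) m𝒵) i hi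
  exact Measurable.of_comap_le h

namespace MixProc

lemma path_meas (H : MixProc P Z p r C) (m : ℕ) : Measurable (fun ω i => Z (i + m) ω) :=
  measurable_pi_lambda _ fun i => H.meas _

lemma integral_shift (H : MixProc P Z p r C) {E : Type*} [NormedAddCommGroup E] [NormedSpace ℝ E]
    {G : (ℕ → 𝒵) → E} (hG : StronglyMeasurable G) (m : ℕ) :
    ∫ ω, G (fun i => Z (i + m) ω) ∂P = ∫ ω, G (fun i => Z i ω) ∂P := by
  have h0 : Measurable (fun ω i => Z i ω) := by simpa using H.path_meas 0
  rw [← integral_map (φ := fun ω i => Z (i + m) ω) (H.path_meas m).aemeasurable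
    hG.aestronglyMeasurable, H.stat m, integral_map h0.aemeasurable hG.aestronglyMeasurable]

lemma integrable_shift (H : MixProc P Z p r C) {G : (ℕ → 𝒵) → ℝ} (hG : StronglyMeasurable G)
    (m : ℕ) (hi : Integrable (fun ω => G (fun i => Z i ω)) P) :
    Integrable (fun ω => G (fun i => Z (i + m) ω)) P := by
  have h0 : Measurable (fun ω i => Z i ω) := by simpa using H.path_meas 0
  have := (integrable_map_measure (μ := P) (f := fun ω i => Z (i + m) ω)
    hG.aestronglyMeasurable (H.path_meas m).aemeasurable).1 (by
      rw [H.stat m]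
      exact (integrable_map_measure hG.aestronglyMeasurable h0.aemeasurable).2 hi)
  exact this

lemma integral_one (H : MixProc P Z p r C) {Y : 𝒵 → ℝ} (hY : Measurable Y) (m : ℕ) :
    ∫ ω, Y (Z m ω) ∂P = ∫ ω, Y (Z 0 ω) ∂P := by
  have := H.integral_shift (G := fun x => Y (x 0))
    (hY.comp (measurable_pi_apply 0)).stronglyMeasurable m
  simpa using this

lemma integrable_one (H : MixProc P Z p r C) {Y : 𝒵 → ℝ} (hY : Measurable Y) (m : ℕ)
    (hi : Integrable (fun ω => Y (Z 0 ω)) P) : Integrable (fun ω => Y (Z m ω)) P := by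
  have := H.integrable_shift (G := fun x => Y (x 0))
    (hY.comp (measurable_pi_apply 0)).stronglyMeasurable m hi
  simpa using this

lemma integral_two (H : MixProc P Z p r C) {Y : 𝒵 → ℝ} (hY : Measurable Y) (t u : ℕ) :
    ∫ ω, Y (Z t ω) * Y (Z u ω) ∂P = ∫ ω, Y (Z 0 ω) * Y (Z (Nat.dist t u) ω) ∂P := by
  have key : ∀ a k : ℕ, ∫ ω, Y (Z a ω) * Y (Z (k + a) ω) ∂P
      = ∫ ω, Y (Z 0 ω) * Y (Z k ω) ∂P := fun a k => by
    have := H.integral_shift (G := fun x => Y (x 0) * Y (x k))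
      ((hY.comp (measurable_pi_apply 0)).mul
        (hY.comp (measurable_pi_apply k))).stronglyMeasurable a
    simpa using this
  rcases le_total t u with h | h
  · rw [Nat.dist_eq_sub_of_le h, ← key t (u - t), Nat.sub_add_cancel h]
  · rw [Nat.dist_eq_sub_of_le_right h, ← key u (t - u), Nat.sub_add_cancel h]
    congr 1; ext; ring

/-- `Y` is a centered measurable function with finite `p`-th moment. -/
structure Good (P : Measure Ω) (Z : ℕ → Ω → 𝒵) (p : ℝ) (Y : 𝒵 → ℝ) : Prop where
  meas : Measurable Y
  int : Integrable (fun ω => |Y (Z 0 ω)| ^ p) P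
  mean : ∫ ω, Y (Z 0 ω) ∂P = 0

lemma Good.memLp (H : MixProc P Z p r C) {Y : 𝒵 → ℝ} (hY : Good P Z p Y) (t : ℕ) :
    MemLp (fun ω => Y (Z t ω)) 2 P :=
  memLp_two_of_rpow H.hp (hY.meas.comp (H.meas t)).aestronglyMeasurable
    (H.integrable_one (Y := fun z => |Y z| ^ p) (hY.meas.abs.pow_const p) t hY.int)

lemma cov_lag (H : MixProc P Z p r C) {Y : 𝒵 → ℝ} (hY : Good P Z p Y) {w : ℝ} (hw : 0 < w)
    {k : ℕ} (hk : 1 ≤ k) :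
    |∫ ω, Y (Z 0 ω) * Y (Z k ω) ∂P| ≤ (4 * C + 8) * (w ^ 2 + w ^ (2 - p) *
      ∫ ω, |Y (Z 0 ω)| ^ p ∂P) * (k : ℝ) ^ (-(r * (1 - 2 / p))) := by
  have hk0 : (0:ℝ) < k := by exact_mod_cast hk
  have hp := H.hp
  have hM : 0 < w * (k : ℝ) ^ (r / p) := by positivity
  have hYp := hY.meas.abs.pow_const p
  have := cov_unbdd (P := P) (m1 := sigmaUpTo Z (0 + 1)) (m2 := sigmaFrom Z (0 + k))
    (sigmaUpTo_le H.meas _) (sigmaFrom_le H.meas _)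
    (X := fun ω => Y (Z 0 ω)) (Y := fun ω => Y (Z k ω)) (κ := C * (k : ℝ) ^ (-r)) hp hM
    (hY.meas.comp (measurable_sigmaUpTo (by simp))).stronglyMeasurable
    (hY.meas.comp (measurable_sigmaFrom (by simp))).stronglyMeasurable
    hY.int (H.integrable_one hYp k hY.int) (H.mix 0 k hk)
  rw [hY.mean, zero_mul, sub_zero, H.integral_one hYp k] at this
  set D := ∫ ω, |Y (Z 0 ω)| ^ p ∂P with hD
  have hD0 : 0 ≤ D := integral_nonneg fun ω => by positivity
  have e1 : (w * (k : ℝ) ^ (r / p)) ^ 2 * (k:ℝ) ^ (-r) =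
      w ^ 2 * (k : ℝ) ^ (-(r * (1 - 2 / p))) := by
    rw [mul_pow, ← Real.rpow_natCast ((k:ℝ) ^ (r / p)), ← Real.rpow_mul hk0.le, mul_assoc,
      ← Real.rpow_add hk0]
    congr 2; push_cast; field_simp; ring
  have e2 : (w * (k : ℝ) ^ (r / p)) ^ (2 - p) =
      w ^ (2 - p) * (k : ℝ) ^ (-(r * (1 - 2 / p))) := by
    rw [Real.mul_rpow hw.le (by positivity), ← Real.rpow_mul hk0.le]
    congr 2; field_simp; ring
  rw [e2] at this
  refine this.trans ?_
  have e3 : 4 * (w * (k : ℝ) ^ (r / p)) ^ 2 * (C * (k:ℝ) ^ (-r)) =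
      4 * C * (w ^ 2 * (k : ℝ) ^ (-(r * (1 - 2 / p)))) := by rw [← e1]; ring
  rw [e3]
  set K := (k : ℝ) ^ (-(r * (1 - 2 / p)))
  have hK : 0 ≤ K := by positivity
  have hw2 : 0 ≤ w ^ (2 - p) := by positivity
  have hC := H.hC
  have t1 : 0 ≤ w ^ 2 * K := by positivity
  have t2 : 0 ≤ C * (w ^ (2 - p) * D * K) := by positivity
  nlinarith

/-- summable envelope -/
def env (s : ℝ) (k : ℕ) : ℝ := if k = 0 then 1 else (k : ℝ) ^ (-s)

lemma env_nonneg (s : ℝ) (k : ℕ) : 0 ≤ env s k := by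
  unfold env; split_ifs <;> positivity

lemma env_summable {s : ℝ} (hs : 1 < s) : Summable (env s) := by
  have h := Real.summable_nat_rpow.2 (show -s < -1 by linarith)
  rw [← summable_nat_add_iff 1] at h ⊢
  refine h.congr fun k => ?_
  simp [env]

lemma sq_le_trunc {p w : ℝ} (hp : 2 < p) (hw : 0 < w) (x : ℝ) :
    x ^ 2 ≤ 2 * (w ^ 2 + w ^ (2 - p) * |x| ^ p) := by
  have h0 : 0 ≤ w ^ (2 - p) * |x| ^ p := by positivity
  rw [← sq_abs]
  rcases le_total |x| w with h | h
  · have : |x| ^ 2 ≤ w ^ 2 := by gcongr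
    nlinarith
  · have := rpow_trunc_le hp hw h |x| (abs_nonneg _)
    nlinarith

lemma cov_env (H : MixProc P Z p r C) {Y : 𝒵 → ℝ} (hY : Good P Z p Y) {w : ℝ} (hw : 0 < w)
    (k : ℕ) :
    |∫ ω, Y (Z 0 ω) * Y (Z k ω) ∂P| ≤ (4 * C + 8) * (w ^ 2 + w ^ (2 - p) *
      ∫ ω, |Y (Z 0 ω)| ^ p ∂P) * env (r * (1 - 2 / p)) k := by
  rcases Nat.eq_zero_or_pos k with rfl | hk
  · have hD0 : 0 ≤ ∫ ω, |Y (Z 0 ω)| ^ p ∂P := integral_nonneg fun ω => by positivity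
    simp only [env, if_true, mul_one]
    rw [abs_of_nonneg (integral_nonneg fun ω => mul_self_nonneg _)]
    have h2 := (Good.memLp H hY 0).integrable_mul (Good.memLp H hY 0)
    have : ∫ ω, Y (Z 0 ω) * Y (Z 0 ω) ∂P ≤
        ∫ ω, 2 * (w ^ 2 + w ^ (2 - p) * |Y (Z 0 ω)| ^ p) ∂P := by
      refine integral_mono h2 (((integrable_const _).add (hY.int.const_mul _)).const_mul _)
        fun ω => ?_
      have := sq_le_trunc H.hp hw (Y (Z 0 ω))
      simpa [sq] using this
    rw [integral_const_mul, integral_add (integrable_const _) (hY.int.const_mul _),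
      integral_const_mul] at this
    simp only [integral_const, probReal_univ, smul_eq_mul, one_mul] at this
    have h3 : 0 ≤ w ^ 2 + w ^ (2 - p) * ∫ ω, |Y (Z 0 ω)| ^ p ∂P := by positivity
    have := H.hC
    nlinarith
  · have := H.cov_lag hY hw hk
    simpa [env, hk.ne'] using this

lemma integral_sq_sum (H : MixProc P Z p r C) {Y : 𝒵 → ℝ} (hY : Good P Z p Y) (I : Finset ℕ) :
    ∫ ω, (∑ t ∈ I, Y (Z t ω)) ^ 2 ∂P =
      ∑ t ∈ I, ∑ u ∈ I, ∫ ω, Y (Z 0 ω) * Y (Z (Nat.dist t u) ω) ∂P := by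
  have hi : ∀ t u, Integrable (fun ω => Y (Z t ω) * Y (Z u ω)) P :=
    fun t u => (Good.memLp H hY t).integrable_mul (Good.memLp H hY u)
  simp_rw [sq, Finset.sum_mul_sum]
  rw [integral_finsetSum _ fun t _ => integrable_finsetSum _ fun u _ => hi t u]
  refine Finset.sum_congr rfl fun t _ => ?_
  rw [integral_finsetSum _ fun u _ => hi t u]
  exact Finset.sum_congr rfl fun u _ => H.integral_two hY.meas t u

lemma sum_dist_le {d : ℕ → ℝ} (hd : ∀ k, 0 ≤ d k) (hs : Summable d) (I : Finset ℕ) (t : ℕ) :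
    ∑ u ∈ I, d (Nat.dist t u) ≤ 2 * ∑' k, d k := by
  have h1 : ∑ u ∈ I with t ≤ u, d (Nat.dist t u) ≤ ∑' k, d k := by
    have : ∑ u ∈ I with t ≤ u, d (Nat.dist t u) =
        ∑ k ∈ (I.filter (t ≤ ·)).image (fun u => u - t), d k := by
      rw [Finset.sum_image]
      · refine Finset.sum_congr rfl fun u hu => ?_
        rw [Nat.dist_eq_sub_of_le (Finset.mem_filter.1 hu).2]
      · intro a ha b hb hab
        have := (Finset.mem_filter.1 ha).2
        have := (Finset.mem_filter.1 hb).2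
        simp only at hab; omega
    rw [this]; exact hs.sum_le_tsum _ fun k _ => hd k
  have h2 : ∑ u ∈ I with ¬ t ≤ u, d (Nat.dist t u) ≤ ∑' k, d k := by
    have : ∑ u ∈ I with ¬ t ≤ u, d (Nat.dist t u) =
        ∑ k ∈ (I.filter (¬ t ≤ ·)).image (fun u => t - u), d k := by
      rw [Finset.sum_image]
      · refine Finset.sum_congr rfl fun u hu => ?_
        rw [Nat.dist_eq_sub_of_le_right (not_le.1 (Finset.mem_filter.1 hu).2).le]
      · intro a ha b hb hab
        have := (Finset.mem_filter.1 ha).2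
        have := (Finset.mem_filter.1 hb).2
        simp only at hab; omega
    rw [this]; exact hs.sum_le_tsum _ fun k _ => hd k
  rw [← Finset.sum_filter_add_sum_filter_not I (t ≤ ·)]
  linarith

/-- The variance-bound constant. -/
def K0 (p r C : ℝ) : ℝ := 2 * (4 * C + 8) * ∑' k, env (r * (1 - 2 / p)) k

lemma K0_nonneg (H : MixProc P Z p r C) : 0 ≤ K0 p r C := by
  have := H.hC
  have : 0 ≤ ∑' k, env (r * (1 - 2 / p)) k := tsum_nonneg (env_nonneg _)
  unfold K0; positivity

lemma var_bound (H : MixProc P Z p r C) {Y : 𝒵 → ℝ} (hY : Good P Z p Y) {w : ℝ} (hw : 0 < w)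
    (I : Finset ℕ) :
    ∫ ω, (∑ t ∈ I, Y (Z t ω)) ^ 2 ∂P ≤ I.card * (K0 p r C * (w ^ 2 + w ^ (2 - p) *
      ∫ ω, |Y (Z 0 ω)| ^ p ∂P)) := by
  rw [H.integral_sq_sum hY, ← nsmul_eq_mul]
  refine Finset.sum_le_card_nsmul _ _ _ fun t _ => ?_
  set B := (4 * C + 8) * (w ^ 2 + w ^ (2 - p) * ∫ ω, |Y (Z 0 ω)| ^ p ∂P) with hB
  have hB0 : 0 ≤ B := by
    have := H.hC
    have hD0 : 0 ≤ ∫ ω, |Y (Z 0 ω)| ^ p ∂P := integral_nonneg fun ω => by positivity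
    positivity
  calc _ ≤ ∑ u ∈ I, B * env (r * (1 - 2 / p)) (Nat.dist t u) :=
        Finset.sum_le_sum fun u _ => (le_abs_self _).trans (H.cov_env hY hw _)
    _ = B * ∑ u ∈ I, env (r * (1 - 2 / p)) (Nat.dist t u) := by rw [Finset.mul_sum]
    _ ≤ B * (2 * ∑' k, env (r * (1 - 2 / p)) k) := by
        gcongr; exact sum_dist_le (env_nonneg _) (env_summable H.hr) I t
    _ = _ := by rw [hB, K0]; ring

lemma tendsto_var (H : MixProc P Z p r C) {Y : 𝒵 → ℝ} (hY : Good P Z p Y) :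
    ∃ σ2 : ℝ, Tendsto (fun n : ℕ => (n : ℝ)⁻¹ * ∫ ω, (∑ t ∈ Finset.range n, Y (Z t ω)) ^ 2 ∂P)
      atTop (𝓝 σ2) := by
  set c : ℕ → ℝ := fun k => ∫ ω, Y (Z 0 ω) * Y (Z k ω) ∂P with hc
  have hcs : Summable c := by
    refine Summable.of_norm_bounded (((env_summable H.hr).mul_left ((4 * C + 8) *
      ((1:ℝ) ^ 2 + (1:ℝ) ^ (2 - p) * ∫ ω, |Y (Z 0 ω)| ^ p ∂P)))) (fun k => ?_)
    exact H.cov_env hY one_pos k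
  set u : ℕ → ℝ := fun n => c 0 + 2 * ∑ k ∈ Finset.range n, c (k + 1) with hu
  have hut : Tendsto u atTop (𝓝 (c 0 + 2 * ∑' k, c (k + 1))) :=
    (((summable_nat_add_iff 1).2 hcs).hasSum.tendsto_sum_nat.const_mul 2).const_add _
  refine ⟨_, (hut.cesaro).congr fun n => ?_⟩
  congr 1
  rw [H.integral_sq_sum hY]
  induction n with
  | zero => simp
  | succ n ih =>
    rw [Finset.sum_range_succ, ih]
    simp_rw [Finset.sum_range_succ]
    rw [Finset.sum_add_distrib]
    have e1 : ∑ t ∈ Finset.range n, ∫ ω, Y (Z 0 ω) * Y (Z (Nat.dist t n) ω) ∂P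
        = ∑ k ∈ Finset.range n, c (k + 1) := by
      rw [← Finset.sum_range_reflect]
      refine Finset.sum_congr rfl fun t ht => ?_
      have := Finset.mem_range.1 ht
      rw [Nat.dist_eq_sub_of_le (by omega)]
      simp only [hc]; rw [show n - (n - 1 - t) = t + 1 by omega]
    have e2 : ∑ t ∈ Finset.range n, ∫ ω, Y (Z 0 ω) * Y (Z (Nat.dist n t) ω) ∂P
        = ∑ k ∈ Finset.range n, c (k + 1) := by
      rw [← e1]; refine Finset.sum_congr rfl fun t ht => ?_
      rw [Nat.dist_comm]
    rw [e1, e2, Nat.dist_self]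
    simp only [hu, hc]; ring

end MixProc
end
end

noncomputable section
set_option linter.unusedSectionVars false
set_option linter.unusedVariables false

lemma exists_blocks {r : ℝ} (hr : 1 < r) : ∃ p q : ℕ → ℕ, (∀ n, 1 ≤ p n) ∧ (∀ n, 1 ≤ q n) ∧
    Tendsto p atTop atTop ∧ Tendsto (fun n : ℕ => (p n : ℝ) / √(n:ℝ)) atTop (𝓝 0) ∧
    Tendsto (fun n : ℕ => (q n : ℝ) / p n) atTop (𝓝 0) ∧
    Tendsto (fun n : ℕ => (n : ℝ) / p n * (q n : ℝ) ^ (-r)) atTop (𝓝 0) := by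
  obtain ⟨δ, hδ0, hδ1⟩ : ∃ δ : ℝ, 0 < δ ∧ δ * (1 + 2 * r) < (r - 1) / 2 := by
    refine ⟨(r - 1) / (4 * (1 + 2 * r)), by apply div_pos <;> nlinarith, ?_⟩
    have : (1 + 2 * r) ≠ 0 := by nlinarith
    field_simp; nlinarith
  have hδ2 : 2 * δ < 1 / 2 := by nlinarith
  set a := 1 / 2 - δ with ha
  set b := 1 / 2 - 2 * δ with hb
  have ha0 : 0 < a := by linarith
  have hb0 : 0 < b := by linarith
  have tn : Tendsto (fun n : ℕ => (n:ℝ)) atTop atTop := tendsto_natCast_atTop_atTop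
  have tneg : ∀ c : ℝ, c < 0 → Tendsto (fun n : ℕ => (n:ℝ) ^ c) atTop (𝓝 0) := fun c hc => by
    have := (tendsto_rpow_neg_atTop (y := -c) (by linarith)).comp tn
    simpa [Function.comp_def] using this
  have up : ∀ (c : ℝ) (n : ℕ), ((⌈(n:ℝ) ^ c⌉₊ + 1 : ℕ) : ℝ) ≤ (n:ℝ) ^ c + 2 := fun c n => by
    have := (Nat.ceil_lt_add_one (a := (n:ℝ) ^ c) (by positivity)).le
    push_cast; linarith
  have lo : ∀ (c : ℝ) (n : ℕ), (n:ℝ) ^ c ≤ ((⌈(n:ℝ) ^ c⌉₊ + 1 : ℕ) : ℝ) := fun c n => by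
    have := Nat.le_ceil ((n:ℝ) ^ c)
    push_cast; linarith
  refine ⟨fun n => ⌈(n:ℝ) ^ a⌉₊ + 1, fun n => ⌈(n:ℝ) ^ b⌉₊ + 1, fun n => Nat.le_add_left _ _,
    fun n => Nat.le_add_left _ _, ?_, ?_, ?_, ?_⟩
  · have h1 : Tendsto (fun n : ℕ => (n:ℝ) ^ a) atTop atTop := (tendsto_rpow_atTop ha0).comp tn
    exact tendsto_atTop_mono (fun n => Nat.le_succ _) (tendsto_nat_ceil_atTop.comp h1)
  · have h : Tendsto (fun n : ℕ => (n:ℝ) ^ (-δ) + 2 * (n:ℝ) ^ (-(1/2) : ℝ)) atTop (𝓝 0) := by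
      simpa using (tneg (-δ) (by linarith)).add ((tneg (-(1/2)) (by norm_num)).const_mul 2)
    refine squeeze_zero' (Eventually.of_forall fun n => by positivity) ?_ h
    filter_upwards [eventually_gt_atTop 0] with n hn
    have hn0 : (0:ℝ) < n := by exact_mod_cast hn
    rw [Real.sqrt_eq_rpow, div_le_iff₀ (by positivity), add_mul, mul_assoc, ← Real.rpow_add hn0,
      ← Real.rpow_add hn0]
    refine (up a n).trans (le_of_eq ?_)
    rw [show -δ + 1/2 = a by rw [ha]; ring]; norm_num
  · have h : Tendsto (fun n : ℕ => (n:ℝ) ^ (-δ) + 2 * (n:ℝ) ^ (-a)) atTop (𝓝 0) := by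
      simpa using (tneg (-δ) (by linarith)).add ((tneg (-a) (by linarith)).const_mul 2)
    refine squeeze_zero' (Eventually.of_forall fun n => by positivity) ?_ h
    filter_upwards [eventually_gt_atTop 0] with n hn
    have hn0 : (0:ℝ) < n := by exact_mod_cast hn
    have hpos : (0:ℝ) < (n:ℝ) ^ a := by positivity
    have : ((⌈(n:ℝ) ^ b⌉₊ + 1 : ℕ) : ℝ) / ((⌈(n:ℝ) ^ a⌉₊ + 1 : ℕ) : ℝ) ≤
        ((n:ℝ) ^ b + 2) / (n:ℝ) ^ a :=
      div_le_div₀ (by positivity) (up b n) hpos (lo a n)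
    refine this.trans (le_of_eq ?_)
    rw [div_eq_iff hpos.ne', add_mul, mul_assoc, ← Real.rpow_add hn0, ← Real.rpow_add hn0,
      show -δ + a = b by rw [ha, hb]; ring]
    norm_num
  · have h := tneg (1 - a - b * r) (by rw [ha, hb]; nlinarith)
    refine squeeze_zero' (Eventually.of_forall fun n => by positivity) ?_ h
    filter_upwards [eventually_gt_atTop 0] with n hn
    have hn0 : (0:ℝ) < n := by exact_mod_cast hn
    have hpos : (0:ℝ) < (n:ℝ) ^ a := by positivity
    have hposb : (0:ℝ) < (n:ℝ) ^ b := by positivity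
    have e1 : (n:ℝ) / ((⌈(n:ℝ) ^ a⌉₊ + 1 : ℕ) : ℝ) ≤ n / (n:ℝ) ^ a :=
      div_le_div_of_nonneg_left hn0.le hpos (lo a n)
    have e2 : ((⌈(n:ℝ) ^ b⌉₊ + 1 : ℕ) : ℝ) ^ (-r) ≤ ((n:ℝ) ^ b) ^ (-r) :=
      Real.rpow_le_rpow_of_nonpos hposb (lo b n) (by linarith)
    calc _ ≤ n / (n:ℝ) ^ a * ((n:ℝ) ^ b) ^ (-r) := by
          apply mul_le_mul e1 e2 (by positivity) (by positivity)
      _ = _ := by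
          rw [← Real.rpow_mul hn0.le, div_eq_mul_inv, ← Real.rpow_neg hn0.le]
          nth_rewrite 1 [← Real.rpow_one (n:ℝ)]
          rw [← Real.rpow_add hn0, ← Real.rpow_add hn0]; ring_nf

lemma charfun_quad {Ω : Type*} {m0 : MeasurableSpace Ω} {P : Measure Ω}
    [IsProbabilityMeasure P] {ξ : Ω → ℝ} (hξ : Measurable ξ) {b : ℝ} (hb : ∀ ω, |ξ ω| ≤ b)
    (hb1 : b ≤ 1) (h0 : ∫ ω, ξ ω ∂P = 0) :
    ‖∫ ω, Complex.exp (Complex.I * ξ ω) ∂P - Complex.exp (-(∫ ω, ξ ω ^ 2 ∂P : ℝ) / 2)‖ ≤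
      b * (∫ ω, ξ ω ^ 2 ∂P) + (∫ ω, ξ ω ^ 2 ∂P) ^ 2 := by
  set τ := ∫ ω, ξ ω ^ 2 ∂P with hτ
  have hτ0 : 0 ≤ τ := integral_nonneg fun ω => sq_nonneg _
  have iξ : Integrable ξ P := Integrable.of_bound hξ.aestronglyMeasurable b
    (Eventually.of_forall (by simpa using hb))
  have iξ2 : Integrable (fun ω => ξ ω ^ 2) P := by
    refine Integrable.of_bound (hξ.pow_const 2).aestronglyMeasurable (b ^ 2)
      (Eventually.of_forall fun ω => ?_)
    rw [norm_pow]; exact pow_le_pow_left₀ (norm_nonneg _) (by simpa using hb ω) 2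
  have hτ1 : τ ≤ 1 := by
    calc τ ≤ ∫ ω, (1:ℝ) ∂P := integral_mono iξ2 (integrable_const _) fun ω => by
          have := (hb ω).trans hb1
          simp only [← sq_abs (ξ ω)]
          exact pow_le_one₀ (abs_nonneg _) this
      _ = 1 := by simp
  have ie : Integrable (fun ω => Complex.exp (Complex.I * ξ ω)) P := by
    refine Integrable.of_bound (by fun_prop) 1 (Eventually.of_forall fun ω => ?_)
    rw [mul_comm, Complex.norm_exp_ofReal_mul_I]
  have iq : Integrable (fun ω => (1 + Complex.I * ξ ω - (ξ ω ^ 2 : ℝ) / 2 : ℂ)) P :=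
    ((integrable_const _).add (iξ.ofReal.const_mul _)).sub (iξ2.ofReal.div_const _)
  have hq : ∫ ω, (1 + Complex.I * ξ ω - (ξ ω ^ 2 : ℝ) / 2 : ℂ) ∂P = 1 - (τ : ℂ) / 2 := by
    have i2 : Integrable (fun ω => (((ξ ω ^ 2 : ℝ) : ℂ) / 2)) P := iξ2.ofReal.div_const _
    have i3 : Integrable (fun ω => Complex.I * (ξ ω : ℂ)) P := iξ.ofReal.const_mul _
    have i4 : Integrable (fun ω => (1:ℂ) + Complex.I * (ξ ω : ℂ)) P := (integrable_const _).add i3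
    rw [integral_sub i4 i2, integral_add (integrable_const _) i3,
      integral_const_mul, integral_div, integral_complex_ofReal, integral_complex_ofReal, h0]
    simp [hτ]
  have b1 : ‖∫ ω, Complex.exp (Complex.I * ξ ω) ∂P - (1 - (τ : ℂ) / 2)‖ ≤ b * τ := by
    rw [← hq, ← integral_sub ie iq, hτ, ← integral_const_mul]
    refine norm_integral_le_of_norm_le (iξ2.const_mul b) (Eventually.of_forall fun ω => ?_)
    have hx : ‖Complex.I * (ξ ω : ℂ)‖ = |ξ ω| := by simp
    have := Complex.exp_bound (x := Complex.I * ξ ω) (by rw [hx]; exact (hb ω).trans hb1)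
      (n := 3) (by norm_num)
    rw [hx] at this
    have e : ∑ m ∈ Finset.range 3, (Complex.I * (ξ ω : ℂ)) ^ m / (m.factorial : ℂ) =
        1 + Complex.I * ξ ω - (ξ ω ^ 2 : ℝ) / 2 := by
      simp [Finset.sum_range_succ, mul_pow, Complex.I_sq]; ring
    rw [e] at this
    refine this.trans ?_
    have h3 : |ξ ω| ^ 3 ≤ b * ξ ω ^ 2 := by
      rw [pow_succ, sq_abs, mul_comm]
      exact mul_le_mul_of_nonneg_right (hb ω) (sq_nonneg _)
    have hc : (((3:ℕ).succ : ℝ) * (((3:ℕ).factorial : ℝ) * (3:ℕ))⁻¹) ≤ 1 := by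
      norm_num [Nat.factorial]
    calc _ ≤ |ξ ω| ^ 3 * 1 := by gcongr
      _ ≤ _ := by linarith
  have b2 : ‖(1 - (τ : ℂ) / 2) - Complex.exp (-(τ : ℝ) / 2)‖ ≤ τ ^ 2 := by
    have e : ((1 - (τ : ℂ) / 2) - Complex.exp (-(τ : ℝ) / 2)) =
        ((-(Real.exp (-τ / 2) - 1 - (-τ / 2)) : ℝ) : ℂ) := by
      push_cast; ring
    rw [e, Complex.norm_real, norm_neg, Real.norm_eq_abs]
    refine (Real.abs_exp_sub_one_sub_id_le ?_).trans ?_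
    · rw [abs_le]; constructor <;> linarith
    · nlinarith
  calc _ = ‖(∫ ω, Complex.exp (Complex.I * ξ ω) ∂P - (1 - (τ : ℂ) / 2)) +
        ((1 - (τ : ℂ) / 2) - Complex.exp (-(τ : ℝ) / 2))‖ := by congr 1; ring
    _ ≤ _ := (norm_add_le _ _).trans (add_le_add b1 b2)

lemma norm_pow_sub_pow_le_cplx {a b : ℂ} (ha : ‖a‖ ≤ 1) (hb : ‖b‖ ≤ 1) (k : ℕ) :
    ‖a ^ k - b ^ k‖ ≤ k * ‖a - b‖ := by
  induction k with
  | zero => simp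
  | succ k ih =>
    have : a ^ (k + 1) - b ^ (k + 1) = a ^ k * (a - b) + (a ^ k - b ^ k) * b := by ring
    rw [this]
    refine (norm_add_le _ _).trans ?_
    rw [norm_mul, norm_mul, norm_pow]
    have h1 : ‖a‖ ^ k * ‖a - b‖ ≤ 1 * ‖a - b‖ := by
      gcongr; exact pow_le_one₀ (norm_nonneg _) ha
    have h2 : ‖a ^ k - b ^ k‖ * ‖b‖ ≤ (k * ‖a - b‖) * 1 := by gcongr
    push_cast; linarith

section
variable {Ω 𝒵 : Type*} [MeasurableSpace Ω] [m𝒵 : MeasurableSpace 𝒵] {P : Measure Ω}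
  [IsProbabilityMeasure P] {Z : ℕ → Ω → 𝒵} {p r C : ℝ}
namespace MixProc

lemma decouple (H : MixProc P Z p r C) {Y : 𝒵 → ℝ} (hY : Measurable Y) (v : ℝ) (a q : ℕ)
    (ha : 1 ≤ a) (hq : 1 ≤ q) (k : ℕ) :
    ‖∫ ω, ∏ j ∈ Finset.range k, Complex.exp (Complex.I * ((v * ∑ t ∈ Finset.range a,
        Y (Z (t + j * (a + q)) ω) : ℝ) : ℂ)) ∂P -
      (∫ ω, Complex.exp (Complex.I * ((v * ∑ t ∈ Finset.range a, Y (Z t ω) : ℝ) : ℂ)) ∂P) ^ k‖ ≤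
      k * (16 * (C * (q : ℝ) ^ (-r))) := by
  set W : ℕ → Ω → ℂ := fun j ω => Complex.exp (Complex.I * ((v * ∑ t ∈ Finset.range a,
        Y (Z (t + j * (a + q)) ω) : ℝ) : ℂ)) with hW
  have hnorm : ∀ j ω, ‖W j ω‖ = 1 := fun j ω => by
    simp only [hW]; rw [mul_comm, Complex.norm_exp_ofReal_mul_I]
  have hWm : ∀ (m : MeasurableSpace Ω) (j : ℕ), (∀ t < a, Measurable[m] (Z (t + j * (a + q)))) →
      Measurable[m] (W j) := fun m j h => by
    have h1 : Measurable[m] (fun ω => v * ∑ t ∈ Finset.range a, Y (Z (t + j * (a + q)) ω)) :=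
      (Finset.measurable_fun_sum _ fun t ht =>
        hY.comp (h t (Finset.mem_range.1 ht))).const_mul v
    exact Complex.measurable_exp.comp ((Complex.measurable_ofReal.comp h1).const_mul Complex.I)
  have hIntg : ∀ j, ∫ ω, W j ω ∂P =
      ∫ ω, Complex.exp (Complex.I * ((v * ∑ t ∈ Finset.range a, Y (Z t ω) : ℝ) : ℂ)) ∂P := by
    intro j
    have hG : Measurable (fun x : ℕ → 𝒵 => Complex.exp (Complex.I *
        ((v * ∑ t ∈ Finset.range a, Y (x t) : ℝ) : ℂ))) := by
      refine Complex.measurable_exp.comp ((Complex.measurable_ofReal.comp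
        (Measurable.const_mul (Finset.measurable_fun_sum _ fun t _ =>
          hY.comp (measurable_pi_apply t)) v)).const_mul Complex.I)
    exact H.integral_shift hG.stronglyMeasurable (j * (a + q))
  set w := ∫ ω, Complex.exp (Complex.I * ((v * ∑ t ∈ Finset.range a, Y (Z t ω) : ℝ) : ℂ)) ∂P
  have hw : ‖w‖ ≤ 1 := by
    rw [← hIntg 0]
    refine (norm_integral_le_integral_norm _).trans ?_
    simp [hnorm]
  have hC := H.hC
  induction k with
  | zero => simp
  | succ k ih =>
    have step : ‖∫ ω, (∏ j ∈ Finset.range k, W j ω) * W k ω ∂P -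
        (∫ ω, ∏ j ∈ Finset.range k, W j ω ∂P) * ∫ ω, W k ω ∂P‖ ≤ 16 * (C * (q : ℝ) ^ (-r)) := by
      rcases Nat.eq_zero_or_pos k with rfl | hk
      · simp; positivity
      · have hl : (k - 1) * (a + q) + (a + q) = k * (a + q) := by
          obtain ⟨k, rfl⟩ := Nat.exists_eq_succ_of_ne_zero hk.ne'
          simp [Nat.succ_mul]
        set l := (k - 1) * (a + q) + a - 1 with hldef
        have hl1 : l + 1 = (k - 1) * (a + q) + a := by omega
        refine cov_bdd_complex (m1 := sigmaUpTo Z (l + 1)) (m2 := sigmaFrom Z (l + q))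
          (sigmaUpTo_le H.meas _) (sigmaFrom_le H.meas _) ?_ ?_ ?_ ?_ (H.mix l q hq)
        · refine Measurable.stronglyMeasurable ?_
          refine Finset.measurable_fun_prod _ fun j hj => hWm _ j fun t ht => ?_
          refine measurable_sigmaUpTo ?_
          have hj' : j ≤ k - 1 := by have := Finset.mem_range.1 hj; omega
          have := Nat.mul_le_mul_right (a + q) hj'
          omega
        · intro ω; rw [norm_prod]; simp [hnorm]
        · refine Measurable.stronglyMeasurable (hWm _ k fun t ht => measurable_sigmaFrom ?_)
          omega
        · intro ω; exact (hnorm k ω).le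
    simp_rw [Finset.prod_range_succ]
    rw [hIntg k] at step
    calc _ = ‖(∫ ω, (∏ j ∈ Finset.range k, W j ω) * W k ω ∂P -
            (∫ ω, ∏ j ∈ Finset.range k, W j ω ∂P) * w) +
            (∫ ω, ∏ j ∈ Finset.range k, W j ω ∂P - w ^ k) * w‖ := by congr 1; ring
      _ ≤ 16 * (C * (q : ℝ) ^ (-r)) + k * (16 * (C * (q : ℝ) ^ (-r))) * 1 := by
          refine (norm_add_le _ _).trans (add_le_add step ?_)
          rw [norm_mul]; gcongr
      _ = _ := by push_cast; ring

end MixProc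
end
end

noncomputable section
set_option linter.unusedSectionVars false
set_option linter.unusedVariables false

lemma norm_cexp_sub_le (x y : ℝ) :
    ‖Complex.exp (Complex.I * (x:ℂ)) - Complex.exp (Complex.I * (y:ℂ))‖ ≤ |x - y| := by
  have h : Complex.exp (Complex.I * (x:ℂ)) - Complex.exp (Complex.I * (y:ℂ)) =
      Complex.exp (Complex.I * (y:ℂ)) * (Complex.exp (Complex.I * ((x - y : ℝ):ℂ)) - 1) := by
    rw [mul_sub, ← Complex.exp_add]; push_cast; ring_nf
  rw [h, norm_mul, mul_comm Complex.I (y:ℂ), Complex.norm_exp_ofReal_mul_I, one_mul]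
  exact Real.norm_exp_I_mul_ofReal_sub_one_le

lemma norm_cexp_I (x : ℝ) : ‖Complex.exp (Complex.I * (x:ℂ))‖ = 1 := by
  rw [mul_comm, Complex.norm_exp_ofReal_mul_I]

lemma integral_abs_le_sqrt {Ω : Type*} {m0 : MeasurableSpace Ω} {P : Measure Ω}
    [IsProbabilityMeasure P] {X : Ω → ℝ} (hX : MemLp X 2 P) :
    ∫ ω, |X ω| ∂P ≤ √(∫ ω, X ω ^ 2 ∂P) := by
  have h := variance_nonneg |X| P
  rw [variance_eq_sub hX.abs] at h
  simp only [Pi.pow_apply, Pi.abs_apply, sq_abs] at h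
  exact Real.le_sqrt_of_sq_le (by linarith)

lemma integrable_cexp {Ω : Type*} {m0 : MeasurableSpace Ω} {P : Measure Ω}
    [IsProbabilityMeasure P] {X : Ω → ℝ} (hX : AEStronglyMeasurable X P) :
    Integrable (fun ω => Complex.exp (Complex.I * (X ω : ℂ))) P := by
  refine Integrable.of_bound ?_ 1 (Eventually.of_forall fun ω => (norm_cexp_I _).le)
  exact Continuous.comp_aestronglyMeasurable (g := fun x : ℝ => Complex.exp (Complex.I * (x:ℂ)))
    (by fun_prop) hX

lemma norm_charfun_sub_le {Ω : Type*} {m0 : MeasurableSpace Ω} {P : Measure Ω}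
    [IsProbabilityMeasure P] {X Y : Ω → ℝ} (hX : AEStronglyMeasurable X P)
    (hY : AEStronglyMeasurable Y P) (hXY : MemLp (fun ω => X ω - Y ω) 2 P) :
    ‖∫ ω, Complex.exp (Complex.I * (X ω : ℂ)) ∂P - ∫ ω, Complex.exp (Complex.I * (Y ω : ℂ)) ∂P‖
      ≤ √(∫ ω, (X ω - Y ω) ^ 2 ∂P) := by
  rw [← integral_sub (integrable_cexp hX) (integrable_cexp hY)]
  refine le_trans ?_ (integral_abs_le_sqrt hXY)
  exact norm_integral_le_of_norm_le (hXY.integrable (by norm_num)).abs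
    (Eventually.of_forall fun ω => norm_cexp_sub_le _ _)

section
variable {Ω 𝒵 : Type*} [MeasurableSpace Ω] [m𝒵 : MeasurableSpace 𝒵] {P : Measure Ω}
  [IsProbabilityMeasure P] {Z : ℕ → Ω → 𝒵} {p r C : ℝ}
namespace MixProc

lemma block_estimate (H : MixProc P Z p r C) {Y : 𝒵 → ℝ} (hY : Good P Z p Y) {M : ℝ}
    (hM : ∀ z, |Y z| ≤ M) (v : ℝ) (n a q k : ℕ) (ha : 1 ≤ a) (hq : 1 ≤ q)
    (hk : k * (a + q) ≤ n) (hb : |v| * (a * M) ≤ 1) :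
    ‖∫ ω, Complex.exp (Complex.I * ((v * ∑ t ∈ Finset.range n, Y (Z t ω) : ℝ) : ℂ)) ∂P -
      Complex.exp (-(k * (v ^ 2 * ∫ ω, (∑ t ∈ Finset.range a, Y (Z t ω)) ^ 2 ∂P) : ℝ) / 2)‖ ≤
    √(v ^ 2 * (((n:ℝ) - k * a) * (K0 p r C * (1 + ∫ ω, |Y (Z 0 ω)| ^ p ∂P)))) +
    k * (16 * (C * (q : ℝ) ^ (-r))) +
    k * (|v| * (a * M) * (v ^ 2 * ∫ ω, (∑ t ∈ Finset.range a, Y (Z t ω)) ^ 2 ∂P) +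
      (v ^ 2 * ∫ ω, (∑ t ∈ Finset.range a, Y (Z t ω)) ^ 2 ∂P) ^ 2) := by
  set ℓ := a + q with hℓ
  set f : ℕ × ℕ → ℕ := fun x => x.2 + x.1 * ℓ with hf
  have hinj : Set.InjOn f (Finset.range k ×ˢ Finset.range a : Finset (ℕ × ℕ)) := by
    rintro ⟨j, t⟩ h1 ⟨j', t'⟩ h2 h
    simp only [Finset.coe_product, Finset.coe_range, Set.mem_prod, Set.mem_Iio] at h1 h2
    simp only [hf] at h
    have ht : t < ℓ := by omega
    have ht' : t' < ℓ := by omega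
    have hmod : t = t' := by
      have := congrArg (· % ℓ) h
      simpa [Nat.add_mul_mod_self_right, Nat.mod_eq_of_lt ht, Nat.mod_eq_of_lt ht'] using this
    subst hmod
    have : j * ℓ = j' * ℓ := by omega
    have := Nat.eq_of_mul_eq_mul_right (by omega) this
    simp [this]
  set B := (Finset.range k ×ˢ Finset.range a).image f with hB
  have hBn : B ⊆ Finset.range n := by
    intro x hx
    obtain ⟨⟨j, t⟩, hjt, rfl⟩ := Finset.mem_image.1 hx
    simp only [Finset.mem_product, Finset.mem_range] at hjt
    have : (j + 1) * ℓ ≤ k * ℓ := Nat.mul_le_mul_right _ hjt.1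
    rw [Nat.succ_mul] at this
    simp only [hf, Finset.mem_range]; omega
  have hBcard : B.card = k * a := by
    rw [hB, Finset.card_image_of_injOn hinj]; simp
  set R := Finset.range n \ B with hR
  have hRcard : (R.card : ℝ) = (n:ℝ) - k * a := by
    have := Finset.card_sdiff_add_card_eq_card hBn
    rw [hBcard, Finset.card_range] at this
    have h2 : (R.card : ℝ) + k * a = n := by exact_mod_cast this
    linarith
  have hsum : ∀ ω, ∑ t ∈ Finset.range n, Y (Z t ω) = ∑ t ∈ R, Y (Z t ω) +
      ∑ j ∈ Finset.range k, ∑ t ∈ Finset.range a, Y (Z (t + j * ℓ) ω) := fun ω => by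
    rw [← Finset.sum_sdiff hBn, hB, Finset.sum_image hinj, Finset.sum_product]
  have hYm : ∀ t, Measurable fun ω => Y (Z t ω) := fun t => hY.meas.comp (H.meas t)
  have hSm : ∀ I : Finset ℕ, Measurable fun ω => ∑ t ∈ I, Y (Z t ω) := fun I =>
    Finset.measurable_fun_sum _ fun t _ => hYm t
  have hDm : Measurable fun ω => v * ∑ j ∈ Finset.range k, ∑ t ∈ Finset.range a,
      Y (Z (t + j * ℓ) ω) :=
    (Finset.measurable_fun_sum _ fun j _ => Finset.measurable_fun_sum _ fun t _ => hYm _).const_mul v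
  -- step 1
  have s1 : ‖∫ ω, Complex.exp (Complex.I * ((v * ∑ t ∈ Finset.range n, Y (Z t ω) : ℝ) : ℂ)) ∂P -
      ∫ ω, Complex.exp (Complex.I * ((v * ∑ j ∈ Finset.range k, ∑ t ∈ Finset.range a,
        Y (Z (t + j * ℓ) ω) : ℝ) : ℂ)) ∂P‖ ≤
      √(v ^ 2 * (((n:ℝ) - k * a) * (K0 p r C * (1 + ∫ ω, |Y (Z 0 ω)| ^ p ∂P)))) := by
    have e : ∀ ω, v * ∑ t ∈ Finset.range n, Y (Z t ω) - v * ∑ j ∈ Finset.range k,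
        ∑ t ∈ Finset.range a, Y (Z (t + j * ℓ) ω) = v * ∑ t ∈ R, Y (Z t ω) := fun ω => by
      rw [hsum]; ring
    refine (norm_charfun_sub_le ((hSm _).const_mul v).aestronglyMeasurable
      hDm.aestronglyMeasurable ?_).trans ?_
    · simp_rw [e]
      exact (memLp_finsetSum _ fun t _ => Good.memLp H hY t).const_mul v
    · simp_rw [e, mul_pow]
      rw [integral_const_mul]
      refine Real.sqrt_le_sqrt (mul_le_mul_of_nonneg_left ?_ (sq_nonneg _))
      have := H.var_bound hY one_pos R
      rw [hRcard] at this
      simpa using this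
  -- step 2
  have s2 := H.decouple hY.meas v a q ha hq k
  have e2 : ∀ ω, ∏ j ∈ Finset.range k, Complex.exp (Complex.I * ((v * ∑ t ∈ Finset.range a,
        Y (Z (t + j * (a + q)) ω) : ℝ) : ℂ)) =
      Complex.exp (Complex.I * ((v * ∑ j ∈ Finset.range k, ∑ t ∈ Finset.range a,
        Y (Z (t + j * ℓ) ω) : ℝ) : ℂ)) := fun ω => by
    rw [← Complex.exp_sum, ← Finset.mul_sum, ← Complex.ofReal_sum, ← Finset.mul_sum]
  simp_rw [e2] at s2
  -- step 3
  set τ := v ^ 2 * ∫ ω, (∑ t ∈ Finset.range a, Y (Z t ω)) ^ 2 ∂P with hτ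
  have hτe : ∫ ω, (v * ∑ t ∈ Finset.range a, Y (Z t ω)) ^ 2 ∂P = τ := by
    simp_rw [mul_pow]; rw [integral_const_mul]
  have s3 := charfun_quad (P := P) (ξ := fun ω => v * ∑ t ∈ Finset.range a, Y (Z t ω))
    ((hSm _).const_mul v) (b := |v| * (a * M)) (fun ω => by
      rw [abs_mul]
      refine mul_le_mul_of_nonneg_left ?_ (abs_nonneg _)
      refine (Finset.abs_sum_le_sum_abs _ _).trans ?_
      refine (Finset.sum_le_card_nsmul _ _ M fun t _ => hM _).trans ?_
      simp) hb (by
      rw [integral_const_mul, integral_finsetSum _ fun t _ =>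
        (Good.memLp H hY t).integrable (by norm_num)]
      simp [H.integral_one hY.meas, hY.mean])
  rw [hτe] at s3
  have hτ0 : 0 ≤ τ := mul_nonneg (sq_nonneg _) (integral_nonneg fun ω => sq_nonneg _)
  set x := ∫ ω, Complex.exp (Complex.I * ((v * ∑ t ∈ Finset.range a, Y (Z t ω) : ℝ) : ℂ)) ∂P
  have hx : ‖x‖ ≤ 1 := by
    refine (norm_integral_le_integral_norm _).trans ?_
    simp_rw [norm_cexp_I]; simp
  have hy : ‖Complex.exp (-(τ:ℝ) / 2)‖ ≤ 1 := by
    rw [show (-(τ:ℂ) / 2) = ((-τ/2 : ℝ) : ℂ) by push_cast; ring, ← Complex.ofReal_exp,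
      Complex.norm_real, Real.norm_of_nonneg (Real.exp_pos _).le]
    exact Real.exp_le_one_iff.2 (by linarith)
  have s4 := (norm_pow_sub_pow_le_cplx hx hy k).trans
    (mul_le_mul_of_nonneg_left s3 (Nat.cast_nonneg k))
  have e4 : Complex.exp (-(τ:ℝ) / 2) ^ k = Complex.exp (-(k * τ : ℝ) / 2) := by
    rw [← Complex.exp_nat_mul]; push_cast; ring_nf
  rw [e4] at s4
  refine le_trans (le_of_eq ?_) ((norm_add₃_le).trans (add_le_add (add_le_add s1 s2) s4))
  congr 1; ring

end MixProc
end
end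

noncomputable section
set_option linter.unusedSectionVars false
set_option linter.unusedVariables false
section
variable {Ω 𝒵 : Type*} [MeasurableSpace Ω] [m𝒵 : MeasurableSpace 𝒵] {P : Measure Ω}
  [IsProbabilityMeasure P] {Z : ℕ → Ω → 𝒵} {p r C : ℝ}
namespace MixProc

lemma one_lt_r (H : MixProc P Z p r C) : 1 < r := by
  have h1 := H.hr
  have h2 := H.hp
  have h3 : 0 < 2 / p := by positivity
  have h4 : 2 / p < 1 := by rw [div_lt_one (by linarith)]; exact h2
  by_contra h
  nlinarith

lemma clt_bdd (H : MixProc P Z p r C) {Y : 𝒵 → ℝ} (hY : Good P Z p Y) {M : ℝ}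
    (hM : ∀ z, |Y z| ≤ M) {σ2 : ℝ}
    (hσ : Tendsto (fun n : ℕ => (n : ℝ)⁻¹ * ∫ ω, (∑ t ∈ Finset.range n, Y (Z t ω)) ^ 2 ∂P)
      atTop (𝓝 σ2)) (u : ℝ) :
    Tendsto (fun n : ℕ => ∫ ω, Complex.exp (Complex.I *
      ((u * (√(n:ℝ))⁻¹ * ∑ t ∈ Finset.range n, Y (Z t ω) : ℝ) : ℂ)) ∂P) atTop
      (𝓝 (Complex.exp (-(u ^ 2 * σ2 : ℝ) / 2))) := by
  obtain ⟨a, q, ha, hq, ta, tan, tqa, tnq⟩ := exists_blocks H.one_lt_r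
  set K := K0 p r C * (1 + ∫ ω, |Y (Z 0 ω)| ^ p ∂P) with hK
  set ℓ : ℕ → ℕ := fun n => a n + q n with hℓ
  set k : ℕ → ℕ := fun n => n / ℓ n with hk
  set v : ℕ → ℝ := fun n => u * (√(n:ℝ))⁻¹ with hv
  set E : ℕ → ℝ := fun m => ∫ ω, (∑ t ∈ Finset.range m, Y (Z t ω)) ^ 2 ∂P with hE
  have hapos : ∀ n, (0:ℝ) < a n := fun n => by exact_mod_cast ha n
  have hqpos : ∀ n, (0:ℝ) < q n := fun n => by exact_mod_cast hq n
  have hC := H.hC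
  have hv2 : ∀ n : ℕ, v n ^ 2 = u ^ 2 / n := fun n => by
    simp only [hv]; rw [mul_pow, inv_pow, Real.sq_sqrt (Nat.cast_nonneg n)]; rfl
  have hkn : ∀ n, k n * ℓ n ≤ n := fun n => Nat.div_mul_le_self _ _
  have hkn' : ∀ n : ℕ, (n:ℝ) ≤ k n * ℓ n + ℓ n := fun n => by
    have h1 : 0 < ℓ n := by have := ha n; simp only [hℓ]; omega
    have := Nat.lt_div_mul_add (a := n) h1
    exact_mod_cast this.le
  have hkle : ∀ n : ℕ, (k n : ℝ) * a n ≤ n := fun n => by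
    have := hkn n
    have h2 : k n * a n ≤ n := le_trans (Nat.mul_le_mul_left _ (Nat.le_add_right _ _)) this
    exact_mod_cast h2
  have hkle' : ∀ n : ℕ, (k n : ℝ) ≤ n / a n := fun n => by
    rw [le_div_iff₀ (hapos n)]; exact hkle n
  -- a/n → 0
  have tsq : Tendsto (fun n : ℕ => (√(n:ℝ))⁻¹) atTop (𝓝 0) :=
    tendsto_inv_atTop_zero.comp (Real.tendsto_sqrt_atTop.comp tendsto_natCast_atTop_atTop)
  have tann : Tendsto (fun n : ℕ => (a n : ℝ) / n) atTop (𝓝 0) := by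
    have := tan.mul tsq
    rw [mul_zero] at this
    refine this.congr fun n => ?_
    rw [div_mul_eq_mul_div, ← div_eq_mul_inv, div_div, Real.mul_self_sqrt (Nat.cast_nonneg n)]
  have tqn : Tendsto (fun n : ℕ => (q n : ℝ) / n) atTop (𝓝 0) := by
    have := tqa.mul tann
    rw [mul_zero] at this
    refine this.congr fun n => ?_
    have := (hapos n).ne'
    rw [div_mul_div_comm, mul_comm, mul_div_mul_left _ _ this]
  have tRem : Tendsto (fun n : ℕ => ((n:ℝ) - k n * a n) / n) atTop (𝓝 0) := by
    have hs := (tann.add tqn).add tqa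
    simp only [add_zero] at hs
    refine squeeze_zero' (Eventually.of_forall fun n => div_nonneg (by linarith [hkle n])
      (Nat.cast_nonneg n)) ?_ hs
    filter_upwards [eventually_gt_atTop 0] with n hn
    have hn0 : (0:ℝ) < n := by exact_mod_cast hn
    rw [← add_div, div_add' _ _ _ hn0.ne', div_le_div_iff_of_pos_right hn0]
    have h1 := hkn' n
    have h2 : (k n : ℝ) * q n ≤ q n / a n * n := by
      calc (k n : ℝ) * q n ≤ n / a n * q n := by gcongr; exact hkle' n
        _ = _ := by ring
    have h3 : (ℓ n : ℝ) = a n + q n := by simp [hℓ]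
    rw [h3] at h1
    nlinarith
  have tka : Tendsto (fun n : ℕ => (k n : ℝ) * a n / n) atTop (𝓝 1) := by
    have := tRem.const_sub 1
    rw [sub_zero] at this
    refine this.congr' ?_
    filter_upwards [eventually_gt_atTop 0] with n hn
    have hn0 : (n:ℝ) ≠ 0 := by exact_mod_cast hn.ne'
    field_simp; ring
  have tEa : Tendsto (fun n => (a n : ℝ)⁻¹ * E (a n)) atTop (𝓝 σ2) := hσ.comp ta
  have tkτ : Tendsto (fun n : ℕ => (k n : ℝ) * (v n ^ 2 * E (a n))) atTop (𝓝 (u ^ 2 * σ2)) := by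
    have := (tka.mul tEa).const_mul (u ^ 2)
    rw [one_mul] at this
    refine this.congr fun n => ?_
    rw [hv2]
    have := (hapos n).ne'
    field_simp
  have tτ : Tendsto (fun n : ℕ => (v n ^ 2 * E (a n))) atTop (𝓝 0) := by
    have := (tann.mul tEa).const_mul (u ^ 2)
    rw [zero_mul, mul_zero] at this
    refine this.congr fun n => ?_
    rw [hv2]
    have := (hapos n).ne'
    field_simp
  have tb : Tendsto (fun n : ℕ => |v n| * (a n * M)) atTop (𝓝 0) := by
    have := (tan.const_mul (|u| * M))
    rw [mul_zero] at this
    refine this.congr fun n => ?_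
    simp only [hv]
    rw [abs_mul, abs_inv, abs_of_nonneg (Real.sqrt_nonneg _)]; ring
  -- the error
  have terr : Tendsto (fun n : ℕ => √(v n ^ 2 * (((n:ℝ) - k n * a n) * K)) +
      k n * (16 * (C * (q n : ℝ) ^ (-r))) +
      k n * (|v n| * (a n * M) * (v n ^ 2 * E (a n)) + (v n ^ 2 * E (a n)) ^ 2)) atTop (𝓝 0) := by
    have t1 : Tendsto (fun n : ℕ => √(v n ^ 2 * (((n:ℝ) - k n * a n) * K))) atTop (𝓝 0) := by
      have := (tRem.const_mul (u ^ 2 * K)).sqrt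
      rw [mul_zero, Real.sqrt_zero] at this
      refine this.congr fun n => ?_
      rw [hv2]; congr 1; ring
    have t2 : Tendsto (fun n : ℕ => k n * (16 * (C * (q n : ℝ) ^ (-r)))) atTop (𝓝 0) := by
      have := tnq.const_mul (16 * C)
      rw [mul_zero] at this
      refine squeeze_zero (fun n => by positivity) (fun n => ?_) this
      calc (k n : ℝ) * (16 * (C * (q n : ℝ) ^ (-r))) ≤
          n / a n * (16 * (C * (q n : ℝ) ^ (-r))) := by gcongr; exact hkle' n
        _ = _ := by ring
    have t3 := tkτ.mul (tb.add tτ)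
    rw [add_zero, mul_zero] at t3
    have := (t1.add t2).add t3
    simp only [add_zero] at this
    refine this.congr fun n => ?_
    ring
  have tmain : Tendsto (fun n : ℕ => Complex.exp (-(k n * (v n ^ 2 * E (a n)) : ℝ) / 2)) atTop
      (𝓝 (Complex.exp (-(u ^ 2 * σ2 : ℝ) / 2))) := by
    have hc : Continuous fun x : ℝ => Complex.exp (-(x:ℂ) / 2) := by fun_prop
    exact (hc.tendsto _).comp tkτ
  refine tendsto_of_tendsto_of_dist tmain ?_
  refine squeeze_zero' (Eventually.of_forall fun n => dist_nonneg) ?_ terr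
  filter_upwards [tb.eventually_le_const (zero_lt_one)] with n hn
  rw [dist_comm, dist_eq_norm]
  exact H.block_estimate hY hM (v n) n (a n) (q n) (k n) (ha n) (hq n) (hkn n) hn

end MixProc
end
end

noncomputable section
set_option linter.unusedSectionVars false
set_option linter.unusedVariables false

lemma abs_exp_neg_sub_le {x y : ℝ} (hx : 0 ≤ x) (hy : 0 ≤ y) :
    |Real.exp (-x) - Real.exp (-y)| ≤ |x - y| := by
  wlog h : x ≤ y generalizing x y
  · rw [abs_sub_comm, abs_sub_comm x]; exact this hy hx (le_of_not_ge h)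
  have h1 : Real.exp (-y) ≤ Real.exp (-x) := Real.exp_le_exp.2 (by linarith)
  rw [abs_of_nonneg (by linarith), abs_of_nonpos (by linarith)]
  have h2 : Real.exp (-y) = Real.exp (-x) * Real.exp (-(y - x)) := by
    rw [← Real.exp_add]; ring_nf
  have h3 := Real.add_one_le_exp (-(y - x))
  have h4 : Real.exp (-x) ≤ 1 := Real.exp_le_one_iff.2 (by linarith)
  have h5 := Real.exp_pos (-x)
  rw [h2]; nlinarith

section
variable {Ω 𝒵 : Type*} [MeasurableSpace Ω] [m𝒵 : MeasurableSpace 𝒵] {P : Measure Ω}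
  [IsProbabilityMeasure P] {Z : ℕ → Ω → 𝒵} {p r C : ℝ}
namespace MixProc

lemma Good.memLpp (H : MixProc P Z p r C) {Y : 𝒵 → ℝ} (hY : Good P Z p Y) :
    MemLp (fun ω => Y (Z 0 ω)) (ENNReal.ofReal p) P := by
  exact memLp_of_rpow (by linarith [H.hp]) (hY.meas.comp (H.meas 0)).aestronglyMeasurable hY.int

lemma good_of_memLp (H : MixProc P Z p r C) {Y : 𝒵 → ℝ} (hm : Measurable Y)
    (hi : MemLp (fun ω => Y (Z 0 ω)) (ENNReal.ofReal p) P)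
    (h0 : ∫ ω, Y (Z 0 ω) ∂P = 0) : Good P Z p Y := by
  have hp := H.hp
  refine ⟨hm, ?_, h0⟩
  have := hi.integrable_norm_rpow (by simp; linarith) (by simp)
  simpa [ENNReal.toReal_ofReal (show 0 ≤ p by linarith)] using this

lemma Good.sub (H : MixProc P Z p r C) {Y Y' : 𝒵 → ℝ} (hY : Good P Z p Y) (hY' : Good P Z p Y') :
    Good P Z p (fun z => Y z - Y' z) := by
  refine good_of_memLp H (hY.meas.sub hY'.meas)
    ((Good.memLpp H hY).sub (Good.memLpp H hY')) ?_
  rw [integral_sub ((Good.memLp H hY 0).integrable (by norm_num))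
    ((Good.memLp H hY' 0).integrable (by norm_num)), hY.mean, hY'.mean, sub_zero]

lemma Good.lin (H : MixProc P Z p r C) {ι : Type*} (s : Finset ι) (c : ι → ℝ) {Y : ι → 𝒵 → ℝ}
    (hY : ∀ i ∈ s, Good P Z p (Y i)) : Good P Z p (fun z => ∑ i ∈ s, c i * Y i z) := by
  refine good_of_memLp H (Finset.measurable_fun_sum _ fun i hi => (hY i hi).meas.const_mul _)
    (memLp_finsetSum s fun i hi => (Good.memLpp H (hY i hi)).const_mul _) ?_
  rw [integral_finsetSum s fun i hi =>
    ((Good.memLp H (hY i hi) 0).integrable (by norm_num)).const_mul _]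
  refine Finset.sum_eq_zero fun i hi => ?_
  rw [integral_const_mul, (hY i hi).mean, mul_zero]

lemma approx (H : MixProc P Z p r C) {Y : 𝒵 → ℝ} (hY : Good P Z p Y) {η : ℝ} (hη : 0 < η) :
    ∃ Y' : 𝒵 → ℝ, ∃ M : ℝ, Good P Z p Y' ∧ (∀ z, |Y' z| ≤ M) ∧
      ∀ n : ℕ, ∫ ω, (∑ t ∈ Finset.range n, (Y (Z t ω) - Y' (Z t ω))) ^ 2 ∂P ≤ n * η := by
  have hp := H.hp
  have hYi : Integrable (fun ω => Y (Z 0 ω)) P := (Good.memLp H hY 0).integrable (by norm_num)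
  have hm0 : Measurable fun ω => Y (Z 0 ω) := hY.meas.comp (H.meas 0)
  set T : ℕ → 𝒵 → ℝ := fun m z => trunc (m:ℝ) (Y z) with hT
  have hTm : ∀ m, Measurable (T m) := fun m => (measurable_trunc _).comp hY.meas
  have hTle : ∀ m z, |T m z| ≤ |Y z| := fun m z => abs_trunc_le' _ _
  have hTsub : ∀ m z, |Y z - T m z| ≤ |Y z| := fun m z => by
    simp only [hT, trunc]; split_ifs <;> simp
  have hTlim : ∀ z, ∀ᶠ m in atTop, T m z = Y z := fun z => by
    filter_upwards [eventually_ge_atTop ⌈|Y z|⌉₊] with m hm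
    have : |Y z| ≤ m := (Nat.le_ceil _).trans (by exact_mod_cast hm)
    simp [hT, trunc, this]
  set μ : ℕ → ℝ := fun m => ∫ ω, T m (Z 0 ω) ∂P with hμ
  have tμ : Tendsto μ atTop (𝓝 0) := by
    rw [← hY.mean]
    refine tendsto_integral_of_dominated_convergence (fun ω => |Y (Z 0 ω)|)
      (fun m => ((hTm m).comp (H.meas 0)).aestronglyMeasurable) hYi.abs
      (fun m => Eventually.of_forall fun ω => by simpa using hTle m _)
      (Eventually.of_forall fun ω => ?_)
    exact tendsto_const_nhds.congr' ((hTlim (Z 0 ω)).mono fun m hm => hm.symm)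
  set A := ∫ ω, |Y (Z 0 ω)| ∂P with hA
  have hA0 : 0 ≤ A := integral_nonneg fun ω => abs_nonneg _
  have hμle : ∀ m, |μ m| ≤ A := fun m => by
    refine (abs_integral_le_integral_abs).trans ?_
    refine integral_mono_of_nonneg (Eventually.of_forall fun ω => abs_nonneg _) hYi.abs
      (Eventually.of_forall fun ω => hTle m _)
  have hmem : MemLp (fun ω => |Y (Z 0 ω)| + A) (ENNReal.ofReal p) P :=
    (Good.memLpp H hY).abs.add (memLp_const A)
  have hdom : Integrable (fun ω => (|Y (Z 0 ω)| + A) ^ p) P := by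
    have := hmem.integrable_norm_rpow (by simp; linarith) (by simp)
    rw [ENNReal.toReal_ofReal (show 0 ≤ p by linarith)] at this
    refine this.congr (Eventually.of_forall fun ω => ?_)
    simp only
    rw [Real.norm_of_nonneg (by positivity)]
  have tδ : Tendsto (fun m => ∫ ω, |Y (Z 0 ω) - (T m (Z 0 ω) - μ m)| ^ p ∂P) atTop (𝓝 0) := by
    have h0 : (0:ℝ) = ∫ ω, (0:ℝ) ∂P := by simp
    rw [h0]
    refine tendsto_integral_of_dominated_convergence (fun ω => (|Y (Z 0 ω)| + A) ^ p)
      (fun m => ?_) hdom (fun m => Eventually.of_forall fun ω => ?_)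
      (Eventually.of_forall fun ω => ?_)
    · exact ((hm0.sub (((hTm m).comp (H.meas 0)).sub_const _)).abs.pow_const p).aestronglyMeasurable
    · rw [Real.norm_of_nonneg (by positivity)]
      refine Real.rpow_le_rpow (abs_nonneg _) ?_ (by linarith)
      calc |Y (Z 0 ω) - (T m (Z 0 ω) - μ m)| = |(Y (Z 0 ω) - T m (Z 0 ω)) + μ m| := by ring_nf
        _ ≤ _ := (abs_add_le _ _).trans (add_le_add (hTsub m _) (hμle m))
    · have h1 : Tendsto (fun m => |μ m| ^ p) atTop (𝓝 0) := by
        have := tμ.abs.rpow_const (p := p) (Or.inr (by linarith))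
        simpa [Real.zero_rpow (show p ≠ 0 by linarith)] using this
      refine h1.congr' ((hTlim (Z 0 ω)).mono fun m hm => ?_)
      simp only [hm]; ring_nf
  -- choose w then m
  obtain ⟨w, hw, hw1⟩ : ∃ w : ℝ, 0 < w ∧ K0 p r C * w ^ 2 < η / 2 := by
    have : Tendsto (fun w : ℝ => K0 p r C * w ^ 2) (𝓝[>] 0) (𝓝 0) := by
      have h : Continuous fun w : ℝ => K0 p r C * w ^ 2 := by fun_prop
      simpa using (h.tendsto 0).mono_left nhdsWithin_le_nhds
    obtain ⟨w, h1, h2⟩ := ((this.eventually_lt_const (half_pos hη)).and self_mem_nhdsWithin).exists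
    exact ⟨w, h2, h1⟩
  have tδ' := (tδ.const_mul (K0 p r C * w ^ (2 - p)))
  rw [mul_zero] at tδ'
  obtain ⟨m, hm⟩ := (tδ'.eventually_lt_const (half_pos hη)).exists
  have hbd : ∀ z, |T m z - μ m| ≤ m + |μ m| := fun z =>
    (abs_sub _ _).trans (add_le_add (abs_trunc_le (Nat.cast_nonneg m) _) le_rfl)
  have hG : Good P Z p (fun z => T m z - μ m) := by
    refine good_of_memLp H ((hTm m).sub_const _) ?_ ?_
    · exact MemLp.of_bound (((hTm m).comp (H.meas 0)).sub_const _).aestronglyMeasurable _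
        (Eventually.of_forall fun ω => hbd _)
    · rw [integral_sub ?_ (integrable_const _)]
      · simp [hμ]
      · exact hYi.mono ((hTm m).comp (H.meas 0)).aestronglyMeasurable
          (Eventually.of_forall fun ω => hTle m _)
  refine ⟨fun z => T m z - μ m, _, hG, hbd, fun n => ?_⟩
  have := H.var_bound (Good.sub H hY hG) hw (Finset.range n)
  refine this.trans ?_
  rw [Finset.card_range]
  refine mul_le_mul_of_nonneg_left ?_ (Nat.cast_nonneg n)
  linarith

lemma clt (H : MixProc P Z p r C) {Y : 𝒵 → ℝ} (hY : Good P Z p Y) {σ2 : ℝ}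
    (hσ : Tendsto (fun n : ℕ => (n : ℝ)⁻¹ * ∫ ω, (∑ t ∈ Finset.range n, Y (Z t ω)) ^ 2 ∂P)
      atTop (𝓝 σ2)) (u : ℝ) :
    Tendsto (fun n : ℕ => ∫ ω, Complex.exp (Complex.I *
      ((u * (√(n:ℝ))⁻¹ * ∑ t ∈ Finset.range n, Y (Z t ω) : ℝ) : ℂ)) ∂P) atTop
      (𝓝 (Complex.exp (-(u ^ 2 * σ2 : ℝ) / 2))) := by
  have hσ0 : 0 ≤ σ2 := ge_of_tendsto' hσ fun n =>
    mul_nonneg (by positivity) (integral_nonneg fun ω => sq_nonneg _)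
  rw [Metric.tendsto_nhds]
  intro e he
  obtain ⟨η, hη, hη1⟩ : ∃ η : ℝ, 0 < η ∧
      |u| * √η + u ^ 2 / 2 * (√η * σ2 + (√η + η)) < e / 2 := by
    have : Tendsto (fun η : ℝ => |u| * √η + u ^ 2 / 2 * (√η * σ2 + (√η + η))) (𝓝[>] 0) (𝓝 0) := by
      have h : Continuous fun η : ℝ => |u| * √η + u ^ 2 / 2 * (√η * σ2 + (√η + η)) := by fun_prop
      simpa using (h.tendsto 0).mono_left nhdsWithin_le_nhds
    obtain ⟨w, h1, h2⟩ := ((this.eventually_lt_const (half_pos he)).and self_mem_nhdsWithin).exists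
    exact ⟨w, h2, h1⟩
  obtain ⟨Y', M, hY', hM, hclose⟩ := H.approx hY hη
  obtain ⟨σ', hσ'⟩ := H.tendsto_var hY'
  have hσ'0 : 0 ≤ σ' := ge_of_tendsto' hσ' fun n =>
    mul_nonneg (by positivity) (integral_nonneg fun ω => sq_nonneg _)
  have hYm : ∀ t, Measurable fun ω => Y (Z t ω) := fun t => hY.meas.comp (H.meas t)
  have hYm' : ∀ t, Measurable fun ω => Y' (Z t ω) := fun t => hY'.meas.comp (H.meas t)
  have hL : ∀ n, MemLp (fun ω => ∑ t ∈ Finset.range n, Y (Z t ω)) 2 P := fun n =>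
    memLp_finsetSum _ fun t _ => Good.memLp H hY t
  have hL' : ∀ n, MemLp (fun ω => ∑ t ∈ Finset.range n, Y' (Z t ω)) 2 P := fun n =>
    memLp_finsetSum _ fun t _ => Good.memLp H hY' t
  have hD : ∀ n, MemLp (fun ω => ∑ t ∈ Finset.range n, (Y (Z t ω) - Y' (Z t ω))) 2 P := fun n =>
    memLp_finsetSum _ fun t _ => (Good.memLp H hY t).sub (Good.memLp H hY' t)
  have hvar : |σ2 - σ'| ≤ √η * σ2 + (√η + η) := by
    have hs : 0 < √η := Real.sqrt_pos.2 hη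
    have hss : √η * √η = η := Real.mul_self_sqrt hη.le
    refine le_of_tendsto_of_tendsto (hσ.sub hσ').abs ((hσ.const_mul (√η)).add_const (√η + η)) ?_
    filter_upwards [eventually_gt_atTop 0] with n hn
    have hn0 : (0:ℝ) < n := by exact_mod_cast hn
    have h1 : |∫ ω, (∑ t ∈ Finset.range n, Y (Z t ω)) ^ 2 ∂P -
        ∫ ω, (∑ t ∈ Finset.range n, Y' (Z t ω)) ^ 2 ∂P| ≤
        √η * ∫ ω, (∑ t ∈ Finset.range n, Y (Z t ω)) ^ 2 ∂P + (1 / √η + 1) *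
          ∫ ω, (∑ t ∈ Finset.range n, (Y (Z t ω) - Y' (Z t ω))) ^ 2 ∂P := by
      rw [← integral_sub (hL n).integrable_sq (hL' n).integrable_sq, ← integral_const_mul,
        ← integral_const_mul, ← integral_add ((hL n).integrable_sq.const_mul _)
        ((hD n).integrable_sq.const_mul _)]
      refine abs_integral_le_integral_abs.trans (integral_mono
        ((hL n).integrable_sq.sub (hL' n).integrable_sq).abs
        (((hL n).integrable_sq.const_mul _).add ((hD n).integrable_sq.const_mul _)) fun ω => ?_)
      simp only [Finset.sum_sub_distrib]
      set x := ∑ t ∈ Finset.range n, Y (Z t ω)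
      set x' := ∑ t ∈ Finset.range n, Y' (Z t ω)
      have k1 : √η * x ^ 2 + (1 / √η) * (x - x') ^ 2 - 2 * x * (x - x') =
          1 / √η * (√η * x - (x - x')) ^ 2 := by field_simp; ring
      have k2 : √η * x ^ 2 + (1 / √η) * (x - x') ^ 2 + 2 * x * (x - x') =
          1 / √η * (√η * x + (x - x')) ^ 2 := by field_simp; ring
      have k3 : 0 ≤ 1 / √η * (√η * x - (x - x')) ^ 2 := by positivity
      have k4 : 0 ≤ 1 / √η * (√η * x + (x - x')) ^ 2 := by positivity
      have k5 := sq_nonneg (x - x')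
      rw [abs_le]; constructor <;> nlinarith
    have h2 := hclose n
    rw [← mul_sub, abs_mul, abs_of_nonneg (by positivity : (0:ℝ) ≤ (n:ℝ)⁻¹)]
    calc _ ≤ (n:ℝ)⁻¹ * (√η * ∫ ω, (∑ t ∈ Finset.range n, Y (Z t ω)) ^ 2 ∂P + (1 / √η + 1) *
          (n * η)) := by
          refine mul_le_mul_of_nonneg_left (h1.trans ?_) (by positivity)
          gcongr
      _ = _ := by
        have : (1 / √η + 1) * η = √η + η := by
          rw [add_mul, one_mul, div_mul_eq_mul_div, one_mul, Real.div_sqrt]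
        rw [← this]; field_simp
  have hexp : ‖Complex.exp (-(u ^ 2 * σ' : ℝ) / 2) - Complex.exp (-(u ^ 2 * σ2 : ℝ) / 2)‖ ≤
      u ^ 2 / 2 * (√η * σ2 + (√η + η)) := by
    have e1 : ∀ s : ℝ, Complex.exp (-(u ^ 2 * s : ℝ) / 2) =
        ((Real.exp (-(u ^ 2 * s / 2)) : ℝ) : ℂ) := fun s => by push_cast; ring_nf
    rw [e1, e1, ← Complex.ofReal_sub, Complex.norm_real]
    refine (abs_exp_neg_sub_le (by positivity) (by positivity)).trans ?_
    rw [← sub_div, ← mul_sub, mul_div_right_comm, abs_mul, abs_of_nonneg (by positivity),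
      abs_sub_comm]
    gcongr
  have hev := Metric.tendsto_nhds.1 (H.clt_bdd hY' hM hσ' u) (e / 2) (half_pos he)
  filter_upwards [hev, eventually_gt_atTop 0] with n hn hn0
  have hn0 : (0:ℝ) < n := by exact_mod_cast hn0
  have hc : ‖∫ ω, Complex.exp (Complex.I *
      ((u * (√(n:ℝ))⁻¹ * ∑ t ∈ Finset.range n, Y (Z t ω) : ℝ) : ℂ)) ∂P - ∫ ω, Complex.exp (Complex.I *
      ((u * (√(n:ℝ))⁻¹ * ∑ t ∈ Finset.range n, Y' (Z t ω) : ℝ) : ℂ)) ∂P‖ ≤ |u| * √η := by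
    have e1 : ∀ ω, u * (√(n:ℝ))⁻¹ * ∑ t ∈ Finset.range n, Y (Z t ω) -
        u * (√(n:ℝ))⁻¹ * ∑ t ∈ Finset.range n, Y' (Z t ω) = u * (√(n:ℝ))⁻¹ *
        ∑ t ∈ Finset.range n, (Y (Z t ω) - Y' (Z t ω)) := fun ω => by
      rw [Finset.sum_sub_distrib]; ring
    refine (norm_charfun_sub_le ((hL n).const_mul _).aestronglyMeasurable
      ((hL' n).const_mul _).aestronglyMeasurable ?_).trans ?_
    · simp_rw [e1]; exact (hD n).const_mul _
    · simp_rw [e1, mul_pow]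
      rw [integral_const_mul, ← Real.sqrt_sq_eq_abs, ← Real.sqrt_mul (sq_nonneg u)]
      refine Real.sqrt_le_sqrt ?_
      calc _ ≤ u ^ 2 * (√(n:ℝ))⁻¹ ^ 2 * (n * η) := by
            refine mul_le_mul_of_nonneg_left (hclose n) (by positivity)
        _ = _ := by
            rw [inv_pow, Real.sq_sqrt hn0.le]; field_simp
  rw [dist_eq_norm] at hn ⊢
  calc _ ≤ _ := norm_sub_le_norm_sub_add_norm_sub _ (∫ ω, Complex.exp (Complex.I *
      ((u * (√(n:ℝ))⁻¹ * ∑ t ∈ Finset.range n, Y' (Z t ω) : ℝ) : ℂ)) ∂P) _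
    _ ≤ |u| * √η + (‖_ - Complex.exp (-(u ^ 2 * σ' : ℝ) / 2)‖ +
        ‖Complex.exp (-(u ^ 2 * σ' : ℝ) / 2) - Complex.exp (-(u ^ 2 * σ2 : ℝ) / 2)‖) :=
        add_le_add hc (norm_sub_le_norm_sub_add_norm_sub _ _ _)
    _ < e := by linarith

end MixProc
end
end

noncomputable section
set_option linter.unusedSectionVars false
set_option linter.unusedVariables false

lemma psd_finset {X : Type*} {h : X → X → ℝ}
    (hpsd : ∀ (m : ℕ) (c : Fin m → ℝ) (z : Fin m → X),
      0 ≤ ∑ i, ∑ j, c i * c j * h (z i) (z j)) (s : Finset X) (c : X → ℝ) :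
    0 ≤ ∑ x ∈ s, ∑ y ∈ s, c x * c y * h x y := by
  have := hpsd s.card (fun i => c (s.equivFin.symm i)) (fun i => s.equivFin.symm i)
  rw [← Finset.sum_coe_sort s (fun x => ∑ y ∈ s, c x * c y * h x y),
    ← s.equivFin.symm.sum_comp]
  refine this.trans (le_of_eq (Finset.sum_congr rfl fun i _ => ?_))
  rw [← Finset.sum_coe_sort s (fun y => c _ * c y * h _ y), ← s.equivFin.symm.sum_comp]

lemma exists_feature.{u} {X : Type u} {h : X → X → ℝ} (hsymm : ∀ z z', h z z' = h z' z)
    (hpsd : ∀ (m : ℕ) (c : Fin m → ℝ) (z : Fin m → X),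
      0 ≤ ∑ i, ∑ j, c i * c j * h (z i) (z j)) :
    ∃ (H : Type u) (_ : NormedAddCommGroup H) (_ : InnerProductSpace ℝ H) (_ : CompleteSpace H)
      (Φ : X → H), (∀ x y, inner ℝ (Φ x) (Φ y) = h x y) ∧
      (Submodule.span ℝ (Set.range Φ)).topologicalClosure = ⊤ := by
  let K : Matrix X X (ℝ →L[ℝ] ℝ) := Matrix.of fun x y => h x y • ContinuousLinearMap.id ℝ ℝ
  have hK : K.PosSemidef := by
    have htf := ((RKHS.posSemidef_tfae (K := K)).out 0 2)
    refine htf.2 ⟨?_, fun vv => ?_⟩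
    · ext x y
      simp [K, Matrix.conjTranspose_apply, hsymm x y, ContinuousLinearMap.star_eq_adjoint, ContinuousLinearMap.adjoint_id]
    · have := psd_finset hpsd vv.support vv
      simp only [Finsupp.sum]
      refine this.trans (le_of_eq ?_)
      simp only [K, RCLike.re_to_real]
      refine Finset.sum_congr rfl fun x _ => Finset.sum_congr rfl fun y _ => ?_
      simp [hsymm y x]; ring
  have : Fact K.PosSemidef := ⟨hK⟩
  refine ⟨RKHS.OfKernel K, inferInstance, inferInstance, inferInstance,
    fun x => RKHS.kerFun (RKHS.OfKernel K) x (1:ℝ), fun x y => ?_, ?_⟩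
  · have h1 := RKHS.kernel_inner (RKHS.OfKernel K) y x (1:ℝ) (1:ℝ)
    rw [RKHS.OfKernel.kernel_ofKernel] at h1
    rw [← h1]
    simp [K, hsymm x y]
  · rw [eq_top_iff, ← RKHS.kerFun_dense (RKHS.OfKernel K)]
    refine Submodule.topologicalClosure_mono (Submodule.span_le.2 ?_)
    rintro _ ⟨x, v, rfl⟩
    have : RKHS.kerFun (RKHS.OfKernel K) x v = v • RKHS.kerFun (RKHS.OfKernel K) x (1:ℝ) := by
      rw [← map_smul]; simp
    rw [this]
    exact Submodule.smul_mem _ _ (Submodule.subset_span ⟨x, rfl⟩)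
end

noncomputable section
set_option linter.unusedSectionVars false
set_option linter.unusedVariables false

lemma orthonormal_countable {H ι : Type*} [NormedAddCommGroup H] [InnerProductSpace ℝ H]
    [TopologicalSpace.SeparableSpace H] {v : ι → H} (hv : Orthonormal ℝ v) : Countable ι := by
  have hd : Pairwise (Function.onFun Disjoint fun i => Metric.ball (v i) (1/2)) := by
    intro i j hij
    refine Metric.ball_disjoint_ball ?_
    have h1 : dist (v i) (v j) ^ 2 = 2 := by
      rw [dist_eq_norm, @norm_sub_sq ℝ, hv.1 i, hv.1 j, hv.2 hij]; norm_num
    have h2 : (0:ℝ) ≤ dist (v i) (v j) := dist_nonneg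
    nlinarith
  exact hd.countable_of_isOpen_disjoint (fun i => Metric.isOpen_ball) 
    (fun i => ⟨v i, Metric.mem_ball_self (by norm_num)⟩)

lemma exists_eigenbasis {H : Type*} [NormedAddCommGroup H] [InnerProductSpace ℝ H]
    [CompleteSpace H] [TopologicalSpace.SeparableSpace H] (T : H →L[ℝ] H)
    (hc : IsCompactOperator T) (hs : (T : H →ₗ[ℝ] H).IsSymmetric) :
    ∃ (e : ℕ → H) (μ : ℕ → ℝ), (∀ i, T (e i) = μ i • e i) ∧ (∀ i, μ i * ‖e i‖ ^ 2 = μ i) ∧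
      ∀ x y, HasSum (fun i => inner ℝ x (e i) * inner ℝ (e i) y) (inner ℝ x y) := by
  have hclosed : ∀ μ : ℝ, IsClosed ((Module.End.eigenspace (T : H →ₗ[ℝ] H) μ : Submodule ℝ H) : Set H) :=
    fun μ => by
      have : ((Module.End.eigenspace (T : H →ₗ[ℝ] H) μ : Submodule ℝ H) : Set H) =
          {x | T x = μ • x} := by
        ext x; simp
      rw [this]
      exact isClosed_eq T.continuous (continuous_const_smul μ)
  have hcomp : ∀ μ : ℝ, CompleteSpace (Module.End.eigenspace (T : H →ₗ[ℝ] H) μ) := fun μ =>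
    (hclosed μ).completeSpace_coe
  choose w b hb using fun μ : ℝ => exists_hilbertBasis ℝ (Module.End.eigenspace (T : H →ₗ[ℝ] H) μ)
  let v : (Σ μ : ℝ, w μ) → H := fun x => ((b x.1 x.2 : Module.End.eigenspace (T : H →ₗ[ℝ] H) x.1) : H)
  have hv : Orthonormal ℝ v :=
    hs.orthogonalFamily_eigenspaces.orthonormal_sigma_orthonormal (fun μ => (b μ).orthonormal)
  have hbot : (Submodule.span ℝ (Set.range v))ᗮ = ⊥ := by
    rw [eq_bot_iff, ← ContinuousLinearMap.orthogonalComplement_iSup_eigenspaces_eq_bot hc hs]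
    intro x hx
    rw [Submodule.mem_orthogonal] at hx
    rw [← Submodule.iInf_orthogonal, Submodule.mem_iInf]
    intro μ
    rw [Submodule.mem_orthogonal]
    intro y hy
    have h1 := (b μ).hasSum_repr ⟨y, hy⟩
    have h2 := h1.mapL ((innerSL ℝ x).comp
      (Module.End.eigenspace (T : H →ₗ[ℝ] H) μ).subtypeL)
    have h3 : ∀ i : w μ, inner ℝ x (((b μ) i : Module.End.eigenspace (T : H →ₗ[ℝ] H) μ) : H) = 0 :=
      fun i => by
        rw [real_inner_comm]
        exact hx (v ⟨μ, i⟩) (Submodule.subset_span ⟨⟨μ, i⟩, rfl⟩)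
    rw [real_inner_comm]
    refine (h2.unique ?_)
    convert hasSum_zero using 1
    ext i
    simp [inner_smul_right, h3]
  have : Countable (Σ μ : ℝ, w μ) := orthonormal_countable hv
  obtain ⟨f, hf⟩ := exists_injective_nat (Σ μ : ℝ, w μ)
  let B := HilbertBasis.mkOfOrthogonalEqBot hv hbot
  have hB : ∀ i, B i = v i := fun i => by simp [B]
  refine ⟨Function.extend f v 0, Function.extend f (fun i => i.1) 0, fun n => ?_, fun n => ?_,
    fun x y => ?_⟩
  · by_cases hn : ∃ i, f i = n
    · obtain ⟨i, rfl⟩ := hn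
      rw [hf.extend_apply, hf.extend_apply]
      exact Module.End.mem_eigenspace_iff.1 (b i.1 i.2).2
    · simp [Function.extend_apply' _ _ _ hn]
  · by_cases hn : ∃ i, f i = n
    · obtain ⟨i, rfl⟩ := hn
      rw [hf.extend_apply, hf.extend_apply, hv.1 i]; simp
    · simp [Function.extend_apply' _ _ _ hn]
  · have h1 := B.hasSum_inner_mul_inner x y
    simp_rw [hB] at h1
    rw [← hasSum_extend_zero hf] at h1
    refine h1.congr_fun fun n => ?_
    by_cases hn : ∃ i, f i = n
    · obtain ⟨i, rfl⟩ := hn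
      rw [hf.extend_apply, hf.extend_apply]
    · simp [Function.extend_apply' _ _ _ hn]
end

noncomputable section
set_option linter.unusedSectionVars false
set_option linter.unusedVariables false

theorem mercer {𝒵 : Type*} [TopologicalSpace 𝒵] [TopologicalSpace.MetrizableSpace 𝒵]
    [SigmaCompactSpace 𝒵] [MeasurableSpace 𝒵] [BorelSpace 𝒵] (θ : Measure 𝒵)
    [IsProbabilityMeasure θ] (h : 𝒵 → 𝒵 → ℝ)
    (hcont : Continuous (Function.uncurry h)) (hsymm : ∀ z z', h z z' = h z' z)
    (hpsd : ∀ (m : ℕ) (c : Fin m → ℝ) (z : Fin m → 𝒵),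
      0 ≤ ∑ i, ∑ j, c i * c j * h (z i) (z j))
    (hdiag : Integrable (fun z => h z z) θ) :
    ∃ (lam : ℕ → ℝ) (ψ : ℕ → 𝒵 → ℝ), (∀ k, 0 ≤ lam k) ∧ (∀ k, Measurable (ψ k)) ∧
      (∀ z z', HasSum (fun k => ψ k z * ψ k z') (h z z')) ∧
      (∀ k z, ∫ z', h z z' * ψ k z' ∂θ = lam k * ψ k z) ∧
      (∀ k, ∫ z, ψ k z ^ 2 ∂θ = lam k) := by
  let _ := TopologicalSpace.metrizableSpaceMetric 𝒵
  have : SecondCountableTopology 𝒵 := inferInstance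
  obtain ⟨H, _, _, _, Φ, hΦ, hdense⟩ := exists_feature hsymm hpsd
  have hc2 : ∀ {f g : 𝒵 → 𝒵}, Continuous f → Continuous g → Continuous fun z => h (f z) (g z) :=
    fun hf hg => hcont.comp (hf.prodMk hg)
  have hnorm : ∀ z, ‖Φ z‖ * ‖Φ z‖ = h z z := fun z => by
    rw [← hΦ, real_inner_self_eq_norm_mul_norm]
  have hΦc : Continuous Φ := by
    rw [continuous_iff_continuousAt]
    intro z0
    rw [ContinuousAt, tendsto_iff_norm_sub_tendsto_zero]
    have h1 : ∀ z, ‖Φ z - Φ z0‖ = √(h z z - 2 * h z z0 + h z0 z0) := fun z => by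
      rw [← Real.sqrt_sq (norm_nonneg (Φ z - Φ z0)), @norm_sub_sq ℝ, hΦ, sq, hnorm, sq, hnorm]
      simp
    simp_rw [h1]
    have h2 : Continuous fun z => √(h z z - 2 * h z z0 + h z0 z0) :=
      (((hc2 continuous_id continuous_id).sub
        (continuous_const.mul (hc2 continuous_id continuous_const))).add continuous_const).sqrt
    have := h2.tendsto z0
    simpa [show h z0 z0 - 2 * h z0 z0 + h z0 z0 = 0 by ring] using this
  have hsep : TopologicalSpace.SeparableSpace H := by
    rw [← TopologicalSpace.isSeparable_univ_iff]
    have h1 : TopologicalSpace.IsSeparable (Set.range Φ) := TopologicalSpace.isSeparable_range hΦc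
    have h2 := (h1.span (R := ℝ)).closure
    have h3 : closure ((Submodule.span ℝ (Set.range Φ) : Submodule ℝ H) : Set H) = Set.univ := by
      rw [← Submodule.topologicalClosure_coe, hdense]; rfl
    rwa [h3] at h2
  let R : 𝒵 → H →L[ℝ] H := fun z => InnerProductSpace.rankOne ℝ (Φ z) (Φ z)
  have hRc : Continuous R := ((InnerProductSpace.rankOne ℝ).continuous.comp hΦc).clm_apply hΦc
  have hRi : Integrable R θ := by
    refine hdiag.mono hRc.stronglyMeasurable.aestronglyMeasurable (Eventually.of_forall fun z => ?_)
    rw [← hnorm]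
    simp [R]
  let S : H →L[ℝ] H := ∫ z, R z ∂θ
  have hS : ∀ x y, inner ℝ y (S x) = ∫ z, inner ℝ (Φ z) x * inner ℝ y (Φ z) ∂θ := fun x y => by
    have h1 : S x = ∫ z, R z x ∂θ := ContinuousLinearMap.integral_apply hRi x
    have h2 : Integrable (fun z => R z x) θ := hRi.apply_continuousLinearMap x
    rw [h1, ← integral_inner h2]
    simp [R, inner_smul_right]
  have hScomp : IsCompactOperator S := by
    have hcl : IsClosed {f : H →L[ℝ] H | IsCompactOperator f} :=
      isClosed_setOfPred_isCompactOperator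
    have hcv : Convex ℝ {f : H →L[ℝ] H | IsCompactOperator f} := by
      intro f hf g hg a b _ _ _
      exact (IsCompactOperator.smul hf a).add (IsCompactOperator.smul hg b)
    refine hcv.integral_mem hcl (Eventually.of_forall fun z => ?_) hRi
    have h1 : IsCompactOperator (ContinuousLinearMap.toSpanSingleton ℝ (Φ z)) :=
      isCompactOperator_of_locallyCompactSpace_rng _
    have h2 := h1.comp_clm (innerSL ℝ (Φ z))
    have e : (R z : H → H) = (ContinuousLinearMap.toSpanSingleton ℝ (Φ z)) ∘ (innerSL ℝ (Φ z)) := by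
      ext x; simp [R]
    show IsCompactOperator (R z)
    rw [e]; exact h2
  have hSs : (S : H →ₗ[ℝ] H).IsSymmetric := by
    intro x y
    show inner ℝ (S x) y = inner ℝ x (S y)
    rw [real_inner_comm, hS, hS]
    refine integral_congr_ae (Eventually.of_forall fun z => ?_)
    simp only
    rw [real_inner_comm (Φ z) x, real_inner_comm (Φ z) y]; ring
  obtain ⟨e, μ, he, hne, hsum⟩ := exists_eigenbasis S hScomp hSs
  have hsq : ∀ k, ∫ z, inner ℝ (Φ z) (e k) ^ 2 ∂θ = μ k := fun k => by
    have h1 := hS (e k) (e k)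
    rw [he, inner_smul_right, real_inner_self_eq_norm_sq, hne] at h1
    rw [h1]
    refine integral_congr_ae (Eventually.of_forall fun z => ?_)
    simp only
    rw [real_inner_comm (Φ z) (e k), sq]
  refine ⟨μ, fun k z => inner ℝ (Φ z) (e k), fun k => ?_, fun k => ?_, fun z z' => ?_,
    fun k z => ?_, hsq⟩
  · rw [← hsq]; exact integral_nonneg fun z => sq_nonneg _
  · exact (hΦc.inner continuous_const).measurable
  · have := hsum (Φ z) (Φ z')
    rw [hΦ] at this
    refine this.congr_fun fun k => ?_
    rw [real_inner_comm (Φ z') (e k)]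
  · have h1 := hS (e k) (Φ z)
    rw [he, inner_smul_right] at h1
    rw [h1]
    refine integral_congr_ae (Eventually.of_forall fun z' => ?_)
    simp only
    rw [hΦ, mul_comm]
end

noncomputable section
set_option linter.unusedSectionVars false
set_option linter.unusedVariables false

/-- The law of an i.i.d. sequence of standard Gaussian variables. -/
def Gm : Measure (ℕ → ℝ) := Measure.infinitePi fun _ : ℕ => gaussianReal 0 1

instance : IsProbabilityMeasure Gm := by unfold Gm; infer_instance

lemma gm_lin (s : Finset ℕ) (c : ℕ → ℝ) :
    Gm.map (fun g => ∑ m ∈ s, c m * g m) = gaussianReal 0 (∑ m ∈ s, c m ^ 2).toNNReal := by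
  have hind : iIndepFun (fun (m : ℕ) (g : ℕ → ℝ) => c m * g m) Gm :=
    iIndepFun_infinitePi (X := fun (m : ℕ) (x : ℝ) => c m * x) (fun i => by fun_prop)
  have hlaw : ∀ m, Gm.map (fun g => c m * g m) = gaussianReal 0 ((c m ^ 2).toNNReal) := fun m => by
    have h1 : Gm.map (fun g => g m) = gaussianReal 0 1 :=
      (measurePreserving_eval_infinitePi (fun _ : ℕ => gaussianReal 0 1) m).map_eq
    have h2 : (fun g : ℕ → ℝ => c m * g m) = (fun x => c m * x) ∘ (fun g => g m) := rfl
    rw [h2, ← Measure.map_map (by fun_prop) (by fun_prop), h1, gaussianReal_map_const_mul]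
    congr 1
    · simp
    · ext; simp [Real.coe_toNNReal _ (sq_nonneg (c m))]
  have hm : Measurable fun g : ℕ → ℝ => ∑ m ∈ s, c m * g m := by fun_prop
  have : IsProbabilityMeasure (Gm.map fun g => ∑ m ∈ s, c m * g m) :=
    Measure.isProbabilityMeasure_map hm.aemeasurable
  refine Measure.ext_of_charFun ?_
  have hcf := iIndepFun.charFun_map_fun_finsetSum_eq_prod (P := Gm) (s := s)
    (X := fun (m : ℕ) (g : ℕ → ℝ) => c m * g m) 
      (fun i _ => (measurable_const.mul (measurable_pi_apply i)).aemeasurable) (hind.restrict _)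
  rw [hcf]
  ext t
  simp_rw [hlaw, Finset.prod_apply, charFun_gaussianReal]
  rw [← Complex.exp_sum]
  congr 1
  rw [Real.coe_toNNReal _ (Finset.sum_nonneg fun i _ => sq_nonneg _)]
  simp only [Real.coe_toNNReal _ (sq_nonneg _)]
  simp only [Complex.ofReal_zero, mul_zero, zero_mul, zero_sub, Finset.sum_neg_distrib]
  rw [← Finset.sum_div, ← Finset.sum_mul]
  push_cast; rfl

lemma cholesky (Γ : ℕ → ℕ → ℝ) (hsymm : ∀ i j, Γ i j = Γ j i)
    (hpsd : ∀ (m : ℕ) (c : Fin m → ℝ) (z : Fin m → ℕ), 0 ≤ ∑ i, ∑ j, c i * c j * Γ (z i) (z j)) :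
    ∃ c : ℕ → ℕ → ℝ, (∀ i m, i < m → c i m = 0) ∧
      ∀ N i j, i < N → j < N → Γ i j = ∑ m ∈ Finset.range N, c i m * c j m := by
  obtain ⟨H, _, _, _, Φ, hΦ, -⟩ := exists_feature hsymm hpsd
  let G := InnerProductSpace.gramSchmidt ℝ Φ
  let a : ℕ → ℕ → ℝ := fun i m => if m < i then inner ℝ (G m) (Φ i) / ‖G m‖ ^ 2 else
    if m = i then 1 else 0
  have hrep : ∀ N i, i < N → Φ i = ∑ m ∈ Finset.range N, a i m • G m := fun N i hi => by
    have h1 := InnerProductSpace.gramSchmidt_def'' ℝ Φ i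
    have h2 : Finset.range N = Finset.Iio i ∪ ({i} ∪ Finset.Ico (i + 1) N) := by
      ext x; simp; omega
    rw [h2, Finset.sum_union, Finset.sum_union, Finset.sum_singleton]
    · have h3 : ∑ x ∈ Finset.Iio i, a i x • G x =
          ∑ x ∈ Finset.Iio i, (inner ℝ (G x) (Φ i) / ‖G x‖ ^ 2) • G x :=
        Finset.sum_congr rfl fun x hx => by simp [a, Finset.mem_Iio.1 hx]
      have h4 : ∑ x ∈ Finset.Ico (i + 1) N, a i x • G x = 0 :=
        Finset.sum_eq_zero fun x hx => by
          have := (Finset.mem_Ico.1 hx).1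
          have e1 : ¬ x < i := by omega
          have e2 : ¬ x = i := by omega
          simp [a, e1, e2]
      rw [h3, h4, add_zero]
      have h5 : a i i = 1 := by simp [a]
      rw [h5, one_smul, add_comm]
      simpa using h1
    · rw [Finset.disjoint_left]; intro x hx hx'; simp at hx hx'; omega
    · rw [Finset.disjoint_left]; intro x hx hx'; simp at hx hx'; omega
  refine ⟨fun i m => a i m * ‖G m‖, fun i m him => ?_, fun N i j hi hj => ?_⟩
  · have e1 : ¬ m < i := by omega
    have e2 : ¬ m = i := by omega
    simp [a, e1, e2]
  · rw [← hΦ, hrep N i hi, hrep N j hj, sum_inner]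
    refine Finset.sum_congr rfl fun m hm => ?_
    rw [inner_sum, Finset.sum_eq_single m]
    · rw [inner_smul_left, inner_smul_right, real_inner_self_eq_norm_sq]; simp; ring
    · intro b _ hb
      rw [inner_smul_left, inner_smul_right, InnerProductSpace.gramSchmidt_orthogonal ℝ Φ hb.symm]
      simp
    · intro hm'; exact absurd hm hm'

lemma gaussian_exists (Γ : ℕ → ℕ → ℝ) (hsymm : ∀ i j, Γ i j = Γ j i)
    (hpsd : ∀ (m : ℕ) (c : Fin m → ℝ) (z : Fin m → ℕ), 0 ≤ ∑ i, ∑ j, c i * c j * Γ (z i) (z j)) :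
    ∃ ζ : ℕ → (ℕ → ℝ) → ℝ, (∀ k, Measurable (ζ k)) ∧ ∀ (N : ℕ) (u : ℕ → ℝ),
      Gm.map (fun g => ∑ i ∈ Finset.range N, u i * ζ i g) = gaussianReal 0
        (∑ i ∈ Finset.range N, ∑ j ∈ Finset.range N, u i * u j * Γ i j).toNNReal := by
  obtain ⟨c, hc0, hc⟩ := cholesky Γ hsymm hpsd
  refine ⟨fun i g => ∑ m ∈ Finset.range (i + 1), c i m * g m, fun k => by fun_prop, fun N u => ?_⟩
  have h1 : ∀ i ∈ Finset.range N, ∀ g : ℕ → ℝ, ∑ m ∈ Finset.range (i + 1), c i m * g m =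
      ∑ m ∈ Finset.range N, c i m * g m := fun i hi g => by
    refine Finset.sum_subset ?_ fun m _ hm => ?_
    · have := Finset.mem_range.1 hi
      intro x; simp; omega
    · rw [hc0 i m (by simp at hm; omega), zero_mul]
  have h2 : (fun g : ℕ → ℝ => ∑ i ∈ Finset.range N, u i * ∑ m ∈ Finset.range (i + 1), c i m * g m) =
      fun g => ∑ m ∈ Finset.range N, (∑ i ∈ Finset.range N, u i * c i m) * g m := by
    ext g
    rw [Finset.sum_congr rfl fun i hi => by rw [h1 i hi g]]
    simp_rw [Finset.mul_sum, Finset.sum_mul]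
    rw [Finset.sum_comm]
    simp_rw [mul_assoc]
  rw [h2, gm_lin]
  congr 2
  simp_rw [sq, Finset.sum_mul_sum]
  rw [Finset.sum_comm]
  refine Finset.sum_congr rfl fun i hi => ?_
  rw [Finset.sum_comm]
  refine Finset.sum_congr rfl fun j hj => ?_
  rw [hc N i j (Finset.mem_range.1 hi) (Finset.mem_range.1 hj), Finset.mul_sum]
  exact Finset.sum_congr rfl fun m _ => by ring

end

noncomputable section
set_option linter.unusedSectionVars false
set_option linter.unusedVariables false

/-- absolute moments of the standard Gaussian -/
def gmom (q : ℝ) : ℝ := ∫ x, |x| ^ q ∂(gaussianReal 0 1)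

lemma gmom_nonneg (q : ℝ) : 0 ≤ gmom q := integral_nonneg fun x => by positivity

lemma gmom_two : gmom 2 = 1 := by
  have h := variance_fun_id_gaussianReal (μ := 0) (v := 1)
  rw [variance_of_integral_eq_zero (by fun_prop) (by simp)] at h
  unfold gmom
  simpa using h

lemma gauss_int (q : ℝ) (hq : 0 < q) : Integrable (fun x => |x| ^ q) (gaussianReal 0 1) := by
  have h := (memLp_id_gaussianReal' (μ := 0) (v := 1) (ENNReal.ofReal q) ENNReal.ofReal_ne_top)
  have := h.integrable_norm_rpow (by simpa using hq) ENNReal.ofReal_ne_top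
  simpa [ENNReal.toReal_ofReal hq.le] using this

lemma gm_moment (q : ℝ) (hq : 0 < q) (s : Finset ℕ) (x : ℕ → ℝ) :
    Integrable (fun g : ℕ → ℝ => |∑ i ∈ s, x i * g i| ^ q) Gm ∧
    ∫ g, |∑ i ∈ s, x i * g i| ^ q ∂Gm = (∑ i ∈ s, x i ^ 2) ^ (q / 2) * gmom q := by
  set v := ∑ i ∈ s, x i ^ 2 with hv
  have hv0 : 0 ≤ v := Finset.sum_nonneg fun i _ => sq_nonneg _
  have h1 := gm_lin s x
  have h2 : gaussianReal 0 v.toNNReal = (gaussianReal 0 1).map (fun y => √v * y) := by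
    rw [gaussianReal_map_const_mul]
    congr 1
    · simp
    · ext; simp [Real.sq_sqrt hv0, Real.coe_toNNReal _ hv0]
  rw [← hv, h2] at h1
  have hm : Measurable fun g : ℕ → ℝ => ∑ m ∈ s, x m * g m := by fun_prop
  have hm2 : Measurable fun y : ℝ => √v * y := by fun_prop
  have hF : StronglyMeasurable fun y : ℝ => |y| ^ q := by
    exact (measurable_id.abs.pow_const q).stronglyMeasurable
  have e : ∀ y : ℝ, |√v * y| ^ q = v ^ (q / 2) * |y| ^ q := fun y => by
    rw [abs_mul, abs_of_nonneg (Real.sqrt_nonneg v), Real.mul_rpow (Real.sqrt_nonneg v) (abs_nonneg y),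
      Real.sqrt_eq_rpow, ← Real.rpow_mul hv0]
    congr 2; ring
  have hi : Integrable (fun y : ℝ => |y| ^ q) (Gm.map fun g : ℕ → ℝ => ∑ m ∈ s, x m * g m) := by
    rw [h1, integrable_map_measure hF.aestronglyMeasurable hm2.aemeasurable]
    simp only [Function.comp_def, e]
    exact (gauss_int q hq).const_mul _
  refine ⟨hi.comp_measurable hm, ?_⟩
  have h3 := integral_map (μ := Gm) hm.aemeasurable (f := fun y : ℝ => |y| ^ q) hF.aestronglyMeasurable
  rw [← h3, h1, integral_map hm2.aemeasurable hF.aestronglyMeasurable]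
  simp only [e]
  rw [integral_const_mul]; rfl

section
variable {Ω : Type*} [MeasurableSpace Ω] {P : Measure Ω} [IsProbabilityMeasure P]

lemma gauss_fubini (q : ℝ) (hq : 0 < q) (s : Finset ℕ) (X : ℕ → Ω → ℝ) (hX : ∀ i, Measurable (X i))
    (hIntg : Integrable (fun ω => (∑ i ∈ s, X i ω ^ 2) ^ (q / 2)) P) :
    Integrable (fun g : ℕ → ℝ => ∫ ω, |∑ i ∈ s, X i ω * g i| ^ q ∂P) Gm ∧
    ∫ g, ∫ ω, |∑ i ∈ s, X i ω * g i| ^ q ∂P ∂Gm =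
      (∫ ω, (∑ i ∈ s, X i ω ^ 2) ^ (q / 2) ∂P) * gmom q := by
  have hm : Measurable (fun z : Ω × (ℕ → ℝ) => |∑ i ∈ s, X i z.1 * z.2 i| ^ q) := by
    refine Measurable.pow_const (Measurable.abs ?_) q
    refine Finset.measurable_sum _ fun i _ => ?_
    exact ((hX i).comp measurable_fst).mul ((measurable_pi_apply i).comp measurable_snd)
  have hI : Integrable (fun z : Ω × (ℕ → ℝ) => |∑ i ∈ s, X i z.1 * z.2 i| ^ q) (P.prod Gm) := by
    rw [integrable_prod_iff hm.aestronglyMeasurable]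
    refine ⟨Eventually.of_forall fun ω => (gm_moment q hq s fun i => X i ω).1, ?_⟩
    have : ∀ ω, ∫ g, ‖|∑ i ∈ s, X i ω * g i| ^ q‖ ∂Gm =
        (∑ i ∈ s, X i ω ^ 2) ^ (q / 2) * gmom q := fun ω => by
      rw [← (gm_moment q hq s fun i => X i ω).2]
      refine integral_congr_ae (Eventually.of_forall fun g => ?_)
      simp only
      rw [Real.norm_eq_abs, abs_of_nonneg (by positivity)]
    simp only [this]
    exact hIntg.mul_const _
  refine ⟨hI.integral_prod_right, ?_⟩
  rw [← integral_integral_swap hI, ← integral_mul_const]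
  exact integral_congr_ae (Eventually.of_forall fun ω => (gm_moment q hq s fun i => X i ω).2)

end

namespace MixProc
section
variable {Ω 𝒵 : Type*} [MeasurableSpace Ω] [m𝒵 : MeasurableSpace 𝒵] {P : Measure Ω}
  [IsProbabilityMeasure P] {Z : ℕ → Ω → 𝒵} {p r C : ℝ}

lemma hilbert_var_bound (H : MixProc P Z p r C) {Y : ℕ → 𝒵 → ℝ} (hY : ∀ i, Good P Z p (Y i))
    (s : Finset ℕ) (hs : Integrable (fun ω => (∑ i ∈ s, Y i (Z 0 ω) ^ 2) ^ (p / 2)) P)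
    {w : ℝ} (hw : 0 < w) (I : Finset ℕ) :
    ∑ i ∈ s, ∫ ω, (∑ t ∈ I, Y i (Z t ω)) ^ 2 ∂P ≤ I.card * (K0 p r C * (w ^ 2 + w ^ (2 - p) *
      ((∫ ω, (∑ i ∈ s, Y i (Z 0 ω) ^ 2) ^ (p / 2) ∂P) * gmom p))) := by
  have hp0 : 0 < p := by linarith [H.hp]
  have hSm : ∀ i, Measurable fun ω => ∑ t ∈ I, Y i (Z t ω) := fun i =>
    Finset.measurable_sum _ fun t _ => (hY i).meas.comp (H.meas t)
  have hS2 : ∀ i, Integrable (fun ω => (∑ t ∈ I, Y i (Z t ω)) ^ 2) P := fun i =>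
    (memLp_finsetSum I fun t _ => (hY i).memLp H t).integrable_sq
  have hf1 := gauss_fubini (P := P) 2 two_pos s (fun i ω => ∑ t ∈ I, Y i (Z t ω)) hSm (by
    simp only [div_self (two_ne_zero' ℝ), Real.rpow_one]
    exact integrable_finsetSum _ fun i _ => hS2 i)
  have hf2 := gauss_fubini (P := P) p hp0 s (fun i ω => Y i (Z 0 ω))
    (fun i => (hY i).meas.comp (H.meas 0)) hs
  have h1 : ∑ i ∈ s, ∫ ω, (∑ t ∈ I, Y i (Z t ω)) ^ 2 ∂P =
      ∫ g, ∫ ω, |∑ i ∈ s, (∑ t ∈ I, Y i (Z t ω)) * g i| ^ (2 : ℝ) ∂P ∂Gm := by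
    rw [hf1.2, gmom_two, mul_one, ← integral_finsetSum _ fun i _ => hS2 i]
    simp
  rw [h1, ← hf2.2]
  have h2 : ∀ g : ℕ → ℝ, ∫ ω, |∑ i ∈ s, (∑ t ∈ I, Y i (Z t ω)) * g i| ^ (2 : ℝ) ∂P ≤
      I.card * (K0 p r C * (w ^ 2 + w ^ (2 - p) * ∫ ω, |∑ i ∈ s, Y i (Z 0 ω) * g i| ^ p ∂P)) := by
    intro g
    have := H.var_bound (Good.lin H s g (fun i _ => hY i)) hw I
    refine (le_of_eq ?_).trans (this.trans (le_of_eq ?_))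
    · refine integral_congr_ae (Eventually.of_forall fun ω => ?_)
      simp only [Real.rpow_two, sq_abs]
      congr 1
      rw [Finset.sum_comm]
      exact Finset.sum_congr rfl fun i _ => by rw [Finset.sum_mul]; simp_rw [mul_comm]
    · simp_rw [mul_comm]
  refine (integral_mono hf1.1 ?_ h2).trans (le_of_eq ?_)
  · exact (((integrable_const _).add (hf2.1.const_mul _)).const_mul _).const_mul _
  · rw [integral_const_mul, integral_const_mul, integral_add (integrable_const _) (hf2.1.const_mul _),
      integral_const_mul]
    simp

end
end MixProc
end

noncomputable section
set_option linter.unusedSectionVars false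
set_option linter.unusedVariables false

namespace MixProc
section
variable {Ω 𝒵 : Type*} [MeasurableSpace Ω] [m𝒵 : MeasurableSpace 𝒵] {P : Measure Ω}
  [IsProbabilityMeasure P] {Z : ℕ → Ω → 𝒵} {p r C : ℝ}

lemma hilbert_tail (H : MixProc P Z p r C) {Y : ℕ → 𝒵 → ℝ} (hY : ∀ i, Good P Z p (Y i))
    {B : 𝒵 → ℝ} (hsum : ∀ z, HasSum (fun i => Y i z ^ 2) (B z))
    (hB : Integrable (fun ω => B (Z 0 ω) ^ (p / 2)) P) {η : ℝ} (hη : 0 < η) :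
    ∃ K : ℕ, ∀ n L : ℕ, ∑ i ∈ Finset.Ico K L, ∫ ω, (∑ t ∈ Finset.range n, Y i (Z t ω)) ^ 2 ∂P ≤
      n * η := by
  have hp2 : 0 < p / 2 := by linarith [H.hp]
  have hK0 := H.K0_nonneg
  obtain ⟨w, hw, hwη⟩ : ∃ w : ℝ, 0 < w ∧ K0 p r C * w ^ 2 ≤ η / 2 := by
    have h1 : Tendsto (fun w : ℝ => K0 p r C * w ^ 2) (𝓝[>] 0) (𝓝 (K0 p r C * 0 ^ 2)) :=
      ((continuous_const.mul (continuous_pow 2)).tendsto 0).mono_left nhdsWithin_le_nhds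
    simp only [ne_eq, OfNat.ofNat_ne_zero, not_false_eq_true, zero_pow, mul_zero] at h1
    have h2 := (h1.eventually_lt_const (half_pos hη)).and self_mem_nhdsWithin
    obtain ⟨w, hw1, hw2⟩ := h2.exists
    exact ⟨w, hw2, hw1.le⟩
  have hYm : ∀ i, Measurable fun ω => Y i (Z 0 ω) := fun i => (hY i).meas.comp (H.meas 0)
  have hpart : ∀ (s : Finset ℕ) z, ∑ i ∈ s, Y i z ^ 2 ≤ B z := fun s z =>
    sum_le_hasSum s (fun i _ => sq_nonneg _) (hsum z)
  have hB0 : ∀ z, 0 ≤ B z := fun z => by simpa using hpart ∅ z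
  have hsint : ∀ s : Finset ℕ, Integrable (fun ω => (∑ i ∈ s, Y i (Z 0 ω) ^ 2) ^ (p / 2)) P := by
    intro s
    refine hB.mono' ?_ (Eventually.of_forall fun ω => ?_)
    · exact ((Finset.measurable_fun_sum _ fun i _ => (hYm i).pow_const 2).pow_const
        (p / 2)).aestronglyMeasurable
    · have h0 : 0 ≤ ∑ i ∈ s, Y i (Z 0 ω) ^ 2 := Finset.sum_nonneg fun i _ => sq_nonneg _
      rw [Real.norm_eq_abs, abs_of_nonneg (by positivity)]
      exact Real.rpow_le_rpow h0 (hpart s _) hp2.le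
  have hBm : Measurable fun ω => B (Z 0 ω) := by
    refine measurable_of_tendsto_metrizable (f := fun N ω => ∑ i ∈ Finset.range N, Y i (Z 0 ω) ^ 2)
      (fun N => Finset.measurable_fun_sum _ fun i _ => (hYm i).pow_const 2) ?_
    rw [tendsto_pi_nhds]
    exact fun ω => (hsum _).tendsto_sum_nat
  let D : ℕ → Ω → ℝ := fun K ω => (B (Z 0 ω) - ∑ i ∈ Finset.range K, Y i (Z 0 ω) ^ 2) ^ (p / 2)
  have hD0 : ∀ K ω, 0 ≤ B (Z 0 ω) - ∑ i ∈ Finset.range K, Y i (Z 0 ω) ^ 2 := fun K ω =>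
    sub_nonneg.2 (hpart _ _)
  have hDm : ∀ K, AEStronglyMeasurable (D K) P := fun K =>
    ((hBm.sub (Finset.measurable_fun_sum _ fun i _ => (hYm i).pow_const 2)).pow_const
        (p / 2)).aestronglyMeasurable
  have hDb : ∀ K, ∀ᵐ ω ∂P, ‖D K ω‖ ≤ B (Z 0 ω) ^ (p / 2) := fun K =>
    Eventually.of_forall fun ω => by
      have := hD0 K ω
      rw [Real.norm_eq_abs, abs_of_nonneg (Real.rpow_nonneg this _)]
      refine Real.rpow_le_rpow this ?_ hp2.le
      have : 0 ≤ ∑ i ∈ Finset.range K, Y i (Z 0 ω) ^ 2 := Finset.sum_nonneg fun i _ => sq_nonneg _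
      linarith
  have hDlim : Tendsto (fun K => ∫ ω, D K ω ∂P) atTop (𝓝 (∫ ω, (0 : ℝ) ∂P)) := by
    refine tendsto_integral_of_dominated_convergence _ hDm hB hDb (Eventually.of_forall fun ω => ?_)
    have h1 : Tendsto (fun K => B (Z 0 ω) - ∑ i ∈ Finset.range K, Y i (Z 0 ω) ^ 2) atTop (𝓝 0) := by
      have := (hsum (Z 0 ω)).tendsto_sum_nat.const_sub (B (Z 0 ω))
      simpa using this
    have := h1.rpow_const (p := p / 2) (Or.inr hp2.le)
    simpa [Real.zero_rpow hp2.ne'] using this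
  have h3 : Tendsto (fun K => K0 p r C * (w ^ (2 - p) * ((∫ ω, D K ω ∂P) * gmom p))) atTop (𝓝 0) := by
    have := ((hDlim.mul_const (gmom p)).const_mul (w ^ (2 - p))).const_mul (K0 p r C)
    simpa using this
  obtain ⟨K, hK⟩ := (h3.eventually_lt_const (half_pos hη)).exists
  refine ⟨K, fun n L => ?_⟩
  refine (H.hilbert_var_bound hY (Finset.Ico K L) (hsint _) hw (Finset.range n)).trans ?_
  rw [Finset.card_range]
  refine mul_le_mul_of_nonneg_left ?_ (Nat.cast_nonneg n)
  have h4 : ∫ ω, (∑ i ∈ Finset.Ico K L, Y i (Z 0 ω) ^ 2) ^ (p / 2) ∂P ≤ ∫ ω, D K ω ∂P := by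
    refine integral_mono (hsint _) (hB.mono' (hDm K) (hDb K)) fun ω => ?_
    refine Real.rpow_le_rpow (Finset.sum_nonneg fun i _ => sq_nonneg _) ?_ hp2.le
    have h5 := hpart (Finset.range K ∪ Finset.Ico K L) (Z 0 ω)
    rw [Finset.sum_union] at h5
    · linarith
    · rw [Finset.disjoint_left]; intro x hx hx'; simp at hx hx'; omega
  have h6 : K0 p r C * (w ^ (2 - p) *
      ((∫ ω, (∑ i ∈ Finset.Ico K L, Y i (Z 0 ω) ^ 2) ^ (p / 2) ∂P) * gmom p)) ≤
      K0 p r C * (w ^ (2 - p) * ((∫ ω, D K ω ∂P) * gmom p)) := by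
    have := gmom_nonneg p
    gcongr
  rw [mul_add]
  linarith

lemma exists_cov (H : MixProc P Z p r C) {Y : ℕ → 𝒵 → ℝ} (hY : ∀ i, Good P Z p (Y i)) :
    ∃ Γ : ℕ → ℕ → ℝ, ∀ i j, Tendsto (fun n : ℕ => (n : ℝ)⁻¹ *
      ∫ ω, (∑ t ∈ Finset.range n, Y i (Z t ω)) * (∑ t ∈ Finset.range n, Y j (Z t ω)) ∂P)
      atTop (𝓝 (Γ i j)) := by
  have key : ∀ i j, ∃ x, Tendsto (fun n : ℕ => (n : ℝ)⁻¹ *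
      ∫ ω, (∑ t ∈ Finset.range n, Y i (Z t ω)) * (∑ t ∈ Finset.range n, Y j (Z t ω)) ∂P)
      atTop (𝓝 x) := by
    intro i j
    let Y2 : Fin 2 → 𝒵 → ℝ := ![Y i, Y j]
    have hY2 : ∀ k ∈ Finset.univ, Good P Z p (Y2 k) := by
      intro k _; fin_cases k
      · exact hY i
      · exact hY j
    have g1 := Good.lin H Finset.univ (![1, 1] : Fin 2 → ℝ) hY2
    have g2 := Good.sub H (hY i) (hY j)
    obtain ⟨a, ha⟩ := H.tendsto_var g1
    obtain ⟨b, hb⟩ := H.tendsto_var g2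
    refine ⟨4⁻¹ * (a - b), ((ha.sub hb).const_mul _).congr fun n => ?_⟩
    have hm1 : MemLp (fun ω => ∑ t ∈ Finset.range n, ∑ k : Fin 2, (![1, 1] : Fin 2 → ℝ) k * Y2 k (Z t ω)) 2 P :=
      memLp_finsetSum _ fun t _ => g1.memLp H t
    have hm2 : MemLp (fun ω => ∑ t ∈ Finset.range n, (Y i (Z t ω) - Y j (Z t ω))) 2 P :=
      memLp_finsetSum _ fun t _ => g2.memLp H t
    rw [← mul_sub, ← integral_sub hm1.integrable_sq hm2.integrable_sq, mul_left_comm,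
      ← integral_const_mul]
    congr 1
    refine integral_congr_ae (Eventually.of_forall fun ω => ?_)
    simp only [Fin.sum_univ_two, Y2]
    simp only [Matrix.cons_val_zero, Matrix.cons_val_one, one_mul, Finset.sum_add_distrib,
      Finset.sum_sub_distrib]
    ring
  choose Γ hΓ using key
  exact ⟨Γ, hΓ⟩

lemma tendsto_var_lin (H : MixProc P Z p r C) {Y : ℕ → 𝒵 → ℝ} (hY : ∀ i, Good P Z p (Y i))
    {Γ : ℕ → ℕ → ℝ} (hΓ : ∀ i j, Tendsto (fun n : ℕ => (n : ℝ)⁻¹ *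
      ∫ ω, (∑ t ∈ Finset.range n, Y i (Z t ω)) * (∑ t ∈ Finset.range n, Y j (Z t ω)) ∂P)
      atTop (𝓝 (Γ i j))) {ι : Type*} (s : Finset ι) (c : ι → ℝ) (z : ι → ℕ) :
    Tendsto (fun n : ℕ => (n : ℝ)⁻¹ *
      ∫ ω, (∑ t ∈ Finset.range n, ∑ i ∈ s, c i * Y (z i) (Z t ω)) ^ 2 ∂P) atTop
      (𝓝 (∑ i ∈ s, ∑ j ∈ s, c i * c j * Γ (z i) (z j))) := by
  have h1 : Tendsto (fun n : ℕ => ∑ i ∈ s, ∑ j ∈ s, c i * c j * ((n : ℝ)⁻¹ *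
      ∫ ω, (∑ t ∈ Finset.range n, Y (z i) (Z t ω)) * (∑ t ∈ Finset.range n, Y (z j) (Z t ω)) ∂P))
      atTop (𝓝 (∑ i ∈ s, ∑ j ∈ s, c i * c j * Γ (z i) (z j))) :=
    tendsto_finsetSum _ fun i _ => tendsto_finsetSum _ fun j _ => (hΓ _ _).const_mul _
  refine h1.congr fun n => ?_
  have hm : ∀ k, MemLp (fun ω => ∑ t ∈ Finset.range n, Y k (Z t ω)) 2 P := fun k =>
    memLp_finsetSum _ fun t _ => (hY k).memLp H t
  have h2 : ∀ i j, Integrable (fun ω => c i * c j * ((∑ t ∈ Finset.range n, Y (z i) (Z t ω)) *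
      (∑ t ∈ Finset.range n, Y (z j) (Z t ω)))) P := fun i j =>
    ((hm _).integrable_mul (hm _)).const_mul _
  have h3 : ∀ ω, (∑ t ∈ Finset.range n, ∑ i ∈ s, c i * Y (z i) (Z t ω)) ^ 2 =
      ∑ i ∈ s, ∑ j ∈ s, c i * c j * ((∑ t ∈ Finset.range n, Y (z i) (Z t ω)) *
      (∑ t ∈ Finset.range n, Y (z j) (Z t ω))) := fun ω => by
    rw [Finset.sum_comm, sq, Finset.sum_mul_sum]
    refine Finset.sum_congr rfl fun i _ => Finset.sum_congr rfl fun j _ => ?_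
    rw [← Finset.mul_sum, ← Finset.mul_sum]; ring
  simp_rw [h3]
  rw [integral_finsetSum _ fun i _ => integrable_finsetSum _ fun j _ => h2 i j, Finset.mul_sum]
  refine Finset.sum_congr rfl fun i _ => ?_
  rw [integral_finsetSum _ fun j _ => h2 i j, Finset.mul_sum]
  refine Finset.sum_congr rfl fun j _ => ?_
  rw [integral_const_mul]; ring

end
end MixProc
end

noncomputable section
set_option linter.unusedSectionVars false
set_option linter.unusedVariables false

namespace MixProc
section
variable {Ω 𝒵 : Type*} [MeasurableSpace Ω] [m𝒵 : MeasurableSpace 𝒵] {P : Measure Ω}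
  [IsProbabilityMeasure P] {Z : ℕ → Ω → 𝒵} {p r C : ℝ}

lemma finite_dim (H : MixProc P Z p r C) {Y : ℕ → 𝒵 → ℝ} (hY : ∀ i, Good P Z p (Y i))
    {Γ : ℕ → ℕ → ℝ} (hΓ : ∀ i j, Tendsto (fun n : ℕ => (n : ℝ)⁻¹ *
      ∫ ω, (∑ t ∈ Finset.range n, Y i (Z t ω)) * (∑ t ∈ Finset.range n, Y j (Z t ω)) ∂P)
      atTop (𝓝 (Γ i j))) {ζ : ℕ → (ℕ → ℝ) → ℝ} (hζm : ∀ k, Measurable (ζ k))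
    (hζ : ∀ (N : ℕ) (u : ℕ → ℝ), Gm.map (fun g => ∑ i ∈ Finset.range N, u i * ζ i g) =
      gaussianReal 0 (∑ i ∈ Finset.range N, ∑ j ∈ Finset.range N, u i * u j * Γ i j).toNNReal)
    (K : ℕ) (lam : ℕ → ℝ) (f : BoundedContinuousFunction ℝ ℝ) :
    Tendsto (fun n : ℕ => ∫ ω, f (∑ k ∈ Finset.range K,
      lam k * ((n : ℝ)⁻¹ * (∑ t ∈ Finset.range n, Y k (Z t ω)) ^ 2)) ∂P) atTop
      (𝓝 (∫ g, f (∑ k ∈ Finset.range K, lam k * ζ k g ^ 2) ∂Gm)) := by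
  let X : ℕ → Ω → EuclideanSpace ℝ (Fin K) := fun n ω =>
    WithLp.toLp 2 (fun k : Fin K => (√(n:ℝ))⁻¹ * ∑ t ∈ Finset.range n, Y k (Z t ω))
  let W : (ℕ → ℝ) → EuclideanSpace ℝ (Fin K) := fun g => WithLp.toLp 2 (fun k : Fin K => ζ k g)
  have hX : ∀ n, Measurable (X n) := fun n =>
    (WithLp.measurable_toLp 2 _).comp (measurable_pi_lambda _ fun k =>
      (Finset.measurable_fun_sum _ fun t _ => (hY k).meas.comp (H.meas t)).const_mul _)
  have hW : Measurable W :=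
    (WithLp.measurable_toLp 2 _).comp (measurable_pi_lambda _ fun k => hζm k)
  let μs : ℕ → ProbabilityMeasure (EuclideanSpace ℝ (Fin K)) := fun n =>
    ⟨P.map (X n), Measure.isProbabilityMeasure_map (hX n).aemeasurable⟩
  let μ : ProbabilityMeasure (EuclideanSpace ℝ (Fin K)) :=
    ⟨Gm.map W, Measure.isProbabilityMeasure_map hW.aemeasurable⟩
  have hlim : Tendsto μs atTop (𝓝 μ) := by
    refine ProbabilityMeasure.tendsto_of_tendsto_charFun fun x => ?_
    have hvar := H.tendsto_var_lin hY hΓ (Finset.univ : Finset (Fin K)) (fun k => x k) (fun k => (k : ℕ))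
    have hclt := H.clt (Good.lin H (Finset.univ : Finset (Fin K)) (fun k => x k)
      (fun k _ => hY (k : ℕ))) hvar 1
    set σ2 := ∑ i : Fin K, ∑ j : Fin K, x i * x j * Γ i j with hσ2
    have hσ0 : 0 ≤ σ2 := ge_of_tendsto' hvar fun n =>
      mul_nonneg (by positivity) (integral_nonneg fun ω => sq_nonneg _)
    have e1 : charFun (μ : Measure (EuclideanSpace ℝ (Fin K))) x =
        Complex.exp (-((1:ℝ) ^ 2 * σ2 : ℝ) / 2) := by
      let u : ℕ → ℝ := fun i => if hi : i < K then x ⟨i, hi⟩ else 0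
      have hl := hζ K u
      have hs : (∑ i ∈ Finset.range K, ∑ j ∈ Finset.range K, u i * u j * Γ i j) = σ2 := by
        rw [Finset.sum_range, hσ2]
        refine Finset.sum_congr rfl fun i _ => ?_
        rw [Finset.sum_range]
        refine Finset.sum_congr rfl fun j _ => ?_
        simp [u]
      rw [hs] at hl
      have hc : charFun (gaussianReal 0 σ2.toNNReal) 1 = charFun (Gm.map W) x := by
        rw [← hl, charFun_apply, charFun_apply, integral_map, integral_map hW.aemeasurable]
        · refine integral_congr_ae (Eventually.of_forall fun g => ?_)
          simp only
          congr 3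
          rw [PiLp.inner_apply, Finset.sum_range]
          simp [W, u]
        · fun_prop
        · exact (Finset.measurable_fun_sum _ fun i _ => (hζm i).const_mul _).aemeasurable
        · fun_prop
      change charFun (Gm.map W) x = _
      rw [← hc, charFun_gaussianReal, Real.coe_toNNReal _ hσ0]
      congr 1
      push_cast; ring
    rw [e1]
    refine hclt.congr fun n => ?_
    change _ = charFun (P.map (X n)) x
    rw [charFun_apply, integral_map (hX n).aemeasurable (by fun_prop)]
    refine integral_congr_ae (Eventually.of_forall fun ω => ?_)
    simp only
    rw [mul_comm]
    congr 3
    rw [PiLp.inner_apply]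
    simp only [X, one_mul, RCLike.inner_apply, conj_trivial]
    rw [Finset.sum_comm, Finset.mul_sum]
    refine Finset.sum_congr rfl fun k _ => ?_
    rw [← Finset.mul_sum]; ring
  let q : C(EuclideanSpace ℝ (Fin K), ℝ) := ⟨fun x => ∑ k : Fin K, lam k * x k ^ 2, by fun_prop⟩
  have h2 := (ProbabilityMeasure.tendsto_iff_forall_integral_tendsto.1 hlim) (f.compContinuous q)
  have e2 : ∫ x, (f.compContinuous q) x ∂(μ : Measure (EuclideanSpace ℝ (Fin K))) =
      ∫ g, f (∑ k ∈ Finset.range K, lam k * ζ k g ^ 2) ∂Gm := by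
    change ∫ x, (f.compContinuous q) x ∂(Gm.map W) = _
    rw [integral_map hW.aemeasurable (f.compContinuous q).continuous.aestronglyMeasurable]
    refine integral_congr_ae (Eventually.of_forall fun g => ?_)
    simp only [BoundedContinuousFunction.compContinuous_apply]
    rw [Finset.sum_range]; rfl
  rw [e2] at h2
  refine h2.congr fun n => ?_
  change ∫ x, (f.compContinuous q) x ∂(P.map (X n)) = _
  rw [integral_map (hX n).aemeasurable (f.compContinuous q).continuous.aestronglyMeasurable]
  refine integral_congr_ae (Eventually.of_forall fun ω => ?_)
  simp only [BoundedContinuousFunction.compContinuous_apply]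
  rw [Finset.sum_range]
  congr 1
  show ∑ k : Fin K, lam k * ((√(n:ℝ))⁻¹ * ∑ t ∈ Finset.range n, Y k (Z t ω)) ^ 2 = _
  refine Finset.sum_congr rfl fun k _ => ?_
  rw [mul_pow, inv_pow, Real.sq_sqrt (Nat.cast_nonneg n)]

end
end MixProc

section
variable {Ω Ω' : Type*} [MeasurableSpace Ω] [MeasurableSpace Ω'] {P : Measure Ω}
  [IsProbabilityMeasure P] {P' : Measure Ω'} [IsProbabilityMeasure P']

lemma gauss_cov {Γ : ℕ → ℕ → ℝ} (hsymm : ∀ i j, Γ i j = Γ j i)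
    (hpsd : ∀ (N : ℕ) (u : ℕ → ℝ), 0 ≤ ∑ i ∈ Finset.range N, ∑ j ∈ Finset.range N, u i * u j * Γ i j)
    {ζ : ℕ → (ℕ → ℝ) → ℝ} (hζm : ∀ k, Measurable (ζ k))
    (hζ : ∀ (N : ℕ) (u : ℕ → ℝ), Gm.map (fun g => ∑ i ∈ Finset.range N, u i * ζ i g) =
      gaussianReal 0 (∑ i ∈ Finset.range N, ∑ j ∈ Finset.range N, u i * u j * Γ i j).toNNReal) :
    (∀ i, MemLp (ζ i) 2 Gm) ∧ (∀ i, Gm.map (ζ i) = gaussianReal 0 (Γ i i).toNNReal) ∧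
      (∀ i, ∫ g, ζ i g ∂Gm = 0) ∧ ∀ i j, ∫ g, ζ i g * ζ j g ∂Gm = Γ i j := by
  have hlaw : ∀ X : (ℕ → ℝ) → ℝ, Measurable X → ∀ v : ℝ, 0 ≤ v → Gm.map X = gaussianReal 0 v.toNNReal →
      MemLp X 2 Gm ∧ ∫ g, X g ∂Gm = 0 ∧ ∫ g, X g ^ 2 ∂Gm = v := by
    intro X hX v hv hl
    refine ⟨?_, ?_, ?_⟩
    · have h1 : MemLp id 2 (Gm.map X) := by rw [hl]; exact memLp_id_gaussianReal' 2 (by simp)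
      exact (memLp_map_measure_iff (by fun_prop) hX.aemeasurable).1 h1
    · have := integral_map hX.aemeasurable (f := fun x : ℝ => x) (μ := Gm) (by fun_prop)
      rw [← this, hl, integral_id_gaussianReal]
    · have := integral_map hX.aemeasurable (f := fun x : ℝ => x ^ 2) (μ := Gm) (by fun_prop)
      rw [← this, hl]
      have h2 := variance_fun_id_gaussianReal (μ := 0) (v := v.toNNReal)
      rw [variance_of_integral_eq_zero (by fun_prop) (by simp)] at h2
      rw [h2, Real.coe_toNNReal _ hv]
  have h1 : ∀ i, Gm.map (ζ i) = gaussianReal 0 (Γ i i).toNNReal := fun i => by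
    have := hζ (i + 1) (Pi.single i 1)
    simpa [Pi.single_apply, Finset.sum_ite_eq, ite_and, ite_mul, mul_ite] using this
  have hd : ∀ i, 0 ≤ Γ i i := fun i => by
    have := hpsd (i + 1) (Pi.single i 1)
    simpa [Pi.single_apply, Finset.sum_ite_eq, ite_and, ite_mul, mul_ite] using this
  have h2 := fun i => hlaw (ζ i) (hζm i) (Γ i i) (hd i) (h1 i)
  refine ⟨fun i => (h2 i).1, h1, fun i => (h2 i).2.1, fun i j => ?_⟩
  have hq : ∑ a ∈ Finset.range (max i j + 1), ∑ b ∈ Finset.range (max i j + 1),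
      (Pi.single i 1 + Pi.single j 1 : ℕ → ℝ) a * (Pi.single i 1 + Pi.single j 1 : ℕ → ℝ) b * Γ a b =
      Γ i i + 2 * Γ i j + Γ j j := by
    simp [Pi.single_apply, add_mul, mul_add, Finset.sum_add_distrib]
    rw [hsymm j i]; ring
  have hs : ∀ g, ∑ a ∈ Finset.range (max i j + 1), (Pi.single i 1 + Pi.single j 1 : ℕ → ℝ) a * ζ a g =
      ζ i g + ζ j g := fun g => by
    simp [Pi.single_apply, add_mul, Finset.sum_add_distrib]
  have h3 := hζ (max i j + 1) (Pi.single i 1 + Pi.single j 1)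
  have h4 := hpsd (max i j + 1) (Pi.single i 1 + Pi.single j 1)
  rw [hq] at h3 h4
  simp only [hs] at h3
  have h5 := (hlaw _ ((hζm i).add (hζm j)) _ h4 h3).2.2
  have h6 : ∫ g, (ζ i g + ζ j g) ^ 2 ∂Gm = Γ i i + 2 * ∫ g, ζ i g * ζ j g ∂Gm + Γ j j := by
    rw [← (h2 i).2.2, ← (h2 j).2.2, ← integral_const_mul, ← integral_add, ← integral_add]
    · refine integral_congr_ae (Eventually.of_forall fun g => ?_)
      simp only; ring
    · exact (h2 i).1.integrable_sq.add (((h2 i).1.integrable_mul (h2 j).1).const_mul _)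
    · exact (h2 j).1.integrable_sq
    · exact (h2 i).1.integrable_sq
    · exact ((h2 i).1.integrable_mul (h2 j).1).const_mul _
  have h5' : ∫ g, (ζ i g + ζ j g) ^ 2 ∂Gm = Γ i i + 2 * Γ i j + Γ j j := h5
  linarith

/-- Approximation: double limit argument for sums of nonnegative terms. -/
lemma series_approx {a : ℕ → Ω → ℝ} (ham : ∀ k, Measurable (a k)) (ha0 : ∀ k ω, 0 ≤ a k ω)
    (hai : ∀ k, Integrable (a k) P) {T : Ω → ℝ}
    (hT : ∀ᵐ ω ∂P, HasSum (fun k => a k ω) (T ω)) {K : ℕ} {η : ℝ}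
    (hη : ∀ L, ∑ k ∈ Finset.Ico K L, ∫ ω, a k ω ∂P ≤ η) {f : ℝ → ℝ} {M : ℝ} (hfM : ∀ x, |f x| ≤ M)
    {c : ℝ≥0} (hf : LipschitzWith c f) :
    |∫ ω, f (T ω) ∂P - ∫ ω, f (∑ k ∈ Finset.range K, a k ω) ∂P| ≤ c * η := by
  have hSm : ∀ L, Measurable fun ω => f (∑ k ∈ Finset.range L, a k ω) := fun L =>
    hf.continuous.measurable.comp (Finset.measurable_fun_sum _ fun k _ => ham k)
  have hSi : ∀ L, Integrable (fun ω => f (∑ k ∈ Finset.range L, a k ω)) P := fun L =>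
    (integrable_const M).mono' (hSm L).aestronglyMeasurable (Eventually.of_forall fun ω => hfM _)
  have hlim : Tendsto (fun L => ∫ ω, f (∑ k ∈ Finset.range L, a k ω) ∂P) atTop
      (𝓝 (∫ ω, f (T ω) ∂P)) := by
    refine tendsto_integral_of_dominated_convergence (fun _ => M)
      (fun L => (hSm L).aestronglyMeasurable) (integrable_const M)
      (fun L => Eventually.of_forall fun ω => hfM _) ?_
    filter_upwards [hT] with ω hω
    exact (hf.continuous.tendsto _).comp hω.tendsto_sum_nat
  have h1 := (hlim.sub_const (∫ ω, f (∑ k ∈ Finset.range K, a k ω) ∂P)).abs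
  refine le_of_tendsto h1 ?_
  filter_upwards [eventually_ge_atTop K] with L hL
  rw [← integral_sub (hSi L) (hSi K)]
  refine abs_integral_le_integral_abs.trans ?_
  have h2 : ∀ ω, |f (∑ k ∈ Finset.range L, a k ω) - f (∑ k ∈ Finset.range K, a k ω)| ≤
      c * ∑ k ∈ Finset.Ico K L, a k ω := fun ω => by
    have := hf.dist_le_mul (∑ k ∈ Finset.range L, a k ω) (∑ k ∈ Finset.range K, a k ω)
    rw [Real.dist_eq, Real.dist_eq, ← Finset.sum_Ico_eq_sub _ hL,
      abs_of_nonneg (Finset.sum_nonneg fun k _ => ha0 k ω)] at this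
    exact this
  refine (integral_mono ((hSi L).sub (hSi K)).abs
    ((integrable_finsetSum _ fun k _ => hai k).const_mul _) h2).trans ?_
  rw [integral_const_mul, integral_finsetSum _ fun k _ => hai k]
  exact mul_le_mul_of_nonneg_left (hη L) c.2

lemma series_summable {a : ℕ → Ω → ℝ} (ham : ∀ k, Measurable (a k)) (ha0 : ∀ k ω, 0 ≤ a k ω)
    (hai : ∀ k, Integrable (a k) P) {K : ℕ} {η : ℝ}
    (hη : ∀ L, ∑ k ∈ Finset.Ico K L, ∫ ω, a k ω ∂P ≤ η) :
    ∀ᵐ ω ∂P, Summable fun k => a k ω := by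
  have hs : Summable fun k => ∫ ω, a k ω ∂P := by
    refine summable_of_sum_range_le (c := ∑ k ∈ Finset.range K, ∫ ω, a k ω ∂P + η)
      (fun k => integral_nonneg (ha0 k)) fun L => ?_
    have h1 : ∑ k ∈ Finset.range L, ∫ ω, a k ω ∂P ≤
        ∑ k ∈ Finset.range K ∪ Finset.Ico K L, ∫ ω, a k ω ∂P :=
      Finset.sum_le_sum_of_subset_of_nonneg (by intro x; simp; omega)
        fun k _ _ => integral_nonneg (ha0 k)
    rw [Finset.sum_union] at h1
    · linarith [hη L]
    · rw [Finset.disjoint_left]; intro x hx hx'; simp at hx hx'; omega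
  have h2 : ∫⁻ ω, ∑' k, ENNReal.ofReal (a k ω) ∂P ≠ ∞ := by
    rw [lintegral_tsum fun k => (ham k).ennreal_ofReal.aemeasurable]
    have : ∀ k, ∫⁻ ω, ENNReal.ofReal (a k ω) ∂P = ENNReal.ofReal (∫ ω, a k ω ∂P) := fun k =>
      (ofReal_integral_eq_lintegral_ofReal (hai k) (Eventually.of_forall (ha0 k))).symm
    simp_rw [this]
    rw [← ENNReal.ofReal_tsum_of_nonneg (fun k => integral_nonneg (ha0 k)) hs]
    exact ENNReal.ofReal_ne_top
  have h3 := ae_lt_top (Measurable.tsum fun k => (ham k).ennreal_ofReal) h2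
  filter_upwards [h3] with ω hω
  have := ENNReal.summable_toReal hω.ne
  simpa [ENNReal.toReal_ofReal (ha0 _ ω)] using this

end
end

noncomputable section
set_option linter.unusedSectionVars false
set_option linter.unusedVariables false

namespace MixProc
section
variable {Ω 𝒵 : Type*} [MeasurableSpace Ω] [m𝒵 : MeasurableSpace 𝒵] {P : Measure Ω}
  [IsProbabilityMeasure P] {Z : ℕ → Ω → 𝒵} {p r C : ℝ}

theorem quad_limit (H : MixProc P Z p r C) {φ : ℕ → 𝒵 → ℝ} (hφ : ∀ i, Good P Z p (φ i))
    {lam : ℕ → ℝ} (hlam : ∀ k, 0 ≤ lam k) {T : ℕ → Ω → ℝ} (hTm : ∀ n, Measurable (T n))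
    (hT : ∀ n : ℕ, ∀ᵐ ω ∂P, HasSum (fun k => lam k * ((n : ℝ)⁻¹ *
      (∑ t ∈ Finset.range n, φ k (Z t ω)) ^ 2)) (T n ω))
    (htail : ∀ η : ℝ, 0 < η → ∃ K : ℕ, ∀ n L : ℕ, ∑ k ∈ Finset.Ico K L,
      lam k * ∫ ω, (∑ t ∈ Finset.range n, φ k (Z t ω)) ^ 2 ∂P ≤ n * η) :
    ∃ ζ : ℕ → (ℕ → ℝ) → ℝ, (∀ k, Measurable (ζ k)) ∧
      (∀ k, ∃ v : ℝ≥0, Gm.map (ζ k) = gaussianReal 0 v) ∧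
      (∀ k, ∫ g, ζ k g ∂Gm = 0) ∧
      (∀ i j, Tendsto (fun n : ℕ => (n : ℝ)⁻¹ *
        ∫ ω, (∑ t ∈ Finset.range n, φ i (Z t ω)) * (∑ t ∈ Finset.range n, φ j (Z t ω)) ∂P)
        atTop (𝓝 (∫ g, ζ i g * ζ j g ∂Gm))) ∧
      ∀ f : BoundedContinuousFunction ℝ ℝ, Tendsto (fun n : ℕ => ∫ ω, f (T n ω) ∂P) atTop
        (𝓝 (∫ g, f (∑' k, lam k * ζ k g ^ 2) ∂Gm)) := by
  obtain ⟨Γ, hΓ⟩ := H.exists_cov hφ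
  have hsymm : ∀ i j, Γ i j = Γ j i := fun i j =>
    tendsto_nhds_unique (hΓ i j) ((hΓ j i).congr fun n => by simp_rw [mul_comm])
  have hpsd : ∀ {ι : Type} (s : Finset ι) (c : ι → ℝ) (z : ι → ℕ),
      0 ≤ ∑ i ∈ s, ∑ j ∈ s, c i * c j * Γ (z i) (z j) := fun s c z =>
    ge_of_tendsto' (H.tendsto_var_lin hφ hΓ s c z) fun n =>
      mul_nonneg (by positivity) (integral_nonneg fun ω => sq_nonneg _)
  obtain ⟨ζ, hζm, hζ⟩ := gaussian_exists Γ hsymm fun m c z => hpsd Finset.univ c z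
  obtain ⟨h2, hlaw, hmean, hcov⟩ := gauss_cov hsymm (fun N u => hpsd (Finset.range N) u id) hζm hζ
  refine ⟨ζ, hζm, fun k => ⟨_, hlaw k⟩, hmean, fun i j => by rw [hcov]; exact hΓ i j, ?_⟩
  -- tails of the limit
  have htail2 : ∀ η : ℝ, 0 < η → ∃ K : ℕ, (∀ n L : ℕ, ∑ k ∈ Finset.Ico K L,
      ∫ ω, lam k * ((n : ℝ)⁻¹ * (∑ t ∈ Finset.range n, φ k (Z t ω)) ^ 2) ∂P ≤ η) ∧
      ∀ L, ∑ k ∈ Finset.Ico K L, ∫ g, lam k * ζ k g ^ 2 ∂Gm ≤ η := by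
    intro η hη
    obtain ⟨K, hK⟩ := htail η hη
    have h1 : ∀ n L : ℕ, ∑ k ∈ Finset.Ico K L,
        ∫ ω, lam k * ((n : ℝ)⁻¹ * (∑ t ∈ Finset.range n, φ k (Z t ω)) ^ 2) ∂P ≤ η := by
      intro n L
      have e : ∀ k, ∫ ω, lam k * ((n : ℝ)⁻¹ * (∑ t ∈ Finset.range n, φ k (Z t ω)) ^ 2) ∂P =
          (n : ℝ)⁻¹ * (lam k * ∫ ω, (∑ t ∈ Finset.range n, φ k (Z t ω)) ^ 2 ∂P) := fun k => by
        rw [integral_const_mul, integral_const_mul]; ring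
      simp only [e]
      rw [← Finset.mul_sum]
      rcases Nat.eq_zero_or_pos n with rfl | hn
      · simpa using hη.le
      · have hn' : (0 : ℝ) < n := by exact_mod_cast hn
        rw [inv_mul_le_iff₀ hn']
        exact hK n L
    refine ⟨K, h1, fun L => ?_⟩
    have h3 : Tendsto (fun n : ℕ => ∑ k ∈ Finset.Ico K L,
        ∫ ω, lam k * ((n : ℝ)⁻¹ * (∑ t ∈ Finset.range n, φ k (Z t ω)) ^ 2) ∂P) atTop
        (𝓝 (∑ k ∈ Finset.Ico K L, ∫ g, lam k * ζ k g ^ 2 ∂Gm)) := by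
      refine tendsto_finsetSum _ fun k _ => ?_
      simp_rw [integral_const_mul]
      refine Tendsto.const_mul _ ?_
      have := hΓ k k
      rw [← hcov] at this
      simpa only [← sq] using this
    exact le_of_tendsto' h3 fun n => h1 n L
  have hζi : ∀ k, Integrable (fun g => lam k * ζ k g ^ 2) Gm := fun k =>
    (h2 k).integrable_sq.const_mul _
  have hζmm : ∀ k, Measurable (fun g => lam k * ζ k g ^ 2) := fun k =>
    ((hζm k).pow_const 2).const_mul _
  have hζ0 : ∀ k g, 0 ≤ lam k * ζ k g ^ 2 := fun k g => mul_nonneg (hlam k) (sq_nonneg _)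
  have hsumm : ∀ᵐ g ∂Gm, HasSum (fun k => lam k * ζ k g ^ 2) (∑' k, lam k * ζ k g ^ 2) := by
    obtain ⟨K, -, hK⟩ := htail2 1 one_pos
    filter_upwards [series_summable hζmm hζ0 hζi hK] with g hg
    exact hg.hasSum
  have hTinf : Measurable fun g => ∑' k, lam k * ζ k g ^ 2 := Measurable.tsum hζmm
  have hni : ∀ (n k : ℕ), Integrable (fun ω => lam k * ((n : ℝ)⁻¹ *
      (∑ t ∈ Finset.range n, φ k (Z t ω)) ^ 2)) P := fun n k =>
    ((memLp_finsetSum _ fun t _ => (hφ k).memLp H t).integrable_sq.const_mul _).const_mul _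
  have hnm : ∀ (n k : ℕ), Measurable (fun ω => lam k * ((n : ℝ)⁻¹ *
      (∑ t ∈ Finset.range n, φ k (Z t ω)) ^ 2)) := fun n k =>
    (((Finset.measurable_fun_sum _ fun t _ => (hφ k).meas.comp (H.meas t)).pow_const 2).const_mul
      _).const_mul _
  have hn0 : ∀ (n k : ℕ) ω, 0 ≤ lam k * ((n : ℝ)⁻¹ *
      (∑ t ∈ Finset.range n, φ k (Z t ω)) ^ 2) := fun n k ω =>
    mul_nonneg (hlam k) (by positivity)
  -- the Lipschitz case
  have hLip : ∀ f : ℝ → ℝ, (∃ M, ∀ x, |f x| ≤ M) → (∃ c, LipschitzWith c f) →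
      Tendsto (fun n : ℕ => ∫ ω, f (T n ω) ∂P) atTop
        (𝓝 (∫ g, f (∑' k, lam k * ζ k g ^ 2) ∂Gm)) := by
    rintro f ⟨M, hM⟩ ⟨c, hc⟩
    rw [Metric.tendsto_atTop]
    intro δ hδ
    obtain ⟨K, hK1, hK2⟩ := htail2 (δ / (4 * (c + 1))) (by positivity)
    have hcδ : (c : ℝ) * (δ / (4 * (c + 1))) ≤ δ / 4 := by
      have : (0:ℝ) ≤ c := c.2
      rw [mul_div_assoc', div_le_div_iff₀ (by positivity) (by positivity)]
      nlinarith
    let F : BoundedContinuousFunction ℝ ℝ := BoundedContinuousFunction.ofNormedAddCommGroup f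
      hc.continuous M hM
    have hfd := H.finite_dim hφ hΓ hζm hζ K lam F
    rw [Metric.tendsto_atTop] at hfd
    obtain ⟨N, hN⟩ := hfd (δ / 4) (by positivity)
    refine ⟨N, fun n hn => ?_⟩
    have h3 := hN n hn
    have h4 := series_approx (hnm n) (hn0 n) (hni n) (hT n) (hK1 n) hM hc
    have h5 := series_approx hζmm hζ0 hζi hsumm hK2 hM hc
    rw [Real.dist_eq] at h3 ⊢
    have h3' : |(∫ ω, f (∑ k ∈ Finset.range K,
      lam k * ((n : ℝ)⁻¹ * (∑ t ∈ Finset.range n, φ k (Z t ω)) ^ 2)) ∂P) -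
      (∫ g, f (∑ k ∈ Finset.range K, lam k * ζ k g ^ 2) ∂Gm)| < δ / 4 := h3
    rw [abs_lt] at h3' ⊢
    rw [abs_le] at h4 h5
    constructor <;> linarith [h4.1, h4.2, h5.1, h5.2, h3'.1, h3'.2]
  let μs : ℕ → ProbabilityMeasure ℝ := fun n =>
    ⟨P.map (T n), Measure.isProbabilityMeasure_map (hTm n).aemeasurable⟩
  let μ : ProbabilityMeasure ℝ := ⟨Gm.map (fun g => ∑' k, lam k * ζ k g ^ 2),
    Measure.isProbabilityMeasure_map hTinf.aemeasurable⟩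
  have hmap1 : ∀ f : ℝ → ℝ, Continuous f → ∀ n, ∫ x, f x ∂(μs n : Measure ℝ) = ∫ ω, f (T n ω) ∂P :=
    fun f hf n => integral_map (hTm n).aemeasurable hf.aestronglyMeasurable
  have hmap2 : ∀ f : ℝ → ℝ, Continuous f → ∫ x, f x ∂(μ : Measure ℝ) =
      ∫ g, f (∑' k, lam k * ζ k g ^ 2) ∂Gm :=
    fun f hf => integral_map hTinf.aemeasurable hf.aestronglyMeasurable
  have hlim : Tendsto μs atTop (𝓝 μ) := by
    rw [tendsto_iff_forall_lipschitz_integral_tendsto]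
    rintro f ⟨M, hM⟩ ⟨c, hc⟩
    simp_rw [hmap1 f hc.continuous, hmap2 f hc.continuous]
    refine hLip f ⟨|f 0| + M, fun x => ?_⟩ ⟨c, hc⟩
    have h3 := hM x 0
    rw [Real.dist_eq] at h3
    have h4 := abs_sub_abs_le_abs_sub (f x) (f 0)
    linarith
  intro f
  have := ProbabilityMeasure.tendsto_iff_forall_integral_tendsto.1 hlim f
  rw [hmap2 f f.continuous] at this
  refine this.congr fun n => ?_
  exact hmap1 f f.continuous n

end
end MixProc
end

/-- Asymptotic distribution of degenerate V-statistics of order 2 under a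
strong mixing condition: `nV` converges in distribution to `∑ λ_k ζ_k²` where the `λ_k`
are the nonnegative eigenvalues of the integral operator with kernel `h` (with matching
eigenfunctions `φ_k`) and the `ζ_k` are centered Gaussian with covariances
`lim_n n⁻¹ ∑_{t,u≤n} Cov(φ_i(Z_t), φ_j(Z_u))`. -/
theorem degenerate_vstatistic_clt_alpha_mixing
    {𝒵 : Type*} [TopologicalSpace 𝒵] [TopologicalSpace.MetrizableSpace 𝒵]
    [SigmaCompactSpace 𝒵] [MeasurableSpace 𝒵] [BorelSpace 𝒵]
    {Ω : Type*} [MeasurableSpace Ω] (P : Measure Ω) [IsProbabilityMeasure P]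
    (Z : ℕ → Ω → 𝒵) (hZmeas : ∀ i, Measurable (Z i))
    -- strict stationarity
    (hstat : MeasurePreserving shift (P.map fun ω i => Z i ω) (P.map fun ω i => Z i ω))
    (θ : Measure 𝒵) (hθ : θ = P.map (Z 0))
    (h : 𝒵 → 𝒵 → ℝ)
    (hcont : Continuous (Function.uncurry h))
    (hsymm : ∀ z z', h z z' = h z' z)
    -- degeneracy
    (hdeg : ∀ᵐ z ∂θ, ∫ z', h z z' ∂θ = 0)
    -- positive semidefiniteness
    (hpsd : ∀ (m : ℕ) (c : Fin m → ℝ) (z : Fin m → 𝒵),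
      0 ≤ ∑ i, ∑ j, c i * c j * h (z i) (z j))
    (ε : ℝ) (hε : 0 < ε)
    -- finite (2+ε)-moments w.r.t. θ² and finite (1+ε/2)-moments on the diagonal
    (hmom : Integrable (fun p : 𝒵 × 𝒵 => |h p.1 p.2| ^ (2 + ε)) (θ.prod θ))
    (hmomdiag : Integrable (fun ω => |h (Z 0 ω) (Z 0 ω)| ^ (1 + ε / 2)) P)
    -- α-mixing with α(n) = O(n^{-r}), r > 1 + 2/ε
    (r : ℝ) (hr : 1 + 2 / ε < r)
    (C : ℝ) (hmix : ∀ n : ℕ, 1 ≤ n → alphaProc P Z n ≤ C * (n : ℝ) ^ (-r)) :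
    ∃ (lam : ℕ → ℝ) (φ : ℕ → 𝒵 → ℝ),
      (∀ k, 0 ≤ lam k) ∧
      (∀ k, Measurable (φ k)) ∧
      -- eigenpairs of the integral operator f ↦ ∫ h(·,z) f(z) dθ(z)
      (∀ k, ∀ᵐ z ∂θ, ∫ z', h z z' * φ k z' ∂θ = lam k * φ k z) ∧
      (∀ k, lam k ≠ 0 → ∫ z, φ k z ^ 2 ∂θ = 1) ∧
      ∃ (Ω' : Type) (mΩ' : MeasurableSpace Ω') (P' : Measure Ω')
        (_ : IsProbabilityMeasure P') (ζ : ℕ → Ω' → ℝ),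
        (∀ k, Measurable (ζ k)) ∧
        -- the ζ_k are centered Gaussian
        (∀ k, ∃ v : ℝ≥0, P'.map (ζ k) = gaussianReal 0 v) ∧
        -- covariance structure Cov(ζ_i,ζ_j) = lim_n n⁻¹ ∑_{t,u<n} Cov(φ_i(Z_t),φ_j(Z_u))
        (∀ i j, Tendsto
          (fun n : ℕ => (n : ℝ)⁻¹ * ∑ t ∈ Finset.range n, ∑ u ∈ Finset.range n,
            (∫ ω, φ i (Z t ω) * φ j (Z u ω) ∂P
              - (∫ ω, φ i (Z t ω) ∂P) * (∫ ω, φ j (Z u ω) ∂P)))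
          atTop
          (𝓝 (∫ ω', ζ i ω' * ζ j ω' ∂P'
              - (∫ ω', ζ i ω' ∂P') * (∫ ω', ζ j ω' ∂P')))) ∧
        -- convergence in distribution of nV to ∑ λ_k ζ_k²
        (∀ f : BoundedContinuousFunction ℝ ℝ,
          Tendsto (fun n : ℕ => ∫ ω,
              f ((n : ℝ) * (((n : ℝ) ^ 2)⁻¹ *
                ∑ i ∈ Finset.range n, ∑ j ∈ Finset.range n, h (Z i ω) (Z j ω))) ∂P)
            atTop (𝓝 (∫ ω', f (∑' k, lam k * ζ k ω' ^ 2) ∂P'))) := by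
  have hp2 : (2 + ε) / 2 = 1 + ε / 2 := by ring
  have hC : 0 ≤ C := by
    have := mix_sets hmix 0 1 le_rfl ∅ ∅
      (@MeasurableSet.empty _ (sigmaUpTo Z (0 + 1))) (@MeasurableSet.empty _ (sigmaFrom Z (0 + 1)))
    simpa using this
  have H : MixProc P Z (2 + ε) r C := by
    refine ⟨hZmeas, fun m => stat_iter hZmeas hstat m, fun l n hn a b ha hb =>
      mix_sets hmix l n hn a b ha hb, by linarith, ?_, hC⟩
    have h1 : 1 - 2 / (2 + ε) = ε / (2 + ε) := by field_simp; ring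
    rw [h1, mul_div_assoc', lt_div_iff₀ (by positivity)]
    have h2 : (1 + 2 / ε) * ε = 2 + ε := by field_simp; ring
    nlinarith
  have hθp : IsProbabilityMeasure θ := by
    rw [hθ]; exact Measure.isProbabilityMeasure_map (hZmeas 0).aemeasurable
  have hIntgθ : ∀ f : 𝒵 → ℝ, Measurable f → ∫ z, f z ∂θ = ∫ ω, f (Z 0 ω) ∂P := fun f hf => by
    rw [hθ, integral_map (hZmeas 0).aemeasurable hf.aestronglyMeasurable]
  have hIθ : ∀ f : 𝒵 → ℝ, Measurable f → (Integrable f θ ↔ Integrable (fun ω => f (Z 0 ω)) P) :=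
    fun f hf => by
      rw [hθ, integrable_map_measure hf.aestronglyMeasurable (hZmeas 0).aemeasurable]; rfl
  have : SecondCountableTopology 𝒵 := by
    let _ := TopologicalSpace.metrizableSpaceMetric 𝒵
    infer_instance
  have hhm : Measurable (Function.uncurry h) := hcont.measurable
  have hdm : Measurable fun z => h z z := (hcont.comp (continuous_id.prodMk continuous_id)).measurable
  have hd0 : ∀ z, 0 ≤ h z z := fun z => by
    have := hpsd 1 (fun _ => 1) (fun _ => z)
    simpa using this
  have hmd : Integrable (fun ω => h (Z 0 ω) (Z 0 ω) ^ ((2 + ε) / 2)) P := by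
    rw [hp2]
    simpa only [abs_of_nonneg (hd0 _)] using hmomdiag
  have hdiag : Integrable (fun z => h z z) θ := by
    rw [hIθ _ hdm]
    have := memLp_of_rpow (P := P) (p := 1 + ε / 2) (by linarith)
      (hdm.comp (hZmeas 0)).aestronglyMeasurable hmomdiag
    exact this.integrable (by
      rw [← ENNReal.ofReal_one]; exact ENNReal.ofReal_le_ofReal (by linarith))
  obtain ⟨lam, ψ, hlam, hψm, hψs, hψe, hψn⟩ := mercer θ h hcont hsymm hpsd hdiag
  have hψs2 : ∀ z, HasSum (fun k => ψ k z ^ 2) (h z z) := fun z => by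
    simpa only [sq] using hψs z z
  have hψb : ∀ k z, ψ k z ^ 2 ≤ h z z := fun k z =>
    le_hasSum (hψs2 z) k fun j _ => sq_nonneg _
  have hψ2 : ∀ k, Integrable (fun z => ψ k z ^ 2) θ := fun k =>
    hdiag.mono' ((hψm k).pow_const 2).aestronglyMeasurable (Eventually.of_forall fun z => by
      rw [Real.norm_eq_abs, abs_of_nonneg (sq_nonneg _)]; exact hψb k z)
  have hψL : ∀ k, MemLp (ψ k) 2 θ := fun k =>
    (memLp_two_iff_integrable_sq (hψm k).aestronglyMeasurable).2 (hψ2 k)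
  have hψz : ∀ k, lam k = 0 → ψ k =ᵐ[θ] 0 := fun k hk => by
    have h1 := hψn k
    rw [hk, integral_eq_zero_iff_of_nonneg (fun z => sq_nonneg _) (hψ2 k)] at h1
    filter_upwards [h1] with z hz
    simpa using hz
  have hmean : ∀ k, ∫ z, ψ k z ∂θ = 0 := by
    intro k
    by_cases hk : lam k = 0
    · rw [integral_congr_ae (hψz k hk)]; simp
    have hI : Integrable (fun q : 𝒵 × 𝒵 => h q.1 q.2 * ψ k q.2) (θ.prod θ) := by
      have h1 : MemLp (fun q : 𝒵 × 𝒵 => h q.1 q.2) 2 (θ.prod θ) :=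
        memLp_two_of_rpow H.hp hhm.aestronglyMeasurable hmom
      have h2 : MemLp (fun q : 𝒵 × 𝒵 => ψ k q.2) 2 (θ.prod θ) :=
        (hψL k).comp_measurePreserving measurePreserving_snd
      exact h1.integrable_mul h2
    have h3 : lam k * ∫ z, ψ k z ∂θ = 0 := by
      rw [← integral_const_mul]
      simp_rw [← hψe k]
      rw [integral_integral_swap (f := fun z z' => h z z' * ψ k z') hI]
      have h4 : ∀ᵐ z' ∂θ, ∫ z, h z z' * ψ k z' ∂θ = 0 := by
        filter_upwards [hdeg] with z' hz'
        rw [integral_mul_const]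
        simp_rw [fun z => hsymm z z']
        rw [hz', zero_mul]
      rw [integral_congr_ae h4]; simp
    exact (mul_eq_zero.1 h3).resolve_left hk
  have hψg : ∀ k, MixProc.Good P Z (2 + ε) (ψ k) := by
    intro k
    refine ⟨hψm k, ?_, by rw [← hIntgθ _ (hψm k)]; exact hmean k⟩
    refine hmd.mono' (((hψm k).comp (hZmeas 0)).abs.pow_const _).aestronglyMeasurable
      (Eventually.of_forall fun ω => ?_)
    rw [Real.norm_eq_abs, abs_of_nonneg (by positivity)]
    have h1 : |ψ k (Z 0 ω)| ^ (2 + ε) = (ψ k (Z 0 ω) ^ 2) ^ ((2 + ε) / 2) := by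
      rw [← sq_abs, ← Real.rpow_natCast, ← Real.rpow_mul (abs_nonneg _)]
      congr 1; push_cast; ring
    rw [h1]
    exact Real.rpow_le_rpow (sq_nonneg _) (hψb k _) (by positivity)
  let φ : ℕ → 𝒵 → ℝ := fun k z => (√(lam k))⁻¹ * ψ k z
  have hφm : ∀ k, Measurable (φ k) := fun k => (hψm k).const_mul _
  have hφg : ∀ k, MixProc.Good P Z (2 + ε) (φ k) := fun k => by
    simpa using MixProc.Good.lin H {k} (fun i => (√(lam i))⁻¹) (fun i _ => hψg i)
  have hae : ∀ᵐ ω ∂P, ∀ k t, ψ k (Z t ω) = √(lam k) * φ k (Z t ω) := by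
    rw [ae_all_iff]; intro k
    rw [ae_all_iff]; intro t
    by_cases hk : lam k = 0
    · have h1 := H.integral_one (Y := fun z => ψ k z ^ 2) ((hψm k).pow_const 2) t
      rw [← hIntgθ _ ((hψm k).pow_const 2), hψn k, hk,
        integral_eq_zero_iff_of_nonneg (fun z => sq_nonneg _) ((hψg k).memLp H t).integrable_sq] at h1
      filter_upwards [h1] with ω hω
      have h2 : ψ k (Z t ω) = 0 := by simpa using hω
      rw [h2, hk]; simp
    · refine Eventually.of_forall fun ω => ?_
      have h1 : √(lam k) ≠ 0 := (Real.sqrt_pos.2 (lt_of_le_of_ne (hlam k) (Ne.symm hk))).ne'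
      simp only [φ]
      rw [← mul_assoc, mul_inv_cancel₀ h1, one_mul]
  have hsumae : ∀ᵐ ω ∂P, ∀ k (n : ℕ), (∑ t ∈ Finset.range n, ψ k (Z t ω)) ^ 2 =
      lam k * (∑ t ∈ Finset.range n, φ k (Z t ω)) ^ 2 := by
    filter_upwards [hae] with ω hω k n
    simp_rw [hω]
    rw [← Finset.mul_sum, mul_pow, Real.sq_sqrt (hlam k)]
  let T : ℕ → Ω → ℝ := fun n ω => (n : ℝ) * (((n : ℝ) ^ 2)⁻¹ *
    ∑ i ∈ Finset.range n, ∑ j ∈ Finset.range n, h (Z i ω) (Z j ω))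
  have hTm : ∀ n, Measurable (T n) := fun n =>
    ((Finset.measurable_fun_sum _ fun i _ => Finset.measurable_fun_sum _ fun j _ =>
      hhm.comp ((hZmeas i).prodMk (hZmeas j))).const_mul _).const_mul _
  have hT : ∀ n : ℕ, ∀ᵐ ω ∂P, HasSum (fun k => lam k * ((n : ℝ)⁻¹ *
      (∑ t ∈ Finset.range n, φ k (Z t ω)) ^ 2)) (T n ω) := by
    intro n
    filter_upwards [hsumae] with ω hω
    have h1 : HasSum (fun k => ∑ i ∈ Finset.range n, ∑ j ∈ Finset.range n,
        ψ k (Z i ω) * ψ k (Z j ω))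
        (∑ i ∈ Finset.range n, ∑ j ∈ Finset.range n, h (Z i ω) (Z j ω)) :=
      hasSum_sum fun i _ => hasSum_sum fun j _ => hψs _ _
    have h2 := (h1.mul_left (((n : ℝ) ^ 2)⁻¹)).mul_left (n : ℝ)
    refine h2.congr_fun fun k => ?_
    rw [← Finset.sum_mul_sum, ← sq, hω k n]
    rcases Nat.eq_zero_or_pos n with rfl | hn
    · simp
    · have hn' : (n : ℝ) ≠ 0 := by exact_mod_cast hn.ne'
      field_simp
  have htail : ∀ η : ℝ, 0 < η → ∃ K : ℕ, ∀ n L : ℕ, ∑ k ∈ Finset.Ico K L,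
      lam k * ∫ ω, (∑ t ∈ Finset.range n, φ k (Z t ω)) ^ 2 ∂P ≤ n * η := by
    intro η hη
    obtain ⟨K, hK⟩ := H.hilbert_tail hψg hψs2 hmd hη
    refine ⟨K, fun n L => (le_of_eq ?_).trans (hK n L)⟩
    refine Finset.sum_congr rfl fun k _ => ?_
    rw [← integral_const_mul]
    refine integral_congr_ae ?_
    filter_upwards [hsumae] with ω hω
    exact (hω k n).symm
  obtain ⟨ζ, hζm, hζg, hζ0, hζc, hζl⟩ := H.quad_limit hφg hlam hTm hT htail
  refine ⟨lam, φ, hlam, hφm, fun k => Eventually.of_forall fun z => ?_, fun k hk => ?_,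
    ℕ → ℝ, inferInstance, Gm, inferInstance, ζ, hζm, hζg, fun i j => ?_, hζl⟩
  · simp only [φ]
    simp_rw [mul_left_comm (h z _)]
    rw [integral_const_mul, hψe]; ring
  · simp only [φ, mul_pow]
    rw [integral_const_mul, hψn, inv_pow, Real.sq_sqrt (hlam k), inv_mul_cancel₀ hk]
  · rw [hζ0, zero_mul, sub_zero]
    refine (hζc i j).congr fun n => ?_
    congr 1
    have hL := fun k t => (hφg k).memLp H t
    have hI : ∀ t u, Integrable (fun ω => φ i (Z t ω) * φ j (Z u ω)) P :=
      fun t u => (hL i t).integrable_mul (hL j u)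
    simp_rw [Finset.sum_mul_sum]
    rw [integral_finsetSum _ fun t _ => integrable_finsetSum _ fun u _ => hI t u]
    refine Finset.sum_congr rfl fun t _ => ?_
    rw [integral_finsetSum _ fun u _ => hI t u]
    refine Finset.sum_congr rfl fun u _ => ?_
    rw [H.integral_one (hφm i) t, (hφg i).mean, zero_mul, sub_zero]
end
end

section
/- Let (X_k)_{k∈ℕ} be a strictly stationary and ergodic sequence with values in a separable metric space (𝒳, d), marginal distribution μ = L(X₁) with finite first moment E d(X₁, x₀) < ∞, and let μₙ denote the empirical measure of X₁, ..., Xₙ. Then D(μₙ) = n^{-2} Σ_{k,l=1}^n d(X_k, X_l) converges almost surely to D(μ) = ∫ d(x, x') dμ²(x, x') as n → ∞. -/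
open MeasureTheory Filter Topology

noncomputable section

/-- running maxima of Birkhoff sums -/
def maxSum {α : Type*} (T : α → α) (g : α → ℝ) : ℕ → α → ℝ
  | 0 => fun _ => 0
  | n + 1 => fun x => max 0 (g x + maxSum T g n (T x))

lemma maxSum_nonneg {α : Type*} (T : α → α) (g : α → ℝ) (n : ℕ) (x : α) :
    0 ≤ maxSum T g n x := by
  cases n with
  | zero => exact le_rfl
  | succ n => exact le_max_left _ _

lemma maxSum_le_succ {α : Type*} (T : α → α) (g : α → ℝ) (n : ℕ) :
    ∀ x, maxSum T g n x ≤ maxSum T g (n + 1) x := by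
  induction n with
  | zero => intro x; exact le_max_left _ _
  | succ n ih =>
    intro x
    exact max_le_max le_rfl (by have := ih (T x); gcongr)

lemma birkhoffSum_le_maxSum {α : Type*} (T : α → α) (g : α → ℝ) (n : ℕ) :
    ∀ x, birkhoffSum T g n x ≤ maxSum T g n x := by
  induction n with
  | zero => intro x; simp [maxSum]
  | succ n ih =>
    intro x
    rw [birkhoffSum_succ']
    exact le_trans (by have := ih (T x); gcongr) (le_max_right _ _)

lemma maxSum_measurable {α : Type*} [MeasurableSpace α] {T : α → α} (hT : Measurable T)
    {g : α → ℝ} (hg : Measurable g) (n : ℕ) : Measurable (maxSum T g n) := by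
  induction n with
  | zero => exact measurable_const
  | succ n ih => exact measurable_const.max (hg.add (ih.comp hT))

lemma maxSum_integrable {α : Type*} [MeasurableSpace α] {m : Measure α} [IsProbabilityMeasure m]
    {T : α → α} (hT : MeasurePreserving T m m)
    {g : α → ℝ} (hg : Integrable g m) (n : ℕ) : Integrable (maxSum T g n) m := by
  induction n with
  | zero => exact integrable_const _
  | succ n ih =>
    exact (integrable_const (0 : ℝ)).sup (hg.add (hT.integrable_comp_of_integrable ih))

lemma bdd_of_neg {α : Type*} [MeasurableSpace α] {m : Measure α} [IsProbabilityMeasure m]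
    {T : α → α} (hT : Ergodic T m)
    {g : α → ℝ} (hgm : Measurable g) (hg : Integrable g m) (hneg : ∫ x, g x ∂m < 0) :
    ∀ᵐ x ∂m, ∃ K : ℕ, ∀ n, birkhoffSum T g n x ≤ K := by
  set A : Set α := {x | ∃ K : ℕ, ∀ n, maxSum T g n x ≤ K} with hA
  have hTm := hT.toMeasurePreserving
  have hAm : MeasurableSet A := by
    have : A = ⋃ K : ℕ, ⋂ n, {x | maxSum T g n x ≤ K} := by ext; simp [hA]
    rw [this]
    exact MeasurableSet.iUnion fun K => MeasurableSet.iInter fun n =>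
      measurableSet_le (maxSum_measurable hTm.measurable hgm n) measurable_const
  have hinv : T ⁻¹' A = A := by
    ext x
    constructor
    · rintro ⟨K, hK⟩
      obtain ⟨L, hL⟩ := exists_nat_ge (|g x| + K)
      refine ⟨L, fun n => ?_⟩
      cases n with
      | zero => exact Nat.cast_nonneg _
      | succ n =>
        refine max_le (Nat.cast_nonneg _) ?_
        linarith [hK n, le_abs_self (g x)]
    · rintro ⟨K, hK⟩
      obtain ⟨L, hL⟩ := exists_nat_ge (|g x| + K)
      refine ⟨L, fun n => ?_⟩
      have h1 : g x + maxSum T g n (T x) ≤ K := le_trans (le_max_right 0 _) (hK (n + 1))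
      linarith [neg_abs_le (g x)]
  have hmain : ∀ᵐ x ∂m, x ∈ A := by
    rcases hT.toPreErgodic.prob_eq_zero_or_one hAm hinv with h0 | h1
    · exfalso
      have hae : ∀ᵐ x ∂m, x ∉ A := measure_eq_zero_iff_ae_notMem.mp h0
      have hae' : ∀ᵐ x ∂m, T x ∉ A := by
        filter_upwards [hae] with x hx h
        exact hx (by rw [← hinv]; exact h)
      have hlim : Tendsto (fun n => ∫ x, (maxSum T g (n + 1) x - maxSum T g n (T x)) ∂m)
          atTop (𝓝 (∫ x, g x ∂m)) := by
        refine tendsto_integral_of_dominated_convergence (fun x => |g x|) ?_ hg.abs ?_ ?_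
        · intro n
          exact ((maxSum_measurable hTm.measurable hgm _).sub
            ((maxSum_measurable hTm.measurable hgm _).comp hTm.measurable)).aestronglyMeasurable
        · intro n
          refine Eventually.of_forall fun x => ?_
          have h0 := maxSum_nonneg T g n (T x)
          simp only [maxSum, Real.norm_eq_abs]
          rw [abs_le]
          constructor
          · linarith [le_max_right 0 (g x + maxSum T g n (T x)), neg_abs_le (g x)]
          · have : max 0 (g x + maxSum T g n (T x)) ≤ |g x| + maxSum T g n (T x) :=
              max_le (by positivity) (by linarith [le_abs_self (g x)])
            linarith
        · filter_upwards [hae'] with x hx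
          obtain ⟨K, hK⟩ := exists_nat_ge (-g x)
          have : ∃ n, (K : ℝ) < maxSum T g n (T x) := by
            by_contra! hcon
            exact hx ⟨K, hcon⟩
          obtain ⟨N, hN⟩ := this
          refine tendsto_const_nhds.congr' ?_
          filter_upwards [eventually_ge_atTop N] with n hn
          have hmono : Monotone fun n => maxSum T g n (T x) :=
            monotone_nat_of_le_succ fun n => maxSum_le_succ T g n (T x)
          have := hmono hn
          simp only at this
          simp only [maxSum]
          rw [max_eq_right (by linarith)]
          ring
      have hnn : ∀ n, 0 ≤ ∫ x, (maxSum T g (n + 1) x - maxSum T g n (T x)) ∂m := by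
        intro n
        have hcomp : Integrable (fun x => maxSum T g n (T x)) m :=
          hTm.integrable_comp_of_integrable (maxSum_integrable hTm hg n)
        rw [integral_sub (maxSum_integrable hTm hg _) hcomp]
        have : ∫ x, maxSum T g n (T x) ∂m = ∫ x, maxSum T g n x ∂m := by
          conv_rhs => rw [← hTm.map_eq]
          rw [integral_map hTm.measurable.aemeasurable
            (maxSum_measurable hTm.measurable hgm n).aestronglyMeasurable]
        rw [this, sub_nonneg]
        exact integral_mono (maxSum_integrable hTm hg _) (maxSum_integrable hTm hg _)
          (maxSum_le_succ T g n)
      exact absurd (ge_of_tendsto' hlim hnn) (not_le.mpr hneg)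
    · exact (mem_ae_iff_prob_eq_one hAm).mpr h1
  filter_upwards [hmain] with x ⟨K, hK⟩
  exact ⟨K, fun n => (birkhoffSum_le_maxSum T g n x).trans (hK n)⟩

lemma birkhoff_upper {α : Type*} [MeasurableSpace α] {m : Measure α} [IsProbabilityMeasure m]
    {T : α → α} (hT : Ergodic T m)
    {f : α → ℝ} (hfm : Measurable f) (hf : Integrable f m) :
    ∀ᵐ x ∂m, ∀ ε > 0, ∀ᶠ n : ℕ in atTop,
      (n : ℝ)⁻¹ * birkhoffSum T f n x ≤ ∫ y, f y ∂m + ε := by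
  have key : ∀ j : ℕ, ∀ᵐ x ∂m, ∃ K : ℕ, ∀ n,
      birkhoffSum T (fun y => f y - (∫ y, f y ∂m + 1 / ((j : ℝ) + 1))) n x ≤ K := by
    intro j
    have hj : (0 : ℝ) < 1 / ((j : ℝ) + 1) := by positivity
    refine bdd_of_neg hT (hfm.sub_const _) (hf.sub (integrable_const _)) ?_
    rw [integral_sub hf (integrable_const _)]
    simp only [integral_const, probReal_univ, one_smul]
    linarith
  filter_upwards [ae_all_iff.mpr key] with x hx ε hε
  obtain ⟨j, hj⟩ := exists_nat_one_div_lt (half_pos hε)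
  obtain ⟨K, hK⟩ := hx j
  obtain ⟨N, hN⟩ := exists_nat_ge (K / (ε / 2))
  filter_upwards [eventually_ge_atTop (N + 1)] with n hn
  have hn0 : (0 : ℝ) < n := by exact_mod_cast (by omega : 0 < n)
  have hNn : (N : ℝ) ≤ n := by exact_mod_cast (by omega : N ≤ n)
  have h1 := hK n
  simp only [birkhoffSum, Finset.sum_sub_distrib, Finset.sum_const, Finset.card_range,
    nsmul_eq_mul] at h1
  have h2 : (K : ℝ) ≤ n * (ε / 2) := by
    rw [div_le_iff₀ (half_pos hε)] at hN
    nlinarith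
  rw [inv_mul_le_iff₀ hn0]
  simp only [birkhoffSum]
  nlinarith

lemma birkhoff_tendsto {α : Type*} [MeasurableSpace α] {m : Measure α} [IsProbabilityMeasure m]
    {T : α → α} (hT : Ergodic T m)
    {f : α → ℝ} (hfm : Measurable f) (hf : Integrable f m) :
    ∀ᵐ x ∂m, Tendsto (fun n : ℕ => (n : ℝ)⁻¹ * birkhoffSum T f n x) atTop
      (𝓝 (∫ y, f y ∂m)) := by
  filter_upwards [birkhoff_upper hT hfm hf, birkhoff_upper hT hfm.neg hf.neg] with x h1 h2
  rw [Metric.tendsto_nhds]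
  intro ε hε
  filter_upwards [h1 (ε / 2) (by positivity), h2 (ε / 2) (by positivity)] with n a b
  simp only [birkhoffSum, Pi.neg_apply, Finset.sum_neg_distrib, integral_neg] at a b
  simp only [birkhoffSum, Real.dist_eq]
  rw [abs_lt]
  constructor <;> linarith

lemma vstat_det {X : Type*} [MetricSpace X] (u : ℕ → X) (g : X → ℝ) (φ : ℕ → X → X)
    (hfin : ∀ m, (Set.range (φ m)).Finite) (c : ℕ → ℝ) (hc : Tendsto c atTop (𝓝 0)) (D : ℝ)
    (hg : ∀ a b, |g a - g b| ≤ dist a b)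
    (h1 : ∀ m, Tendsto (fun n : ℕ => (n : ℝ)⁻¹ * ∑ k ∈ Finset.range n, dist (φ m (u k)) (u k))
      atTop (𝓝 (c m)))
    (h2 : ∀ m, ∀ a ∈ Set.range (φ m),
      Tendsto (fun n : ℕ => (n : ℝ)⁻¹ * ∑ k ∈ Finset.range n, dist (u k) a) atTop (𝓝 (g a)))
    (h3 : Tendsto (fun n : ℕ => (n : ℝ)⁻¹ * ∑ k ∈ Finset.range n, g (u k)) atTop (𝓝 D)) :
    Tendsto (fun n : ℕ => ((n : ℝ) ^ 2)⁻¹ *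
        ∑ k ∈ Finset.range n, ∑ l ∈ Finset.range n, dist (u k) (u l)) atTop (𝓝 D) := by
  rw [Metric.tendsto_nhds]
  intro ε hε
  have hδ : 0 < ε / 5 := by positivity
  set δ := ε / 5 with hδdef
  obtain ⟨m, hm⟩ := (hc.eventually (gt_mem_nhds hδ)).exists
  have e2 : ∀ᶠ n : ℕ in atTop, ∀ a ∈ Set.range (φ m),
      dist ((n : ℝ)⁻¹ * ∑ k ∈ Finset.range n, dist (u k) a) (g a) < δ := by
    rw [(hfin m).eventually_all]
    intro a ha
    exact Metric.tendsto_nhds.mp (h2 m a ha) δ hδ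
  filter_upwards [(h1 m).eventually (gt_mem_nhds hm), e2, Metric.tendsto_nhds.mp h3 δ hδ,
    eventually_ge_atTop 1] with n a1 a2 a3 hn
  have hn0 : (0 : ℝ) < n := by exact_mod_cast hn
  set F : X → ℝ := fun y => (n : ℝ)⁻¹ * ∑ k ∈ Finset.range n, dist (u k) y with hF
  have hFL : ∀ a b, |F a - F b| ≤ dist a b := by
    intro a b
    simp only [hF]
    rw [← mul_sub, ← Finset.sum_sub_distrib, abs_mul, abs_of_pos (inv_pos.mpr hn0),
      inv_mul_le_iff₀ hn0]
    refine (Finset.abs_sum_le_sum_abs _ _).trans ?_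
    refine (Finset.sum_le_card_nsmul _ _ (dist a b) fun k _ => ?_).trans ?_
    · rw [dist_comm (u k), dist_comm (u k)]
      exact abs_dist_sub_le a b (u k)
    · simp
  have hl : ∀ l, |F (u l) - g (u l)| ≤ δ + 2 * dist (φ m (u l)) (u l) := by
    intro l
    have b1 := hFL (φ m (u l)) (u l)
    have b2 := hg (φ m (u l)) (u l)
    have b3 := (a2 (φ m (u l)) ⟨_, rfl⟩).le
    rw [Real.dist_eq] at b3
    change |F (φ m (u l)) - g (φ m (u l))| ≤ δ at b3
    rw [abs_le] at *
    constructor <;> linarith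
  have hV : ((n : ℝ) ^ 2)⁻¹ * ∑ k ∈ Finset.range n, ∑ l ∈ Finset.range n, dist (u k) (u l)
      = (n : ℝ)⁻¹ * ∑ l ∈ Finset.range n, F (u l) := by
    simp only [hF]
    rw [Finset.sum_comm, ← Finset.mul_sum, ← mul_assoc, pow_two, mul_inv]
  have hd : |(n : ℝ)⁻¹ * ∑ l ∈ Finset.range n, F (u l)
      - (n : ℝ)⁻¹ * ∑ l ∈ Finset.range n, g (u l)| ≤ 3 * δ := by
    rw [← mul_sub, ← Finset.sum_sub_distrib, abs_mul, abs_of_pos (inv_pos.mpr hn0),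
      inv_mul_le_iff₀ hn0]
    refine (Finset.abs_sum_le_sum_abs _ _).trans ?_
    refine (Finset.sum_le_sum fun l _ => hl l).trans ?_
    rw [Finset.sum_add_distrib, ← Finset.mul_sum]
    rw [inv_mul_lt_iff₀ hn0] at a1
    simp only [Finset.sum_const, Finset.card_range, nsmul_eq_mul]
    linarith
  rw [hV, Real.dist_eq]
  rw [Real.dist_eq] at a3
  rw [abs_lt] at *
  rw [abs_le] at hd
  constructor <;> linarith

lemma shift_iterate {X : Type*} (k : ℕ) : ∀ x : ℕ → X, shift^[k] x 0 = x k := by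
  have : ∀ (x : ℕ → X) j, shift^[k] x j = x (j + k) := by
    induction k with
    | zero => intro x j; rfl
    | succ k ih =>
      intro x j
      rw [Function.iterate_succ_apply, ih]
      simp only [shift]
      congr 1
  intro x
  simpa using this x 0

lemma slln_path {X : Type*} [MeasurableSpace X]
    {Ω : Type*} [MeasurableSpace Ω] (P : Measure Ω) [IsProbabilityMeasure P]
    (Xs : ℕ → Ω → X) (hXmeas : ∀ i, Measurable (Xs i))
    (herg : Ergodic shift (P.map fun ω i => Xs i ω))
    (μ : Measure X) (hμ : μ = P.map (Xs 0))
    {f : X → ℝ} (hfm : Measurable f) (hf : Integrable f μ) :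
    ∀ᵐ ω ∂P, Tendsto (fun n : ℕ => (n : ℝ)⁻¹ * ∑ k ∈ Finset.range n, f (Xs k ω)) atTop
      (𝓝 (∫ x, f x ∂μ)) := by
  have hpath : Measurable fun ω i => Xs i ω := measurable_pi_lambda _ hXmeas
  have : IsProbabilityMeasure (P.map fun ω i => Xs i ω) :=
    Measure.isProbabilityMeasure_map hpath.aemeasurable
  have hmap : μ = (P.map fun ω i => Xs i ω).map (fun x => x 0) := by
    rw [Measure.map_map (measurable_pi_apply 0) hpath, hμ]
    rfl
  have hFm : Measurable (fun x : ℕ → X => f (x 0)) := hfm.comp (measurable_pi_apply 0)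
  have hFi : Integrable (fun x : ℕ → X => f (x 0)) (P.map fun ω i => Xs i ω) := by
    rw [hmap] at hf
    exact hf.comp_measurable (measurable_pi_apply 0)
  have hint : ∫ x, f x ∂μ = ∫ x : ℕ → X, f (x 0) ∂(P.map fun ω i => Xs i ω) := by
    rw [hmap, integral_map (measurable_pi_apply 0).aemeasurable hfm.aestronglyMeasurable]
  have h := ae_of_ae_map hpath.aemeasurable (birkhoff_tendsto herg hFm hFi)
  rw [hint]
  filter_upwards [h] with ω hω
  simpa only [birkhoffSum, shift_iterate] using hω

/-- For a strictly stationary ergodic sequence `(X_k)` in a separable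
metric space with marginal `μ` of finite first moment, the empirical quantity
`D(μₙ) = n⁻² ∑_{k,l} d(X_k, X_l)` converges almost surely to
`D(μ) = ∫ d(x,x') dμ²(x,x')`. -/
theorem empirical_D_strong_consistency
    {X : Type*} [MetricSpace X] [TopologicalSpace.SeparableSpace X]
    [MeasurableSpace X] [BorelSpace X]
    {Ω : Type*} [MeasurableSpace Ω] (P : Measure Ω) [IsProbabilityMeasure P]
    (Xs : ℕ → Ω → X) (hXmeas : ∀ i, Measurable (Xs i))
    -- strict stationarity and ergodicity
    (hstat : MeasurePreserving shift (P.map fun ω i => Xs i ω) (P.map fun ω i => Xs i ω))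
    (herg : Ergodic shift (P.map fun ω i => Xs i ω))
    (μ : Measure X) (hμ : μ = P.map (Xs 0))
    (x₀ : X) (hmom : Integrable (fun x => dist x x₀) μ) :
    ∀ᵐ ω ∂P, Tendsto
      (fun n : ℕ => ((n : ℝ) ^ 2)⁻¹ *
        ∑ k ∈ Finset.range n, ∑ l ∈ Finset.range n, dist (Xs k ω) (Xs l ω))
      atTop (𝓝 (∫ p : X × X, dist p.1 p.2 ∂(μ.prod μ))) := by
  have : SecondCountableTopology X := UniformSpace.secondCountable_of_separable X
  have : IsProbabilityMeasure μ := by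
    rw [hμ]; exact Measure.isProbabilityMeasure_map (hXmeas 0).aemeasurable
  set φ : ℕ → SimpleFunc X X := fun m =>
    SimpleFunc.approxOn id measurable_id Set.univ x₀ (Set.mem_univ _) m with hφ
  have hdi : ∀ a, Integrable (fun x => dist x a) μ := by
    intro a
    refine (hmom.add (integrable_const (dist x₀ a))).mono'
      (measurable_id.dist measurable_const).aestronglyMeasurable (Eventually.of_forall fun x => ?_)
    rw [Real.norm_eq_abs, abs_of_nonneg dist_nonneg]
    exact dist_triangle _ _ _
  set g : X → ℝ := fun a => ∫ x, dist x a ∂μ with hgdef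
  have hgL : ∀ a b, |g a - g b| ≤ dist a b := by
    intro a b
    simp only [hgdef]
    rw [← integral_sub (hdi a) (hdi b)]
    have h := norm_integral_le_of_norm_le_const (μ := μ) (C := dist a b)
      (f := fun x => dist x a - dist x b) (Eventually.of_forall fun x => by
        rw [Real.norm_eq_abs, dist_comm x, dist_comm x]
        exact abs_dist_sub_le a b x)
    simpa using h
  have hgc : Continuous g := by
    refine (LipschitzWith.of_dist_le_mul (K := 1) fun a b => ?_).continuous
    simpa [Real.dist_eq] using hgL a b
  have hgi : Integrable g μ := by
    refine (hmom.add (integrable_const |g x₀|)).mono'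
      hgc.measurable.aestronglyMeasurable (Eventually.of_forall fun x => ?_)
    have h1 := hgL x x₀
    have h2 := abs_sub_abs_le_abs_sub (g x) (g x₀)
    simp only [Real.norm_eq_abs, Pi.add_apply]
    linarith
  have hrle : ∀ m x, dist (φ m x) x ≤ dist x x₀ := by
    intro m x
    have h := SimpleFunc.edist_approxOn_le (f := (id : X → X)) measurable_id
      (Set.mem_univ x₀) x m
    rw [edist_dist, edist_dist, ENNReal.ofReal_le_ofReal_iff dist_nonneg, dist_comm x₀] at h
    exact h
  have hrm : ∀ m, Measurable fun x => dist (φ m x) x := fun m =>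
    (φ m).measurable.dist measurable_id
  have hri : ∀ m, Integrable (fun x => dist (φ m x) x) μ := fun m =>
    hmom.mono' (hrm m).aestronglyMeasurable (Eventually.of_forall fun x => by
      rw [Real.norm_eq_abs, abs_of_nonneg dist_nonneg]; exact hrle m x)
  have hc : Tendsto (fun m => ∫ x, dist (φ m x) x ∂μ) atTop (𝓝 0) := by
    have h := tendsto_integral_of_dominated_convergence (μ := μ)
      (F := fun m x => dist (φ m x) x) (f := fun _ => (0 : ℝ)) (fun x => dist x x₀)
      (fun m => (hrm m).aestronglyMeasurable) hmom
      (fun m => Eventually.of_forall fun x => by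
        rw [Real.norm_eq_abs, abs_of_nonneg dist_nonneg]; exact hrle m x)
      (Eventually.of_forall fun x => by
        have h := SimpleFunc.tendsto_approxOn (f := (id : X → X)) measurable_id
          (Set.mem_univ x₀) (x := x) (by simp)
        exact tendsto_iff_dist_tendsto_zero.mp h)
    simpa using h
  have hD : ∫ p : X × X, dist p.1 p.2 ∂(μ.prod μ) = ∫ a, g a ∂μ := by
    have hpi : Integrable (fun p : X × X => dist p.1 p.2) (μ.prod μ) := by
      refine ((hmom.comp_fst μ).add (hmom.comp_snd μ)).mono'
        continuous_dist.measurable.aestronglyMeasurable (Eventually.of_forall fun p => ?_)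
      rw [Real.norm_eq_abs, abs_of_nonneg dist_nonneg]
      exact dist_triangle_right _ _ _
    rw [integral_prod _ hpi]
    simp only [hgdef]
    refine integral_congr_ae (Eventually.of_forall fun a => ?_)
    simp only [dist_comm a]
  rw [hD]
  have A1 := ae_all_iff.mpr fun m => slln_path P Xs hXmeas herg μ hμ (hrm m) (hri m)
  have A2 : ∀ᵐ ω ∂P, ∀ m, ∀ a ∈ Set.range (φ m), Tendsto (fun n : ℕ => (n : ℝ)⁻¹ *
      ∑ k ∈ Finset.range n, dist (Xs k ω) a) atTop (𝓝 (g a)) := by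
    rw [ae_all_iff]
    intro m
    rw [ae_ball_iff (φ m).finite_range.countable]
    intro a _
    exact slln_path P Xs hXmeas herg μ hμ (measurable_id.dist measurable_const) (hdi a)
  have A3 := slln_path P Xs hXmeas herg μ hμ hgc.measurable hgi
  filter_upwards [A1, A2, A3] with ω h1 h2 h3
  exact vstat_det (fun k => Xs k ω) g (fun m => φ m) (fun m => (φ m).finite_range) _ hc _ hgL
    h1 h2 h3
end
end
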